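/- The operator ½I + K + L is injective: if (½I + K + L)μ = 0 then μ = 0. -/

import Mathlib

open MeasureTheory Real Filter

noncomputable section

abbrev E2 := EuclideanSpace ℝ (Fin 2)

/-- Kernel of the elastance operator `K`: `∂G(x,y)/∂n_x ds_y` with `x = γ i s` on
`Γ i` and `y = γ j t` on `Γ j`.  Here `∇_x G(x,y) = -(1/2π)(x-y)/|x-y|²`, `n_x` is
the unit outward normal `nrot(γ i)'(s)/‖(γ i)'(s)‖`, and `ds_y = ‖(γ j)'(t)‖ dt`. -/
def Kker {N : ℕ} (γ : Fin N → ℝ → E2) (i j : Fin N) (s t : ℝ) : ℝ :=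
  -(1/(2*π)) * ((γ i s - γ j t) 0 * deriv (γ i) s 1 - (γ i s - γ j t) 1 * deriv (γ i) s 0)
      / (‖γ i s - γ j t‖ ^ 2 * ‖deriv (γ i) s‖) * ‖deriv (γ j) t‖

open Topology

/-- A regular simple closed curve of class `C²`, parametrized with period `2π`. -/
structure IsJordanParam (g : ℝ → ℂ) : Prop where
  contDiff : ContDiff ℝ 2 g
  periodic : Function.Periodic g (2 * π)
  regular : ∀ t, deriv g t ≠ 0
  injOn : Set.InjOn g (Set.Ico 0 (2 * π))

/-- The planar cross product. -/
def cross (a b : ℂ) : ℝ := a.re * b.im - a.im * b.re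

lemma cross_eq_im (a b : ℂ) : cross a b = (starRingEnd ℂ a * b).im := by
  simp [cross]; ring

lemma abs_cross_le (a b : ℂ) : |cross a b| ≤ ‖a‖ * ‖b‖ := by
  rw [cross_eq_im]
  refine (Complex.abs_im_le_norm _).trans ?_
  simp

lemma exists_int_abs_sub_le (s t : ℝ) : ∃ k : ℤ, |s - (t + k * (2 * π))| ≤ π := by
  refine ⟨round ((s - t) / (2 * π)), ?_⟩
  have h := abs_sub_round ((s - t) / (2 * π))
  have hp := Real.pi_pos
  have e : s - (t + round ((s - t) / (2 * π)) * (2 * π))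
      = ((s - t) / (2 * π) - round ((s - t) / (2 * π))) * (2 * π) := by
    field_simp; ring
  rw [e, abs_mul, abs_of_pos (by positivity : (0:ℝ) < 2 * π)]
  nlinarith

namespace IsJordanParam
variable {g : ℝ → ℂ}

lemma hasDerivAt (h : IsJordanParam g) (t : ℝ) : HasDerivAt g (deriv g t) t :=
  (h.contDiff.differentiable (by norm_num)).differentiableAt.hasDerivAt

lemma continuous (h : IsJordanParam g) : Continuous g := h.contDiff.continuous

lemma contDiff_deriv (h : IsJordanParam g) : ContDiff ℝ 1 (deriv g) := by
  have := (contDiff_succ_iff_deriv (n := 1) (𝕜 := ℝ) (f := g)).1 (by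
    rw [one_add_one_eq_two]; exact h.contDiff)
  exact this.2.2

lemma continuous_deriv (h : IsJordanParam g) : Continuous (deriv g) :=
  h.contDiff_deriv.continuous

lemma periodic_deriv (h : IsJordanParam g) : Function.Periodic (deriv g) (2 * π) := by
  intro t
  have : g = fun x => g (x + 2 * π) := by ext x; exact (h.periodic x).symm
  conv_rhs => rw [this]
  rw [deriv_comp_add_const]

lemma apply_add_int (h : IsJordanParam g) (t : ℝ) (k : ℤ) : g (t + k * (2 * π)) = g t := by
  simpa using (h.periodic.int_mul k) t

end IsJordanParam

lemma Function.Periodic.exists_norm_le {E : Type*} [NormedAddCommGroup E] {f : ℝ → E}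
    (hf : Function.Periodic f (2 * π)) (hc : Continuous f) : ∃ C, 0 < C ∧ ∀ t, ‖f t‖ ≤ C := by
  obtain ⟨C, hC⟩ := (hf.compact_of_continuous (by positivity) hc).isBounded.exists_norm_le
  exact ⟨max C 1, by positivity, fun t => (hC _ ⟨t, rfl⟩).trans (le_max_left _ _)⟩

namespace IsJordanParam
variable {g : ℝ → ℂ}

lemma exists_norm_deriv_le (h : IsJordanParam g) : ∃ M, 0 < M ∧ ∀ t, ‖deriv g t‖ ≤ M :=
  h.periodic_deriv.exists_norm_le h.continuous_deriv

lemma exists_le_norm_deriv (h : IsJordanParam g) : ∃ m, 0 < m ∧ ∀ t, m ≤ ‖deriv g t‖ := by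
  have hp : Function.Periodic (fun t => (deriv g t)⁻¹) (2 * π) := fun t => by
    simp only [h.periodic_deriv t]
  obtain ⟨C, hC, hb⟩ := hp.exists_norm_le (h.continuous_deriv.inv₀ h.regular)
  refine ⟨C⁻¹, by positivity, fun t => ?_⟩
  have := hb t
  rw [norm_inv] at this
  exact inv_le_of_inv_le₀ (norm_pos_iff.2 (h.regular t)) this

lemma exists_norm_deriv_sub_le (h : IsJordanParam g) :
    ∃ C, 0 < C ∧ ∀ s t, ‖deriv g t - deriv g s‖ ≤ C * |t - s| := by
  have hd := contDiff_one_iff_deriv.1 h.contDiff_deriv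
  have hp : Function.Periodic (deriv (deriv g)) (2 * π) := by
    intro t
    have : deriv g = fun x => deriv g (x + 2 * π) := by
      ext x; exact (h.periodic_deriv x).symm
    conv_rhs => rw [this]
    rw [deriv_comp_add_const]
  obtain ⟨C, hC, hb⟩ := hp.exists_norm_le hd.2
  refine ⟨C, hC, fun s t => ?_⟩
  have := Convex.norm_image_sub_le_of_norm_deriv_le (f := deriv g) (s := Set.univ) (C := C)
    (fun x _ => hd.1 x) (fun x _ => hb x) convex_univ (Set.mem_univ s) (Set.mem_univ t)
  simpa [Real.norm_eq_abs] using this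

lemma exists_taylor (h : IsJordanParam g) :
    ∃ C, 0 < C ∧ ∀ s t, ‖g t - g s - (t - s) • deriv g s‖ ≤ C * |t - s| ^ 2 := by
  obtain ⟨C, hC, hb⟩ := h.exists_norm_deriv_sub_le
  refine ⟨C, hC, fun s t => ?_⟩
  have hder : ∀ x ∈ Set.uIcc s t, HasDerivWithinAt (fun r => g r - (r - s) • deriv g s)
      (deriv g x - (1:ℝ) • deriv g s) (Set.uIcc s t) x := by
    intro x _
    refine ((h.hasDerivAt x).sub ?_).hasDerivWithinAt
    exact (((hasDerivAt_id x).sub_const s).smul_const _)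
  have hbd : ∀ x ∈ Set.uIcc s t, ‖deriv g x - (1:ℝ) • deriv g s‖ ≤ C * |t - s| := by
    intro x hx
    rw [one_smul]
    exact (hb s x).trans (mul_le_mul_of_nonneg_left (Set.abs_sub_left_of_mem_uIcc hx) hC.le)
  have := Convex.norm_image_sub_le_of_norm_hasDerivWithin_le hder hbd (convex_uIcc s t)
    Set.left_mem_uIcc Set.right_mem_uIcc
  simp only [sub_self, zero_smul, sub_zero] at this
  calc _ = ‖g t - (t - s) • deriv g s - g s‖ := by congr 1; abel
    _ ≤ _ := this
    _ = _ := by rw [Real.norm_eq_abs]; ring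

lemma eq_of_apply_eq (h : IsJordanParam g) {s t : ℝ} (hst : g s = g t) :
    ∃ k : ℤ, s = t + k * (2 * π) := by
  have hp : (0:ℝ) < 2 * π := by positivity
  obtain ⟨a, ha⟩ : ∃ a : ℤ, s - a * (2 * π) ∈ Set.Ico 0 (2 * π) := by
    refine ⟨⌊s / (2 * π)⌋, ?_, ?_⟩
    · have := Int.floor_le (s / (2 * π)); rw [le_div_iff₀ hp] at this; linarith
    · have := Int.lt_floor_add_one (s / (2 * π)); rw [div_lt_iff₀ hp] at this; linarith
  obtain ⟨b, hb⟩ : ∃ b : ℤ, t - b * (2 * π) ∈ Set.Ico 0 (2 * π) := by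
    refine ⟨⌊t / (2 * π)⌋, ?_, ?_⟩
    · have := Int.floor_le (t / (2 * π)); rw [le_div_iff₀ hp] at this; linarith
    · have := Int.lt_floor_add_one (t / (2 * π)); rw [div_lt_iff₀ hp] at this; linarith
  have e : g (s - a * (2 * π)) = g (t - b * (2 * π)) := by
    have h1 := h.apply_add_int (s - a * (2 * π)) a
    have h2 := h.apply_add_int (t - b * (2 * π)) b
    rw [sub_add_cancel] at h1 h2
    rw [← h1, ← h2, hst]
  have := h.injOn ha hb e
  exact ⟨a - b, by push_cast; linarith⟩

lemma exists_mul_abs_sub_le (h : IsJordanParam g) :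
    ∃ c, 0 < c ∧ ∀ s t, |s - t| ≤ π → c * |s - t| ≤ ‖g s - g t‖ := by
  obtain ⟨m, hm, hmb⟩ := h.exists_le_norm_deriv
  obtain ⟨C, hC, hT⟩ := h.exists_taylor
  have hpi := Real.pi_pos
  set δ := m / (2 * C) with hδ
  have hδ0 : 0 < δ := by positivity
  set K : Set (ℝ × ℝ) := (Set.Icc 0 (2 * π) ×ˢ Set.Icc (-π) π) ∩ {q | δ ≤ |q.2|} with hK
  have hKc : IsCompact K := (isCompact_Icc.prod isCompact_Icc).inter_right
    (isClosed_le continuous_const (by fun_prop))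
  have hcont : ContinuousOn (fun q : ℝ × ℝ => ‖g (q.1 + q.2) - g q.1‖) K := by
    have := h.continuous
    fun_prop
  have hpos : ∀ q ∈ K, 0 < ‖g (q.1 + q.2) - g q.1‖ := by
    rintro ⟨s, d⟩ ⟨⟨-, hd1⟩, hd2⟩
    simp only [Set.mem_ofPred_eq, Set.mem_Icc] at hd1 hd2
    rw [norm_pos_iff, sub_ne_zero]
    intro he
    obtain ⟨k, hk⟩ := h.eq_of_apply_eq he
    have hdk : d = k * (2 * π) := by linarith
    have hk0 : k ≠ 0 := by
      rintro rfl; simp at hdk; rw [hdk] at hd2; simp at hd2; linarith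
    have : (1:ℝ) ≤ |(k:ℝ)| := by exact_mod_cast Int.one_le_abs hk0
    have h2 : |d| = |(k:ℝ)| * (2 * π) := by
      rw [hdk, abs_mul, abs_of_pos (by positivity : (0:ℝ) < 2 * π)]
    have h3 : |d| ≤ π := abs_le.2 hd1
    nlinarith
  obtain ⟨c₀, hc₀, hc₀b⟩ : ∃ c₀, 0 < c₀ ∧ ∀ q ∈ K, c₀ ≤ ‖g (q.1 + q.2) - g q.1‖ :=
    hKc.exists_forall_le' hcont hpos
  refine ⟨min (m / 2) (c₀ / π), by positivity, fun s t hst => ?_⟩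
  rcases le_or_gt δ |s - t| with hd | hd
  · obtain ⟨k, hk⟩ : ∃ k : ℤ, t + k * (2 * π) ∈ Set.Icc 0 (2 * π) := by
      obtain ⟨k, hk⟩ := exists_int_abs_sub_le π t
      exact ⟨k, by rw [abs_le] at hk; constructor <;> linarith⟩
    have := hc₀b (t + k * (2 * π), s - t) ⟨⟨hk, abs_le.1 hst⟩, hd⟩
    simp only at this
    rw [h.apply_add_int, show t + k * (2 * π) + (s - t) = s + k * (2 * π) by ring,
      h.apply_add_int] at this
    calc _ ≤ c₀ / π * |s - t| := by gcongr; exact min_le_right _ _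
      _ ≤ c₀ / π * π := by gcongr
      _ = c₀ := by field_simp
      _ ≤ _ := this
  · have h1 := hT t s
    have h2 : m * |s - t| ≤ ‖(s - t) • deriv g t‖ := by
      rw [norm_smul, Real.norm_eq_abs, mul_comm]; gcongr; exact hmb t
    have h3 : ‖(s - t) • deriv g t‖ - ‖g s - g t‖ ≤ ‖g s - g t - (s - t) • deriv g t‖ := by
      rw [norm_sub_rev (g s - g t)]; exact norm_sub_norm_le _ _
    have h4 : C * |s - t| ^ 2 ≤ m / 2 * |s - t| := by
      have : C * |s - t| ≤ m / 2 := by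
        calc _ ≤ C * δ := by gcongr
          _ = m / 2 := by rw [hδ]; field_simp
      nlinarith [abs_nonneg (s - t)]
    calc _ ≤ m / 2 * |s - t| := by gcongr; exact min_le_left _ _
      _ ≤ _ := by linarith

lemma exists_abs_cross_le (h : IsJordanParam g) :
    ∃ C, 0 < C ∧ ∀ s t, |cross (g s - g t) (deriv g s)| ≤ C * ‖g s - g t‖ ^ 2 := by
  obtain ⟨c, hc, hb⟩ := h.exists_mul_abs_sub_le
  obtain ⟨C, hC, hT⟩ := h.exists_taylor
  obtain ⟨M, hM, hMb⟩ := h.exists_norm_deriv_le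
  refine ⟨C * M / c ^ 2, by positivity, fun s t => ?_⟩
  obtain ⟨k, hk⟩ := exists_int_abs_sub_le s t
  rw [← h.apply_add_int t k]
  set t' := t + k * (2 * π)
  have e : cross (g s - g t') (deriv g s)
      = - cross (g t' - g s - (t' - s) • deriv g s) (deriv g s) := by
    simp [cross]; ring
  rw [e, abs_neg]
  have h1 := abs_cross_le (g t' - g s - (t' - s) • deriv g s) (deriv g s)
  have h2 := hb s t' hk
  have h3 : |t' - s| ^ 2 ≤ ‖g s - g t'‖ ^ 2 / c ^ 2 := by
    rw [le_div_iff₀ (by positivity), abs_sub_comm, mul_comm, ← mul_pow]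
    gcongr
  calc _ ≤ _ := h1
    _ ≤ (C * |t' - s| ^ 2) * M := by gcongr; exacts [hT _ _, hMb s]
    _ ≤ (C * (‖g s - g t'‖ ^ 2 / c ^ 2)) * M := by gcongr
    _ = _ := by ring

end IsJordanParam

lemma intervalIntegrable_abs_rpow {r : ℝ} (hr : -1 < r) (a : ℝ) :
    IntervalIntegrable (fun t : ℝ => |t| ^ r) volume (-a) a := by
  have h0 : ∀ b : ℝ, 0 ≤ b → IntervalIntegrable (fun t : ℝ => |t| ^ r) volume 0 b := by
    intro b hb
    refine (intervalIntegral.intervalIntegrable_rpow' hr (a := 0) (b := b)).congr ?_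
    intro t ht
    rw [Set.uIoc_of_le hb] at ht
    simp only [abs_of_pos ht.1]
  have h1 : ∀ b : ℝ, 0 ≤ b → IntervalIntegrable (fun t : ℝ => |t| ^ r) volume 0 (-b) := by
    intro b hb
    have := (IntervalIntegrable.iff_comp_neg (by simp)).1 (h0 b hb)
    simpa using this
  rcases le_total 0 a with ha | ha
  · exact (h1 a ha).symm.trans (h0 a ha)
  · have := (h0 (-a) (by linarith)).symm.trans (h1 (-a) (by linarith))
    simpa using this

namespace IsJordanParam
variable {g : ℝ → ℂ}

lemma exists_nearest (h : IsJordanParam g) (x : ℂ) : ∃ s, ∀ t, ‖x - g s‖ ≤ ‖x - g t‖ := by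
  obtain ⟨s, hs, hmin⟩ := isCompact_Icc.exists_isMinOn (s := Set.Icc (0:ℝ) (2 * π))
    ⟨0, by simp [Real.pi_pos.le]⟩ (f := fun t => ‖x - g t‖)
    (by have := h.continuous; fun_prop)
  refine ⟨s, fun t => ?_⟩
  obtain ⟨k, hk⟩ := exists_int_abs_sub_le π t
  rw [← h.apply_add_int t k]
  apply hmin
  rw [abs_le] at hk
  constructor <;> linarith

lemma exists_integral_rpow_le (h : IsJordanParam g) : ∃ C, ∀ x : ℂ,
    IntervalIntegrable (fun t => ‖x - g t‖ ^ (-(1 / 2) : ℝ)) volume 0 (2 * π) ∧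
    ∫ t in (0:ℝ)..(2 * π), ‖x - g t‖ ^ (-(1 / 2) : ℝ) ≤ C := by
  obtain ⟨c, hc, hb⟩ := h.exists_mul_abs_sub_le
  have hpi := Real.pi_pos
  set J := fun t : ℝ => |t| ^ (-(1 / 2) : ℝ) with hJ
  have hJi : IntervalIntegrable J volume (-π) π := intervalIntegrable_abs_rpow (by norm_num) π
  refine ⟨∫ t in (-π)..π, (c / 2) ^ (-(1 / 2) : ℝ) * J t, fun x => ?_⟩
  obtain ⟨s, hs⟩ := h.exists_nearest x
  set f := fun t => ‖x - g t‖ ^ (-(1 / 2) : ℝ) with hf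
  have hfp : Function.Periodic f (2 * π) := fun t => by simp only [hf, h.periodic t]
  have hfm : Measurable f := by
    have := h.continuous.measurable
    fun_prop
  have hJs : IntervalIntegrable (fun t => (c / 2) ^ (-(1 / 2) : ℝ) * J (t - s)) volume
      (s - π) (s - π + 2 * π) := by
    have := (hJi.comp_sub_right s).const_mul ((c / 2) ^ (-(1 / 2) : ℝ))
    convert this using 1 <;> ring
  have hle : s - π ≤ s - π + 2 * π := by linarith
  have key : ∀ t ∈ Set.Icc (s - π) (s - π + 2 * π), t ≠ s →
      f t ≤ (c / 2) ^ (-(1 / 2) : ℝ) * J (t - s) := by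
    intro t ht hts
    have h1 : |t - s| ≤ π := by
      rw [abs_le]; constructor <;> linarith [ht.1, ht.2]
    have h0 : 0 < |t - s| := abs_pos.2 (sub_ne_zero.2 hts)
    have h2 := hb t s h1
    have h3 : ‖g t - g s‖ ≤ ‖x - g s‖ + ‖x - g t‖ := by
      calc _ = ‖(x - g s) - (x - g t)‖ := by congr 1; ring
        _ ≤ _ := norm_sub_le _ _
    have h4 : c / 2 * |t - s| ≤ ‖x - g t‖ := by linarith [hs t]
    simp only [hf, hJ]
    rw [← Real.mul_rpow (by positivity) (by positivity)]
    exact Real.rpow_le_rpow_of_nonpos (by positivity) h4 (by norm_num)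
  have hae : ∀ᵐ t ∂volume.restrict (Set.Icc (s - π) (s - π + 2 * π)),
      f t ≤ (c / 2) ^ (-(1 / 2) : ℝ) * J (t - s) := by
    filter_upwards [ae_restrict_mem measurableSet_Icc,
      ae_restrict_of_ae (Measure.ae_ne volume s)] with t ht hts using key t ht hts
  have hfi : IntervalIntegrable f volume (s - π) (s - π + 2 * π) := by
    refine hJs.mono_fun hfm.aestronglyMeasurable ?_
    rw [Set.uIoc_of_le hle]
    filter_upwards [ae_restrict_of_ae_restrict_of_subset Set.Ioc_subset_Icc_self hae] with t ht
    have h0 : 0 ≤ f t := by simp only [hf]; positivity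
    rw [Real.norm_of_nonneg h0]
    exact ht.trans (le_abs_self _)
  refine ⟨hfp.intervalIntegrable (by positivity) hfi 0 (2 * π), ?_⟩
  have e := hfp.intervalIntegral_add_eq 0 (s - π)
  rw [zero_add] at e
  rw [e]
  calc _ ≤ ∫ t in (s - π)..(s - π + 2 * π), (c / 2) ^ (-(1 / 2) : ℝ) * J (t - s) :=
        intervalIntegral.integral_mono_ae_restrict hle hfi hJs hae
    _ = _ := by
      rw [intervalIntegral.integral_comp_sub_right (fun t => (c / 2) ^ (-(1 / 2) : ℝ) * J t)]
      congr 1 <;> ring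

end IsJordanParam

/-- The union of the open discs of radius `|r| * ‖deriv g s‖` tangent to the curve `g` at `g s`,
lying on the left of `g` if `r > 0` and on the right if `r < 0`. -/
def side (g : ℝ → ℂ) (r : ℝ) : Set ℂ :=
  {x | ∃ s : ℝ, ∃ z ∈ Metric.ball ((r : ℂ) * Complex.I) |r|, g s + z * deriv g s = x}

lemma mem_ball_mul_I_iff (r : ℝ) (z : ℂ) :
    z ∈ Metric.ball ((r : ℂ) * Complex.I) |r| ↔ ‖z‖ ^ 2 < 2 * r * z.im := by
  rw [mem_ball_iff_norm, ← abs_norm, ← sq_lt_sq, ← Complex.normSq_eq_norm_sq,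
    ← Complex.normSq_eq_norm_sq, Complex.normSq_apply, Complex.normSq_apply]
  simp only [Complex.sub_re, Complex.mul_re, Complex.ofReal_re, Complex.I_re, Complex.ofReal_im,
    Complex.I_im, Complex.sub_im, Complex.mul_im]
  constructor <;> intro h <;> nlinarith

namespace IsJordanParam
variable {g : ℝ → ℂ}

lemma isPreconnected_side (h : IsJordanParam g) (r : ℝ) : IsPreconnected (side g r) := by
  have : side g r = (fun q : ℝ × ℂ => g q.1 + q.2 * deriv g q.1) ''
      (Set.univ ×ˢ Metric.ball ((r : ℂ) * Complex.I) |r|) := by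
    ext x; simp [side]
  rw [this]
  refine (isPreconnected_univ.prod (convex_ball _ _).isPreconnected).image _ ?_
  have := h.continuous
  have := h.continuous_deriv
  fun_prop

lemma isCompact_range (h : IsJordanParam g) : IsCompact (Set.range g) :=
  h.periodic.compact_of_continuous (by positivity) h.continuous

lemma exists_side (h : IsJordanParam g) : ∃ r₀ : ℝ, 0 < r₀ ∧
    ∀ r : ℝ, |r| = r₀ → (Disjoint (side g r) (Set.range g)) ∧
      ∀ p ∈ Set.range g, ∀ᶠ x in 𝓝 p, x ∈ Set.range g ∨ x ∈ side g r ∨ x ∈ side g (-r) := by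
  obtain ⟨C, hC, hcr⟩ := h.exists_abs_cross_le
  obtain ⟨m, hm, hmb⟩ := h.exists_le_norm_deriv
  refine ⟨1 / (2 * C), by positivity, fun r hr => ⟨?_, ?_⟩⟩
  · rw [Set.disjoint_left]
    rintro _ ⟨s, z, hz, rfl⟩ ⟨t, ht⟩
    rw [mem_ball_mul_I_iff] at hz
    have h1 := hcr s t
    have e1 : g s - g t = - (z * deriv g s) := by rw [ht]; ring
    rw [e1, norm_neg, norm_mul] at h1
    have e2 : cross (-(z * deriv g s)) (deriv g s) = z.im * ‖deriv g s‖ ^ 2 := by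
      rw [← Complex.normSq_eq_norm_sq, Complex.normSq_apply]
      simp [cross]; ring
    rw [e2, abs_mul, abs_of_nonneg (sq_nonneg ‖deriv g s‖), mul_pow, ← mul_assoc] at h1
    have h2 : 0 < ‖deriv g s‖ ^ 2 := by
      have := norm_pos_iff.2 (h.regular s); positivity
    have h3 := le_of_mul_le_mul_right h1 h2
    have h4 : r * z.im ≤ 1 / (2 * C) * |z.im| := by
      rw [← hr, ← abs_mul]; exact le_abs_self _
    have h5 : C * ‖z‖ ^ 2 < C * (2 * (1 / (2 * C) * |z.im|)) := by
      gcongr; linarith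
    have h6 : C * (2 * (1 / (2 * C) * |z.im|)) = |z.im| := by field_simp
    linarith
  · rintro p ⟨t, rfl⟩
    have hρ : 0 < 2 * |r| * m := by rw [hr]; positivity
    filter_upwards [Metric.ball_mem_nhds (g t) hρ] with x hx
    obtain ⟨s, hs⟩ := h.exists_nearest x
    by_cases hxs : x = g s
    · exact Or.inl ⟨s, hxs.symm⟩
    right
    have hlt : ‖x - g s‖ < 2 * |r| * m := (hs t).trans_lt (by simpa [dist_eq_norm] using hx)
    have hder : HasDerivAt (fun u => ‖x - g u‖ ^ 2)
        (2 * inner ℝ (x - g s) (-deriv g s)) s := ((h.hasDerivAt s).const_sub x).norm_sq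
    have hz : 2 * inner ℝ (x - g s) (-deriv g s) = 0 := by
      refine IsLocalMin.hasDerivAt_eq_zero ?_ hder
      exact Eventually.of_forall fun u => by
        have := hs u
        exact pow_le_pow_left₀ (norm_nonneg _) this 2
    have hg := h.regular s
    set z := (x - g s) / deriv g s with hzd
    have hzx : z * deriv g s = x - g s := by rw [hzd]; field_simp
    have hre : z.re = 0 := by
      rw [← hzx, inner_neg_right, Complex.inner] at hz
      have hn : Complex.normSq (deriv g s) ≠ 0 := by simpa using hg
      have e : ((deriv g s) * (starRingEnd ℂ) (z * deriv g s)).re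
          = z.re * Complex.normSq (deriv g s) := by
        simp [Complex.normSq_apply]; ring
      rw [e] at hz
      have : z.re * Complex.normSq (deriv g s) = 0 := by linarith
      exact (mul_eq_zero.1 this).resolve_right hn
    have hzn : ‖z‖ = |z.im| := by
      rw [Complex.norm_def, Complex.normSq_apply, hre]
      simp [← sq, Real.sqrt_sq_eq_abs]
    have hz0 : 0 < |z.im| := by
      rw [← hzn, norm_pos_iff]
      exact div_ne_zero (sub_ne_zero.2 hxs) hg
    have hz2 : |z.im| < 2 * |r| := by
      rw [← hzn, hzd, norm_div, div_lt_iff₀ (norm_pos_iff.2 hg)]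
      calc _ < _ := hlt
        _ ≤ _ := by gcongr; exact hmb s
    have key : |z.im| ^ 2 < 2 * (|r| * |z.im|) := by nlinarith
    rw [← abs_mul] at key
    rcases abs_cases (r * z.im) with ⟨h1, -⟩ | ⟨h1, -⟩
    · left
      refine ⟨s, z, ?_, by rw [hzx]; ring⟩
      rw [mem_ball_mul_I_iff, hzn]; linarith
    · right
      refine ⟨s, z, ?_, by rw [hzx]; ring⟩
      rw [mem_ball_mul_I_iff, hzn]; linarith

lemma exists_side_subset (h : IsJordanParam g) {D : Set ℂ} (hD : IsOpen D)
    (hb : Bornology.IsBounded D) (hf : frontier D = Set.range g) :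
    ∃ r : ℝ, r ≠ 0 ∧ side g r ⊆ D ∧ side g (-r) ⊆ (closure D)ᶜ ∧
      ∀ p ∈ Set.range g, ∀ᶠ x in 𝓝 p, x ∈ Set.range g ∨ x ∈ side g r ∨ x ∈ side g (-r) := by
  obtain ⟨r₀, hr₀, H⟩ := h.exists_side
  have hcl : closure D = D ∪ Set.range g := by
    rw [← hf, closure_eq_interior_union_frontier, hD.interior_eq]
  have hdis : Disjoint D (Set.range g) := by
    rw [← hf]; exact (disjoint_frontier_iff_isOpen.2 hD).symm
  have hdich : ∀ r : ℝ, |r| = r₀ → side g r ⊆ D ∨ side g r ⊆ (closure D)ᶜ := by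
    intro r hr
    refine (h.isPreconnected_side r).subset_or_subset hD isClosed_closure.isOpen_compl ?_ ?_
    · exact Set.disjoint_compl_right_iff_subset.2 subset_closure
    · intro x hx
      by_cases hxD : x ∈ D
      · exact Or.inl hxD
      · refine Or.inr fun hxc => ?_
        rw [hcl] at hxc
        exact Set.disjoint_left.1 (H r hr).1 hx (hxc.resolve_left hxD)
  have a1 : |r₀| = r₀ := abs_of_pos hr₀
  have a2 : |(-r₀)| = r₀ := by rw [abs_neg, a1]
  have hnb := (H r₀ a1).2
  rcases hdich r₀ a1 with h1 | h1 <;> rcases hdich (-r₀) a2 with h2 | h2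
  · exfalso
    have hopen : IsOpen (closure D) := by
      rw [isOpen_iff_mem_nhds]
      intro p hp
      by_cases hpD : p ∈ D
      · exact mem_of_superset (hD.mem_nhds hpD) subset_closure
      · rw [hcl] at hp
        filter_upwards [hnb p (hp.resolve_left hpD)] with x hx
        rw [hcl]
        rcases hx with hx | hx | hx
        exacts [Or.inr hx, Or.inl (h1 hx), Or.inl (h2 hx)]
    have huniv : closure D = Set.univ := IsClopen.eq_univ ⟨isClosed_closure, hopen⟩
      ⟨g 0, by rw [hcl]; exact Or.inr ⟨0, rfl⟩⟩
    have : IsCompact (Set.univ : Set ℂ) := huniv ▸ hb.isCompact_closure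
    exact noncompact_univ ℂ this
  · exact ⟨r₀, hr₀.ne', h1, h2, hnb⟩
  · exact ⟨-r₀, by simpa using hr₀.ne', h2, by simpa using h1, (H (-r₀) a2).2⟩
  · exfalso
    have hp : g 0 ∈ closure D := by rw [hcl]; exact Or.inr ⟨0, rfl⟩
    obtain ⟨x, hx, hxD⟩ := mem_closure_iff_nhds.1 hp _ (hnb (g 0) ⟨0, rfl⟩)
    rcases hx with hx | hx | hx
    · exact Set.disjoint_left.1 hdis hxD hx
    · exact h1 hx (subset_closure hxD)
    · exact h2 hx (subset_closure hxD)

end IsJordanParam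

lemma side_nonempty (g : ℝ → ℂ) {r : ℝ} (hr : r ≠ 0) : (side g r).Nonempty :=
  ⟨_, 0, r * Complex.I, Metric.mem_ball_self (abs_pos.2 hr), rfl⟩

lemma IsPreconnected.eqOn_of_eventually_eq {X : Type*} {f : ℂ → X} {A Γ : Set ℂ}
    (hA : IsPreconnected A) (hΓ : IsClosed Γ) (hAΓ : Disjoint A Γ)
    (hf : ∀ x ∉ Γ, ∀ᶠ y in 𝓝 x, f y = f x) {a : ℂ} (ha : a ∈ A) : ∀ x ∈ A, f x = f a := by
  have h1 : IsOpen {x | x ∉ Γ ∧ f x = f a} := by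
    rw [isOpen_iff_mem_nhds]
    rintro x ⟨hx, hxa⟩
    filter_upwards [hf x hx, hΓ.isOpen_compl.mem_nhds hx] with y hy hy'
    exact ⟨hy', hy.trans hxa⟩
  have h2 : IsOpen {x | x ∉ Γ ∧ f x ≠ f a} := by
    rw [isOpen_iff_mem_nhds]
    rintro x ⟨hx, hxa⟩
    filter_upwards [hf x hx, hΓ.isOpen_compl.mem_nhds hx] with y hy hy'
    exact ⟨hy', by rwa [hy]⟩
  rcases hA.subset_or_subset h1 h2 (by
      rw [Set.disjoint_left]; rintro x ⟨-, hx⟩ ⟨-, hx'⟩; exact hx' hx) (by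
      intro x hx
      have := Set.disjoint_left.1 hAΓ hx
      by_cases hxa : f x = f a
      exacts [Or.inl ⟨this, hxa⟩, Or.inr ⟨this, hxa⟩]) with h | h
  · exact fun x hx => (h hx).2
  · exact absurd rfl (h ha).2

lemma eq_of_eventually_eq_of_frontier {X : Type*} {f : ℂ → X} {E Γ : Set ℂ} (hE : IsOpen E)
    (hEΓ : Disjoint E Γ) (hΓ : Γ.Nonempty) (hcl : closure E ⊆ E ∪ Γ)
    (hf : ∀ x ∈ E, ∀ᶠ y in 𝓝 x, f y = f x) {a : X}
    (ha : ∀ p ∈ Γ, ∀ᶠ x in 𝓝 p, x ∈ E → f x = a) : ∀ x ∈ E, f x = a := by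
  set S := {x | x ∈ E ∧ f x ≠ a} with hS
  have hSo : IsOpen S := by
    rw [isOpen_iff_mem_nhds]
    rintro x ⟨hx, hxa⟩
    filter_upwards [hf x hx, hE.mem_nhds hx] with y hy hy'
    exact ⟨hy', by rwa [hy]⟩
  have hSc : IsClosed S := by
    rw [← isOpen_compl_iff, isOpen_iff_mem_nhds]
    intro x hx
    by_cases hxE : x ∈ E
    · have hxa : f x = a := by by_contra hne; exact hx ⟨hxE, hne⟩
      filter_upwards [hf x hxE] with y hy hyS
      exact hyS.2 (hy.trans hxa)
    · by_cases hxΓ : x ∈ Γ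
      · filter_upwards [ha x hxΓ] with y hy hyS
        exact hyS.2 (hy hyS.1)
      · have : x ∉ closure E := fun hc => (hcl hc).elim hxE hxΓ
        filter_upwards [isClosed_closure.isOpen_compl.mem_nhds this] with y hy hyS
        exact hy (subset_closure hyS.1)
  rcases isClopen_iff.1 ⟨hSc, hSo⟩ with h | h
  · intro x hx
    by_contra hne
    have : x ∈ S := ⟨hx, hne⟩
    rw [h] at this; exact this
  · obtain ⟨p, hp⟩ := hΓ
    have : p ∈ S := by rw [h]; trivial
    exact absurd hp (Set.disjoint_left.1 hEΓ this.1)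

namespace IsJordanParam
variable {g : ℝ → ℂ}

lemma exists_const (h : IsJordanParam g) {D : Set ℂ} (hD : IsOpen D)
    (hb : Bornology.IsBounded D) (hf : frontier D = Set.range g) {X : Type*} {f : ℂ → X}
    (hfc : ∀ x ∉ Set.range g, ∀ᶠ y in 𝓝 x, f y = f x) :
    ∃ a b, (∀ x ∈ D, f x = a) ∧ ∀ x ∉ closure D, f x = b := by
  obtain ⟨r, hr, h1, h2, h3⟩ := h.exists_side_subset hD hb hf
  have hΓ : IsClosed (Set.range g) := h.isCompact_range.isClosed
  have hne : (Set.range g).Nonempty := ⟨_, 0, rfl⟩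
  have hcl : closure D = D ∪ Set.range g := by
    rw [← hf, closure_eq_interior_union_frontier, hD.interior_eq]
  have hdis : Disjoint D (Set.range g) := by
    rw [← hf]; exact (disjoint_frontier_iff_isOpen.2 hD).symm
  have hdis' : Disjoint (closure D)ᶜ (Set.range g) := by
    rw [hcl, Set.disjoint_left]; intro x hx hx'; exact hx (Or.inr hx')
  obtain ⟨x₁, hx₁⟩ := side_nonempty g hr
  obtain ⟨x₂, hx₂⟩ := side_nonempty g (neg_ne_zero.2 hr)
  have c1 := (h.isPreconnected_side r).eqOn_of_eventually_eq hΓ (hdis.mono_left h1) hfc hx₁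
  have c2 := (h.isPreconnected_side (-r)).eqOn_of_eventually_eq hΓ (hdis'.mono_left h2) hfc hx₂
  refine ⟨f x₁, f x₂, ?_, ?_⟩
  · refine eq_of_eventually_eq_of_frontier hD hdis hne hcl.subset
      (fun x hx => hfc x (Set.disjoint_left.1 hdis hx)) fun p hp => ?_
    filter_upwards [h3 p hp] with x hx hxD
    rcases hx with hx | hx | hx
    · exact absurd hx (Set.disjoint_left.1 hdis hxD)
    · exact c1 x hx
    · exact absurd (subset_closure hxD) (h2 hx)
  · refine eq_of_eventually_eq_of_frontier (E := (closure D)ᶜ) isClosed_closure.isOpen_compl hdis'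
      hne ?_ (fun x hx => hfc x (Set.disjoint_left.1 hdis' hx)) fun p hp => ?_
    · intro x hx
      by_cases hxc : x ∈ closure D
      · right
        rw [← hf]
        refine ⟨hxc, fun hi => ?_⟩
        rw [closure_compl] at hx
        exact hx (interior_mono subset_closure hi)
      · exact Or.inl hxc
    · filter_upwards [h3 p hp] with x hx hxD
      rcases hx with hx | hx | hx
      · exact absurd hx (Set.disjoint_left.1 hdis' hxD)
      · exact absurd (subset_closure (h1 hx)) hxD
      · exact c2 x hx

end IsJordanParam

section Parametric

variable {H E T : Type*} [NormedAddCommGroup H] [NormedAddCommGroup E]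
  [TopologicalSpace T] {S : Set T} {U : Set H}

lemma exists_closedBall_bound [ProperSpace H] (hS : IsCompact S) (hU : IsOpen U) {F : H → T → E}
    (hF : ContinuousOn (Function.uncurry F) (U ×ˢ S)) {x₀ : H} (hx₀ : x₀ ∈ U) :
    ∃ δ > 0, Metric.closedBall x₀ δ ⊆ U ∧ ∃ C, ∀ x ∈ Metric.closedBall x₀ δ, ∀ t ∈ S,
      ‖F x t‖ ≤ C := by
  obtain ⟨δ, hδ, hb⟩ := Metric.nhds_basis_closedBall.mem_iff.1 (hU.mem_nhds hx₀)
  obtain ⟨C, hC⟩ := ((isCompact_closedBall x₀ δ).prod hS).exists_bound_of_continuousOn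
    (hF.mono (Set.prod_mono hb subset_rfl))
  exact ⟨δ, hδ, hb, C, fun x hx t ht => hC (x, t) ⟨hx, ht⟩⟩

lemma ContinuousOn.slice_right {F : H → T → E}
    (hF : ContinuousOn (Function.uncurry F) (U ×ˢ S)) {x : H} (hx : x ∈ U) :
    ContinuousOn (F x) S :=
  hF.comp (f := fun t => (x, t)) (by fun_prop) fun _ ht => ⟨hx, ht⟩

lemma ContinuousOn.slice_left {F : H → T → E}
    (hF : ContinuousOn (Function.uncurry F) (U ×ˢ S)) {t : T} (ht : t ∈ S) :
    ContinuousOn (fun x => F x t) U :=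
  hF.comp (f := fun x => (x, t)) (by fun_prop) fun _ hx => ⟨hx, ht⟩

variable [ProperSpace H] [MeasurableSpace T] [BorelSpace T] [T2Space T]
  {m : Measure T} [IsFiniteMeasureOnCompacts m]

lemma continuousAt_setIntegral_of_continuousOn [NormedSpace ℝ E] (hS : IsCompact S)
    (hU : IsOpen U) {F : H → T → E} (hF : ContinuousOn (Function.uncurry F) (U ×ˢ S))
    {x₀ : H} (hx₀ : x₀ ∈ U) : ContinuousAt (fun x => ∫ t in S, F x t ∂m) x₀ := by
  obtain ⟨δ, hδ, hb, C, hC⟩ := exists_closedBall_bound hS hU hF hx₀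
  have hnb : ∀ᶠ x in 𝓝 x₀, x ∈ Metric.closedBall x₀ δ := Metric.closedBall_mem_nhds _ hδ
  have : IsFiniteMeasure (m.restrict S) := ⟨by simpa using hS.measure_lt_top⟩
  refine continuousAt_of_dominated (bound := fun _ => C) ?_ ?_ (integrable_const C) ?_
  · filter_upwards [hnb] with x hx
    exact (hF.slice_right (hb hx)).aestronglyMeasurable_of_isCompact hS hS.measurableSet
  · filter_upwards [hnb] with x hx
    filter_upwards [ae_restrict_mem hS.measurableSet] with t ht using hC x hx t ht
  · filter_upwards [ae_restrict_mem hS.measurableSet] with t ht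
    exact (hF.slice_left ht).continuousAt (hU.mem_nhds hx₀)

lemma hasFDerivAt_setIntegral_of_continuousOn {𝕜 : Type*} [RCLike 𝕜] [NormedSpace 𝕜 H]
    [NormedSpace ℝ E] [NormedSpace 𝕜 E] (hS : IsCompact S)
    (hU : IsOpen U) {F : H → T → E} {F' : H → T → H →L[𝕜] E}
    (hF : ContinuousOn (Function.uncurry F) (U ×ˢ S))
    (hF' : ContinuousOn (Function.uncurry F') (U ×ˢ S))
    (hd : ∀ x ∈ U, ∀ t ∈ S, HasFDerivAt (fun x => F x t) (F' x t) x)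
    {x₀ : H} (hx₀ : x₀ ∈ U) :
    HasFDerivAt (fun x => ∫ t in S, F x t ∂m) (∫ t in S, F' x₀ t ∂m) x₀ := by
  obtain ⟨δ, hδ, hb, C, hC⟩ := exists_closedBall_bound hS hU hF' hx₀
  have : IsFiniteMeasure (m.restrict S) := ⟨by simpa using hS.measure_lt_top⟩
  refine hasFDerivAt_integral_of_dominated_of_fderiv_le (bound := fun _ => C)
    (Metric.closedBall_mem_nhds x₀ hδ) ?_ ?_ ?_ ?_ (integrable_const C) ?_
  · filter_upwards [hU.mem_nhds hx₀] with x hx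
    exact (hF.slice_right hx).aestronglyMeasurable_of_isCompact hS hS.measurableSet
  · exact (hF.slice_right hx₀).integrableOn_compact hS
  · exact (hF'.slice_right hx₀).aestronglyMeasurable_of_isCompact hS hS.measurableSet
  · filter_upwards [ae_restrict_mem hS.measurableSet] with t ht x hx using hC x hx t ht
  · filter_upwards [ae_restrict_mem hS.measurableSet] with t ht x hx using hd x (hb hx) t ht

end Parametric

/-- The gradient of a real function on the plane, as a complex number. -/
def cgrad (f : ℂ → ℝ) (z : ℂ) : ℂ := ⟨fderiv ℝ f z 1, fderiv ℝ f z Complex.I⟩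

lemma fderiv_apply_eq_cgrad (f : ℂ → ℝ) (z v : ℂ) :
    fderiv ℝ f z v = v.re * (cgrad f z).re + v.im * (cgrad f z).im := by
  have : v = v.re • (1 : ℂ) + v.im • Complex.I := by
    apply Complex.ext <;> simp
  conv_lhs => rw [this, map_add, map_smul, map_smul]
  simp [cgrad]

lemma ContDiff.continuous_cgrad {f : ℂ → ℝ} (hf : ContDiff ℝ 1 f) : Continuous (cgrad f) := by
  have h := hf.continuous_fderiv (by norm_num)
  have : cgrad f = fun z => (fderiv ℝ f z 1 : ℂ) + (fderiv ℝ f z Complex.I : ℂ) * Complex.I := by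
    ext z; apply Complex.ext <;> simp [cgrad]
  rw [this]
  fun_prop

lemma HasCompactSupport.cgrad {f : ℂ → ℝ} (hf : HasCompactSupport f) :
    HasCompactSupport (cgrad f) := by
  refine (hf.fderiv ℝ).mono fun z hz => ?_
  simp only [Function.mem_support] at hz ⊢
  contrapose! hz
  simp [_root_.cgrad, hz]; rfl

lemma integral_cgrad_div_self {f : ℂ → ℝ} (hf : ContDiff ℝ 1 f) (hs : HasCompactSupport f) :
    ∫ z, cgrad f z / z = -(2 * π * f 0 : ℝ) := by
  obtain ⟨R, hR⟩ := hs.isCompact.isBounded.subset_closedBall 0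
  have hpi := Real.pi_pos
  have hfd : Continuous (fderiv ℝ f) := hf.continuous_fderiv (by norm_num)
  have hfd0 : ∀ z, R < ‖z‖ → fderiv ℝ f z = 0 := by
    intro z hz
    by_contra hne
    have : z ∈ tsupport f := support_fderiv_subset ℝ (Function.mem_support.2 hne)
    have := hR this
    rw [mem_closedBall_zero_iff] at this
    linarith
  have hf0 : ∀ z, R < ‖z‖ → f z = 0 := by
    intro z hz
    by_contra hne
    have := hR (subset_tsupport f (Function.mem_support.2 hne))
    rw [mem_closedBall_zero_iff] at this
    linarith
  set E : ℝ → ℂ := fun θ => Real.cos θ + Real.sin θ * Complex.I with hE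
  have hEn : ∀ θ, ‖E θ‖ = 1 := fun θ => by
    simp only [hE]
    rw [Complex.ofReal_cos, Complex.ofReal_sin]; exact Complex.norm_cos_add_sin_mul_I θ
  have hEc : Continuous E := by simp only [hE]; fun_prop
  set A : ℝ × ℝ → ℝ := fun p => fderiv ℝ f (p.1 * E p.2) (E p.2) with hA
  set B : ℝ × ℝ → ℝ := fun p => fderiv ℝ f (p.1 * E p.2) (E p.2 * Complex.I) with hB
  have hAc : Continuous A := by simp only [hA]; fun_prop
  have hBc : Continuous B := by simp only [hB]; fun_prop
  have hz : ∀ p : ℝ × ℝ, R < p.1 → fderiv ℝ f (p.1 * E p.2) = 0 := by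
    intro p hp
    apply hfd0
    rw [norm_mul, hEn, mul_one, Complex.norm_real, Real.norm_eq_abs]
    exact hp.trans_le (le_abs_self _)
  set P : Set (ℝ × ℝ) := Set.Ioi 0 ×ˢ Set.Ioo (-π) π with hP
  have hF_int : ∀ F : ℝ × ℝ → ℝ, Continuous F → (∀ p : ℝ × ℝ, R < p.1 → F p = 0) →
      IntegrableOn F P := by
    intro F hF hF0
    have h1 : IntegrableOn F (Set.Icc 0 R ×ˢ Set.Icc (-π) π) :=
      hF.continuousOn.integrableOn_compact (isCompact_Icc.prod isCompact_Icc)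
    refine h1.of_forall_sdiff_eq_zero (measurableSet_Ioi.prod measurableSet_Ioo) ?_
    rintro ⟨r, θ⟩ ⟨⟨h2, h3⟩, h4⟩
    apply hF0
    by_contra hr
    exact h4 ⟨⟨le_of_lt h2, not_lt.1 hr⟩, h3.1.le, h3.2.le⟩
  have hAi : IntegrableOn A P := hF_int A hAc fun p hp => by simp only [hA, hz p hp]; rfl
  have hBi : IntegrableOn B P := hF_int B hBc fun p hp => by simp only [hB, hz p hp]; rfl
  have hAv : ∫ p in P, A p = -(2 * π * f 0) := by
    rw [hP, Measure.volume_eq_prod, ← setIntegral_prod_swap,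
      setIntegral_prod (μ := volume) (ν := volume) (fun z : ℝ × ℝ => A z.swap) ?_]
    · have : ∀ θ : ℝ, ∫ r in Set.Ioi (0:ℝ), A (r, θ) = -f 0 := by
        intro θ
        have hder : ∀ r : ℝ, HasDerivAt (fun r : ℝ => f (r * E θ)) (A (r, θ)) r := by
          intro r
          have h1 : HasDerivAt (fun r : ℝ => (r : ℂ) * E θ) (E θ) r := by
            simpa using (Complex.ofRealCLM.hasDerivAt (x := r)).mul_const (E θ)
          exact ((hf.differentiable (by norm_num)).differentiableAt.hasFDerivAt).comp_hasDerivAt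
            r h1
        have := integral_Ioi_of_hasDerivAt_of_tendsto' (a := 0) (m := 0) (fun r _ => hder r) ?_ ?_
        · simpa using this
        · have h1 : IntegrableOn (fun r => A (r, θ)) (Set.Icc 0 R) :=
            (by fun_prop : Continuous fun r => A (r, θ)).continuousOn.integrableOn_compact
              isCompact_Icc
          refine h1.of_forall_sdiff_eq_zero measurableSet_Ioi ?_
          rintro r ⟨h2, h4⟩
          have : R < r := by by_contra hr; exact h4 ⟨le_of_lt h2, not_lt.1 hr⟩
          simp only [hA, hz (r, θ) this]; rfl
        · refine tendsto_const_nhds.congr' ?_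
          filter_upwards [eventually_gt_atTop R] with r hr
          refine (hf0 _ ?_).symm
          rw [norm_mul, hEn, mul_one, Complex.norm_real, Real.norm_eq_abs]
          exact hr.trans_le (le_abs_self _)
      simp only [Prod.swap_prod_mk, this]
      simp
      rw [max_eq_left (by linarith)]
      left; ring
    · rw [Measure.volume_eq_prod] at hAi
      exact hAi.swap
  have hBv : ∫ p in P, B p = 0 := by
    rw [hP, Measure.volume_eq_prod, setIntegral_prod _ (by
      rw [← Measure.volume_eq_prod]; exact hBi)]
    refine setIntegral_eq_zero_of_forall_eq_zero fun r hr => ?_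
    have hr : (0:ℝ) < r := hr
    have hder : ∀ θ : ℝ, HasDerivAt (fun θ : ℝ => f (r * E θ)) (r * B (r, θ)) θ := by
      intro θ
      have h1 : HasDerivAt (fun θ : ℝ => (r : ℂ) * E θ) (r * (E θ * Complex.I)) θ := by
        refine HasDerivAt.const_mul (r : ℂ) ?_
        have h2 := (Real.hasDerivAt_cos θ).ofReal_comp
        have h3 := ((Real.hasDerivAt_sin θ).ofReal_comp).mul_const Complex.I
        refine (h2.add h3).congr_deriv ?_
        simp only [hE]
        push_cast
        ring_nf
        rw [Complex.I_sq]; ring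
      have := ((hf.differentiable (by norm_num)).differentiableAt.hasFDerivAt).comp_hasDerivAt θ h1
      refine this.congr_deriv ?_
      simp only [hB]
      have e : (r : ℂ) * (E θ * Complex.I) = r • (E θ * Complex.I) := (Complex.real_smul ..).symm
      rw [e, map_smul]; rfl
    have := intervalIntegral.integral_eq_sub_of_hasDerivAt (a := -π) (b := π)
      (fun θ _ => hder θ) (by
        apply Continuous.intervalIntegrable
        fun_prop)
    rw [intervalIntegral.integral_of_le (by linarith), ← integral_Ioc_eq_integral_Ioo] at *
    rw [integral_const_mul] at this
    have hEE : E π = E (-π) := by simp [hE]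
    rw [hEE, sub_self] at this
    exact (mul_eq_zero.1 this).resolve_left hr.ne'
  rw [← Complex.integral_comp_polarCoord_symm, polarCoord_target]
  have e : ∀ p ∈ P, p.1 • (cgrad f (Complex.polarCoord.symm p) / Complex.polarCoord.symm p)
      = (A p : ℂ) + (B p : ℂ) * Complex.I := by
    rintro ⟨r, θ⟩ ⟨hr, -⟩
    have hr : (0:ℝ) < r := hr
    rw [Complex.polarCoord_symm_apply]
    change r • (cgrad f (r * E θ) / (r * E θ)) = _
    have hE0 : E θ ≠ 0 := by rw [← norm_ne_zero_iff, hEn]; norm_num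
    have hr0 : (r : ℂ) ≠ 0 := by exact_mod_cast hr.ne'
    have h1 : r • (cgrad f (r * E θ) / (r * E θ)) = cgrad f (r * E θ) * (E θ)⁻¹ := by
      rw [Complex.real_smul]; field_simp
    have h2 : (E θ)⁻¹ = starRingEnd ℂ (E θ) := by
      rw [Complex.inv_def, Complex.normSq_eq_norm_sq, hEn]; simp
    rw [h1, h2]
    apply Complex.ext
    · simp only [hA, hB, fderiv_apply_eq_cgrad]; simp; ring
    · simp only [hA, hB, fderiv_apply_eq_cgrad]; simp; ring
  rw [setIntegral_congr_fun (measurableSet_Ioi.prod measurableSet_Ioo) e, integral_add,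
    integral_mul_const, integral_complex_ofReal, integral_complex_ofReal]
  · rw [← hP, hAv, hBv]; simp
  · exact hAi.ofReal
  · exact hBi.ofReal.mul_const _

lemma integral_cgrad_div_sub {f : ℂ → ℝ} (hf : ContDiff ℝ 1 f) (hs : HasCompactSupport f)
    (ζ : ℂ) : ∫ z, cgrad f z / (z - ζ) = -(2 * π * f ζ : ℝ) := by
  have h := integral_cgrad_div_self (f := fun z => f (z + ζ)) (by fun_prop)
    (hs.comp_homeomorph (Homeomorph.addRight ζ))
  have e : ∀ z, cgrad (fun z => f (z + ζ)) z = cgrad f (z + ζ) := by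
    intro z; simp only [cgrad, fderiv_comp_add_right]
  simp only [e, zero_add] at h
  rw [← h, ← integral_add_right_eq_self _ ζ]
  simp

lemma integrableOn_closedBall_norm_inv (R : ℝ) :
    IntegrableOn (fun z : ℂ => ‖z‖⁻¹) (Metric.closedBall 0 R) := by
  have h : IntegrableOn (fun z : ℂ => ‖z‖⁻¹) (Metric.ball 0 (R + 1)) :=
    integrableOn_ball_of_norm_le_rpow (C := 1) (α := 1) (by simp) (by simp)
      (Eventually.of_forall fun z => by simp [Real.rpow_neg_one]) (by fun_prop)
  exact h.mono_set (Metric.closedBall_subset_ball (by linarith))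

/-- `2πi` times the winding number. -/
def windInt (g : ℝ → ℂ) (z : ℂ) : ℂ := ∫ t in Set.Icc 0 (2 * π), deriv g t / (g t - z)

namespace IsJordanParam
variable {g : ℝ → ℂ}

lemma volume_range (h : IsJordanParam g) : volume (Set.range g) = 0 := by
  have : Set.range g = (fun z : ℂ => g z.re) '' Set.univ := by
    rw [Set.image_univ]
    ext x; constructor
    · rintro ⟨t, rfl⟩; exact ⟨t, by simp⟩
    · rintro ⟨z, rfl⟩; exact ⟨z.re, rfl⟩
  rw [this]
  refine addHaar_image_eq_zero_of_det_fderivWithin_eq_zero volume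
    (f' := fun z => Complex.reCLM.smulRight (deriv g z.re)) (fun z _ => ?_) fun z _ => ?_
  · have := (h.hasDerivAt z.re).hasFDerivAt.comp z Complex.reCLM.hasFDerivAt
    refine (HasFDerivAt.congr_fderiv this ?_).hasFDerivWithinAt
    ext; simp
  · rw [ContinuousLinearMap.det]
    by_contra hne
    have hinj := (LinearMap.equivOfDetNeZero _ hne).injective
    have := @hinj Complex.I 0 (by simp [LinearMap.equivOfDetNeZero])
    exact Complex.I_ne_zero this

lemma hasDerivAt_windInt (h : IsJordanParam g) {z : ℂ} (hz : z ∉ Set.range g) :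
    HasDerivAt (windInt g) 0 z := by
  have hU : IsOpen (Set.range g)ᶜ := h.isCompact_range.isClosed.isOpen_compl
  have hne : ∀ z ∈ (Set.range g)ᶜ, ∀ t, g t - z ≠ 0 := by
    rintro z hz t h0
    exact hz ⟨t, sub_eq_zero.1 h0⟩
  have hc := h.continuous
  have hc' := h.continuous_deriv
  have hF : ContinuousOn (Function.uncurry fun (z : ℂ) t => deriv g t / (g t - z))
      ((Set.range g)ᶜ ×ˢ Set.Icc 0 (2 * π)) := by
    refine ContinuousOn.div (by fun_prop) (by fun_prop) ?_
    rintro ⟨z, t⟩ ⟨hz, -⟩; exact hne z hz t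
  have hG : ContinuousOn (Function.uncurry fun (z : ℂ) t => deriv g t / (g t - z) ^ 2)
      ((Set.range g)ᶜ ×ˢ Set.Icc 0 (2 * π)) := by
    refine ContinuousOn.div (by fun_prop) (by fun_prop) ?_
    rintro ⟨z, t⟩ ⟨hz, -⟩; exact pow_ne_zero _ (hne z hz t)
  have key := hasFDerivAt_setIntegral_of_continuousOn (𝕜 := ℂ) (m := volume) isCompact_Icc hU hF
    (F' := fun z t => (1 : ℂ →L[ℂ] ℂ).smulRight (deriv g t / (g t - z) ^ 2)) (by
      exact (ContinuousLinearMap.smulRightL ℂ ℂ ℂ 1).continuous.comp_continuousOn hG) (by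
      intro z hz t _
      have h1 : HasDerivAt (fun z => deriv g t / (g t - z)) (deriv g t / (g t - z) ^ 2) z := by
        refine ((hasDerivAt_const z (deriv g t)).div ((hasDerivAt_id z).const_sub (g t))
          (hne z hz t)).congr_deriv ?_
        simp
      exact h1.hasFDerivAt) hz
  refine key.hasDerivAt.congr_deriv ?_
  rw [ContinuousLinearMap.integral_apply]
  swap
  · refine ContinuousOn.integrableOn_compact isCompact_Icc ?_
    exact (ContinuousLinearMap.smulRightL ℂ ℂ ℂ 1).continuous.comp_continuousOn (hG.slice_right hz)
  simp only [ContinuousLinearMap.smulRight_apply, one_apply_eq_self, one_smul]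
  rw [integral_Icc_eq_integral_Ioc, ← intervalIntegral.integral_of_le (by positivity)]
  rw [intervalIntegral.integral_eq_sub_of_hasDerivAt (f := fun t => -(g t - z)⁻¹)]
  · have := h.periodic 0
    rw [zero_add] at this
    rw [this]; simp
  · intro t _
    have := (((h.hasDerivAt t).sub_const z).inv (hne z hz t)).neg
    refine this.congr_deriv ?_
    ring
  · apply Continuous.intervalIntegrable
    exact hc'.div (by fun_prop) fun t => pow_ne_zero _ (hne z hz t)

lemma eventually_windInt_eq (h : IsJordanParam g) {z : ℂ} (hz : z ∉ Set.range g) :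
    ∀ᶠ w in 𝓝 z, windInt g w = windInt g z := by
  have hU : IsOpen (Set.range g)ᶜ := h.isCompact_range.isClosed.isOpen_compl
  obtain ⟨δ, hδ, hb⟩ := Metric.isOpen_iff.1 hU z hz
  filter_upwards [Metric.ball_mem_nhds z hδ] with w hw
  exact Metric.isOpen_ball.is_const_of_deriv_eq_zero (convex_ball z δ).isPreconnected
    (fun y hy => (h.hasDerivAt_windInt (hb hy)).differentiableAt.differentiableWithinAt)
    (fun y hy => (h.hasDerivAt_windInt (hb hy)).deriv) hw (Metric.mem_ball_self hδ)

lemma exists_windInt (h : IsJordanParam g) {D : Set ℂ} (hD : IsOpen D)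
    (hb : Bornology.IsBounded D) (hf : frontier D = Set.range g) :
    ∃ k, (∀ z ∈ D, windInt g z = k) ∧ ∀ z ∉ closure D, windInt g z = 0 := by
  obtain ⟨k, b, hk, hb'⟩ := h.exists_const hD hb hf (f := windInt g)
    fun x hx => h.eventually_windInt_eq hx
  refine ⟨k, hk, ?_⟩
  suffices b = 0 by rwa [this] at hb'
  obtain ⟨R, hR⟩ := hb.closure.subset_closedBall 0
  obtain ⟨M, hM, hM'⟩ := h.exists_norm_deriv_le
  by_contra hne
  have hb0 : 0 < ‖b‖ := norm_pos_iff.2 hne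
  have hpi := Real.pi_pos
  set S : ℝ := |R| + 2 * π * M / ‖b‖ + 1 with hS
  have hSR : |R| < S := by have : 0 ≤ 2 * π * M / ‖b‖ := by positivity
                           linarith
  have hz : ((S : ℝ) : ℂ) ∉ closure D := by
    intro hc
    have := hR hc
    rw [mem_closedBall_zero_iff, Complex.norm_real, Real.norm_eq_abs] at this
    have h1 := le_abs_self S
    have h2 := le_abs_self R
    linarith
  have hgR : ∀ t, ‖g t‖ ≤ |R| := fun t => by
    have : g t ∈ closure D := frontier_subset_closure (hf ▸ ⟨t, rfl⟩)
    exact (mem_closedBall_zero_iff.1 (hR this)).trans (le_abs_self R)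
  have hbd : ‖windInt g S‖ ≤ M / (S - |R|) * (2 * π) := by
    have := norm_setIntegral_le_of_norm_le_const (μ := volume) (s := Set.Icc 0 (2 * π))
      (f := fun t => deriv g t / (g t - S)) (C := M / (S - |R|)) isCompact_Icc.measure_lt_top (by
        intro t _
        rw [norm_div]
        have h1 : S - |R| ≤ ‖g t - S‖ := by
          have := norm_sub_norm_le (S : ℂ) (g t)
          rw [norm_sub_rev, Complex.norm_real, Real.norm_eq_abs] at this
          have := hgR t
          have := le_abs_self S
          linarith
        exact div_le_div₀ hM.le (hM' t) (by linarith) h1)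
    simpa [windInt, measureReal_def, ENNReal.toReal_ofReal hpi.le] using this
  rw [hb' _ hz] at hbd
  have h3 : S - |R| = 2 * π * M / ‖b‖ + 1 := by rw [hS]; ring
  have h4 : 0 < S - |R| := by linarith
  rw [div_mul_eq_mul_div, le_div_iff₀ h4, h3, mul_add, mul_div_cancel₀ _ hb0.ne'] at hbd
  linarith

end IsJordanParam

lemma integrable_div_sub {f : ℂ → ℂ} (hf : Continuous f) (hs : HasCompactSupport f) (ζ : ℂ) :
    Integrable fun z => f z / (z - ζ) := by
  obtain ⟨C, hC⟩ := hs.exists_bound_of_continuous hf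
  obtain ⟨R, hR⟩ := hs.isCompact.isBounded.subset_closedBall ζ
  have h1 : IntegrableOn (fun z : ℂ => ‖z - ζ‖⁻¹) (Metric.closedBall ζ R) := by
    have := (measurePreserving_sub_right volume ζ).integrableOn_comp_preimage
      (MeasurableEquiv.subRight ζ).measurableEmbedding (f := fun z : ℂ => ‖z‖⁻¹)
      (s := Metric.closedBall 0 R)
    have e : (fun z : ℂ => z - ζ) ⁻¹' Metric.closedBall 0 R = Metric.closedBall ζ R := by
      ext z; simp [dist_eq_norm]
    rw [e] at this
    exact this.2 (integrableOn_closedBall_norm_inv R)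
  have h2 : IntegrableOn (fun z => f z / (z - ζ)) (Metric.closedBall ζ R) := by
    refine Integrable.mono' (h1.const_mul C) ?_ (Eventually.of_forall fun z => ?_)
    · exact (hf.measurable.div (measurable_id.sub_const ζ)).aestronglyMeasurable
    · rw [norm_div, div_eq_mul_inv]
      gcongr
      exact hC z
  refine (integrableOn_iff_integrable_of_support_subset fun z hz => ?_).1 h2
  apply hR
  apply subset_tsupport
  intro h0
  exact hz (by simp [h0])

namespace IsJordanParam
variable {g : ℝ → ℂ}

lemma integral_comp_mul_deriv (h : IsJordanParam g) {a : ℂ → ℝ} (ha : ContDiff ℝ 1 a)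
    (hs : HasCompactSupport a) :
    ∫ t in Set.Icc 0 (2 * π), (a (g t) : ℂ) * deriv g t
      = (2 * π : ℂ)⁻¹ * ∫ z, cgrad a z * windInt g z := by
  have hpi : (π : ℂ) ≠ 0 := by exact_mod_cast Real.pi_ne_zero
  have hc := h.continuous
  have hc' := h.continuous_deriv
  have hcg := ha.continuous_cgrad
  have hsg := hs.cgrad
  obtain ⟨M, hM, hM'⟩ := h.exists_norm_deriv_le
  have hF_int : Integrable (Function.uncurry fun (t : ℝ) (z : ℂ) => deriv g t * (cgrad a z / (z - g t)))
      ((volume.restrict (Set.Icc 0 (2 * π))).prod volume) := by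
    have hmeas : Measurable (Function.uncurry fun (t : ℝ) (z : ℂ) =>
        deriv g t * (cgrad a z / (z - g t))) := by
      have := hc.measurable; have := hc'.measurable; have := hcg.measurable
      unfold Function.uncurry
      fun_prop
    obtain ⟨C, hC⟩ := hsg.exists_bound_of_continuous hcg
    have hC0 : 0 ≤ C := (norm_nonneg _).trans (hC 0)
    obtain ⟨R₁, hR₁⟩ := hsg.isCompact.isBounded.subset_closedBall 0
    obtain ⟨R₂, hR₂⟩ := h.isCompact_range.isBounded.subset_closedBall 0
    rw [integrable_prod_iff hmeas.aestronglyMeasurable]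
    refine ⟨Eventually.of_forall fun t => (integrable_div_sub hcg hsg (g t)).const_mul (deriv g t), ?_⟩
    have hb : ∀ t, ∫ z, ‖deriv g t * (cgrad a z / (z - g t))‖
        ≤ M * (C * ∫ z in Metric.closedBall (0:ℂ) (R₁ + R₂), ‖z‖⁻¹) := by
      intro t
      simp only [norm_mul]
      rw [integral_const_mul]
      refine mul_le_mul (hM' t) ?_ (integral_nonneg fun _ => norm_nonneg _) hM.le
      rw [← integral_add_right_eq_self _ (g t)]
      simp only [add_sub_cancel_right]
      rw [← integral_const_mul, ← integral_indicator measurableSet_closedBall]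
      refine integral_mono_of_nonneg (Eventually.of_forall fun z => norm_nonneg _)
        (IntegrableOn.integrable_indicator ((integrableOn_closedBall_norm_inv _).const_mul C)
          measurableSet_closedBall) (Eventually.of_forall fun z => ?_)
      simp only
      by_cases hz : z ∈ Metric.closedBall (0:ℂ) (R₁ + R₂)
      · rw [Set.indicator_of_mem hz, norm_div, div_eq_mul_inv]
        gcongr; exact hC _
      · rw [Set.indicator_of_notMem hz]
        have : cgrad a (z + g t) = 0 := by
          by_contra hne
          have h1 := hR₁ (subset_tsupport _ hne)
          have h2 := hR₂ ⟨t, rfl⟩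
          rw [mem_closedBall_zero_iff] at h1 h2 hz
          have := norm_sub_le (z + g t) (g t)
          rw [add_sub_cancel_right] at this
          linarith
        simp [this]
    refine Integrable.of_bound (C := M * (C * ∫ z in Metric.closedBall (0:ℂ) (R₁ + R₂), ‖z‖⁻¹))
      ?_ (Eventually.of_forall fun t => ?_)
    · exact hmeas.norm.aestronglyMeasurable.integral_prod_right'
    · rw [Real.norm_of_nonneg (integral_nonneg fun _ => norm_nonneg _)]
      exact hb t
  have key := integral_integral_swap hF_int
  have e1 : ∀ t, ∫ z, deriv g t * (cgrad a z / (z - g t)) = -(2 * π) * ((a (g t) : ℂ) * deriv g t) := by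
    intro t
    rw [integral_const_mul, integral_cgrad_div_sub ha hs]
    push_cast; ring
  have e2 : ∀ z, ∫ t in Set.Icc 0 (2 * π), deriv g t * (cgrad a z / (z - g t))
      = - (cgrad a z * windInt g z) := by
    intro z
    rw [windInt, ← integral_const_mul, ← integral_neg]
    congr 1; ext t
    rw [← neg_sub (g t) z, div_neg]; ring
  simp only [e1, e2] at key
  rw [integral_const_mul, integral_neg] at key
  have : ∫ z, cgrad a z * windInt g z
      = 2 * π * ∫ t in Set.Icc 0 (2 * π), (a (g t) : ℂ) * deriv g t := by linear_combination key
  rw [this]; field_simp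

end IsJordanParam

/-- A bounded open set whose boundary is a positively oriented `C²` Jordan curve. -/
structure IsJordanDomain (g : ℝ → ℂ) (D : Set ℂ) : Prop extends IsJordanParam g where
  isOpen : IsOpen D
  isBounded : Bornology.IsBounded D
  frontier_eq : frontier D = Set.range g
  orient : (1 / 2) * ∫ t in (0:ℝ)..(2 * π), cross (g t) (deriv g t) = (volume D).toReal

namespace IsJordanDomain
variable {g : ℝ → ℂ} {D : Set ℂ}

lemma closure_eq (h : IsJordanDomain g D) : closure D = D ∪ Set.range g := by
  rw [← h.frontier_eq, closure_eq_interior_union_frontier, h.isOpen.interior_eq]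

lemma disjoint_range (h : IsJordanDomain g D) : Disjoint D (Set.range g) := by
  rw [← h.frontier_eq]; exact (disjoint_frontier_iff_isOpen.2 h.isOpen).symm

lemma nonempty (h : IsJordanDomain g D) : D.Nonempty := by
  rw [Set.nonempty_iff_ne_empty]
  rintro rfl
  have := h.frontier_eq
  rw [frontier_empty] at this
  exact (Set.range_nonempty g).ne_empty this.symm

lemma volume_toReal_pos (h : IsJordanDomain g D) : 0 < (volume D).toReal :=
  ENNReal.toReal_pos (h.isOpen.measure_pos _ h.nonempty).ne' h.isBounded.measure_lt_top.ne

lemma exists_integral_comp (h : IsJordanDomain g D) : ∃ k : ℂ, ∀ a : ℂ → ℝ, ContDiff ℝ 1 a →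
    ∫ t in (0:ℝ)..(2 * π), (a (g t) : ℂ) * deriv g t = k * ∫ z in D, cgrad a z := by
  obtain ⟨k, hk, hk0⟩ := h.exists_windInt h.isOpen h.isBounded h.frontier_eq
  refine ⟨(2 * π : ℂ)⁻¹ * k, fun a ha => ?_⟩
  rw [intervalIntegral.integral_of_le (by positivity), ← integral_Icc_eq_integral_Ioc]
  obtain ⟨R, hR⟩ := h.isBounded.closure.subset_ball 0
  let χ : ContDiffBump (0 : ℂ) := ⟨|R| + 1, |R| + 2, by positivity, by linarith⟩
  have hRR : Metric.ball (0:ℂ) R ⊆ Metric.ball 0 (|R| + 1) :=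
    Metric.ball_subset_ball (by linarith [le_abs_self R])
  have hχ : ∀ z ∈ closure D, (fun z => χ z * a z) =ᶠ[𝓝 z] a := by
    intro z hz
    filter_upwards [Metric.isOpen_ball.mem_nhds (hRR (hR hz))] with w hw
    rw [χ.one_of_mem_closedBall (Metric.ball_subset_closedBall hw), one_mul]
  have key := h.integral_comp_mul_deriv (a := fun z => χ z * a z) (χ.contDiff.mul ha)
    χ.hasCompactSupport.mul_right
  have e1 : ∀ t, χ (g t) * a (g t) = a (g t) := fun t =>
    (hχ (g t) (by rw [h.closure_eq]; exact Or.inr ⟨t, rfl⟩)).self_of_nhds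
  simp only [e1] at key
  rw [key, mul_assoc]
  congr 1
  rw [← integral_const_mul, ← integral_indicator h.isOpen.measurableSet]
  refine integral_congr_ae ?_
  have hn : ∀ᵐ z, z ∉ Set.range g := by
    exact measure_eq_zero_iff_ae_notMem.1 h.volume_range
  filter_upwards [hn] with z hz
  by_cases hzD : z ∈ D
  · rw [Set.indicator_of_mem hzD, hk z hzD, mul_comm]
    congr 1
    simp only [cgrad, (hχ z (subset_closure hzD)).fderiv_eq]
  · rw [Set.indicator_of_notMem hzD, hk0 z (by rw [h.closure_eq]; rintro (h1 | h1) <;> contradiction),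
      mul_zero]

/-- Green's formula. -/
lemma integral_comp_mul_deriv (h : IsJordanDomain g D) {a : ℂ → ℝ} (ha : ContDiff ℝ 1 a) :
    ∫ t in (0:ℝ)..(2 * π), (a (g t) : ℂ) * deriv g t = Complex.I * ∫ z in D, cgrad a z := by
  obtain ⟨k, hk⟩ := h.exists_integral_comp
  suffices k = Complex.I by rw [← this]; exact hk a ha
  have hc := h.continuous
  have hc' := h.continuous_deriv
  have hv := h.volume_toReal_pos
  have g1 : ∀ z, cgrad Complex.re z = 1 := by
    intro z
    have : fderiv ℝ Complex.re z = Complex.reCLM := Complex.reCLM.fderiv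
    apply Complex.ext <;> simp [cgrad, this]
  have g2 : ∀ z, cgrad Complex.im z = Complex.I := by
    intro z
    have : fderiv ℝ Complex.im z = Complex.imCLM := Complex.imCLM.fderiv
    apply Complex.ext <;> simp [cgrad, this]
  have k1 := hk Complex.re Complex.reCLM.contDiff
  have k2 := hk Complex.im Complex.imCLM.contDiff
  simp only [g1, g2, integral_const, measureReal_restrict_apply MeasurableSet.univ,
    Set.univ_inter] at k1 k2
  have hi : ∀ f : ℝ → ℂ, Continuous f → IntervalIntegrable f volume 0 (2 * π) :=
    fun f hf => hf.intervalIntegrable _ _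
  have r1 : ∫ t in (0:ℝ)..(2 * π), (g t).re * (deriv g t).re = k.re * (volume D).toReal := by
    have := congrArg Complex.re k1
    rw [← Complex.reCLM_apply, ← Complex.reCLM.intervalIntegral_comp_comm (hi _ (by fun_prop))] at this
    simpa [measureReal_def, mul_comm] using this
  have r2 : ∫ t in (0:ℝ)..(2 * π), (g t).re * (deriv g t).im = k.im * (volume D).toReal := by
    have := congrArg Complex.im k1
    rw [← Complex.imCLM_apply, ← Complex.imCLM.intervalIntegral_comp_comm (hi _ (by fun_prop))] at this
    simpa [measureReal_def, mul_comm] using this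
  have r3 : ∫ t in (0:ℝ)..(2 * π), (g t).im * (deriv g t).re = -(k.im * (volume D).toReal) := by
    have := congrArg Complex.re k2
    rw [← Complex.reCLM_apply, ← Complex.reCLM.intervalIntegral_comp_comm (hi _ (by fun_prop))] at this
    simpa [measureReal_def, mul_comm] using this
  have r0 : ∫ t in (0:ℝ)..(2 * π), (g t).re * (deriv g t).re = 0 := by
    rw [intervalIntegral.integral_eq_sub_of_hasDerivAt (f := fun t => (g t).re ^ 2 / 2)]
    · have := h.periodic 0
      rw [zero_add] at this
      rw [this]; simp
    · intro t _
      have h1 : HasDerivAt (fun t => (g t).re) (deriv g t).re t :=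
        Complex.reCLM.hasFDerivAt.comp_hasDerivAt t (h.hasDerivAt t)
      refine ((h1.pow 2).div_const 2).congr_deriv ?_
      simp; ring
    · apply Continuous.intervalIntegrable; fun_prop
  have ho := h.orient
  simp only [cross] at ho
  rw [intervalIntegral.integral_sub, r2, r3] at ho
  · rw [r0] at r1
    apply Complex.ext
    · simp only [Complex.I_re]
      exact (mul_eq_zero.1 r1.symm).resolve_right hv.ne'
    · simp only [Complex.I_im]
      have : k.im * (volume D).toReal = 1 * (volume D).toReal := by linarith
      exact mul_right_cancel₀ hv.ne' this
  · apply Continuous.intervalIntegrable; fun_prop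
  · apply Continuous.intervalIntegrable; fun_prop

end IsJordanDomain

/-- The divergence theorem. -/
lemma IsJordanDomain.integral_div {g : ℝ → ℂ} {D : Set ℂ} (h : IsJordanDomain g D) {V : ℂ → ℂ}
    (hV : ContDiff ℝ 1 V) :
    ∫ z in D, ((fderiv ℝ V z 1).re + (fderiv ℝ V z Complex.I).im)
      = ∫ t in (0:ℝ)..(2 * π), cross (V (g t)) (deriv g t) := by
  have hc := h.continuous
  have hc' := h.continuous_deriv
  have hVc := hV.continuous
  have hP : ContDiff ℝ 1 fun z => (V z).re := Complex.reCLM.contDiff.comp hV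
  have hQ : ContDiff ℝ 1 fun z => (V z).im := Complex.imCLM.contDiff.comp hV
  have dP : ∀ z, (cgrad (fun z => (V z).re) z).re = (fderiv ℝ V z 1).re := fun z => by
    have : HasFDerivAt (fun z => (V z).re) (Complex.reCLM.comp (fderiv ℝ V z)) z :=
      Complex.reCLM.hasFDerivAt.comp z (hV.differentiable (by norm_num)).differentiableAt.hasFDerivAt
    simp [cgrad, this.fderiv]
  have dQ : ∀ z, (cgrad (fun z => (V z).im) z).im = (fderiv ℝ V z Complex.I).im := fun z => by
    have : HasFDerivAt (fun z => (V z).im) (Complex.imCLM.comp (fderiv ℝ V z)) z :=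
      Complex.imCLM.hasFDerivAt.comp z (hV.differentiable (by norm_num)).differentiableAt.hasFDerivAt
    simp [cgrad, this.fderiv]
  have hi : ∀ f : ℝ → ℂ, Continuous f → IntervalIntegrable f volume 0 (2 * π) :=
    fun f hf => hf.intervalIntegrable _ _
  have hI : ∀ {F : Type} [NormedAddCommGroup F] (f : ℂ → F), Continuous f → IntegrableOn f D :=
    fun f hf => (hf.continuousOn.integrableOn_compact h.isBounded.isCompact_closure).mono_set
      subset_closure
  have kP := congrArg Complex.im (h.integral_comp_mul_deriv hP)
  have kQ := congrArg Complex.re (h.integral_comp_mul_deriv hQ)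
  rw [← Complex.imCLM_apply, ← Complex.imCLM.intervalIntegral_comp_comm (hi _ (by fun_prop))] at kP
  rw [← Complex.reCLM_apply, ← Complex.reCLM.intervalIntegral_comp_comm (hi _ (by fun_prop))] at kQ
  have sP : (∫ z in D, cgrad (fun z => (V z).re) z).re = ∫ z in D, (fderiv ℝ V z 1).re := by
    rw [← Complex.reCLM_apply, ← Complex.reCLM.integral_comp_comm (hI _ hP.continuous_cgrad)]
    simp only [Complex.reCLM_apply, dP]
  have sQ : (∫ z in D, cgrad (fun z => (V z).im) z).im = ∫ z in D, (fderiv ℝ V z Complex.I).im := by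
    rw [← Complex.imCLM_apply, ← Complex.imCLM.integral_comp_comm (hI _ hQ.continuous_cgrad)]
    simp only [Complex.imCLM_apply, dQ]
  simp only [Complex.imCLM_apply, Complex.reCLM_apply, Complex.mul_im, Complex.mul_re,
    Complex.ofReal_re, Complex.ofReal_im, Complex.I_re, Complex.I_im, zero_mul, add_zero, sub_zero,
    one_mul, zero_add, zero_sub, sP, sQ] at kP kQ
  have hd : Continuous (fderiv ℝ V) := hV.continuous_fderiv (by norm_num)
  rw [integral_add (hI _ (by fun_prop)) (hI _ (by fun_prop)), ← kP, ← neg_neg (∫ z in D, _), ← kQ]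
  simp only [cross]
  rw [intervalIntegral.integral_sub, sub_eq_add_neg]
  · apply Continuous.intervalIntegrable; fun_prop
  · apply Continuous.intervalIntegrable; fun_prop

section Potential

/-- The measure `∑ⱼ dt` on the disjoint union of `N` parameter lines. -/
abbrev paramMeasure (N : ℕ) : Measure (Fin N × ℝ) := Measure.count.prod volume

/-- The disjoint union of `N` parameter intervals `[0, 2π]`. -/
abbrev paramSet (N : ℕ) : Set (Fin N × ℝ) := Set.univ ×ˢ Set.Icc 0 (2 * π)

lemma isCompact_paramSet (N : ℕ) : IsCompact (paramSet N) := isCompact_univ.prod isCompact_Icc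

variable {N : ℕ} (p : Fin N × ℝ → ℂ) (σ : Fin N × ℝ → ℝ)

/-- Logarithmic potential of the charge `σ`, regularized at scale `ε`. -/
def pot (ε : ℝ) (x : ℂ) : ℝ :=
  ∫ τ in paramSet N, σ τ * (1 / 2 * Real.log (‖x - p τ‖ ^ 2 + ε ^ 2)) ∂paramMeasure N

/-- The gradient of `pot`. -/
def potGrad (ε : ℝ) (x : ℂ) : ℂ :=
  ∫ τ in paramSet N, (σ τ * (‖x - p τ‖ ^ 2 + ε ^ 2)⁻¹) • (x - p τ) ∂paramMeasure N

/-- The Laplacian of `pot`. -/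
def potLap (ε : ℝ) (x : ℂ) : ℝ :=
  ∫ τ in paramSet N, σ τ * (2 * ε ^ 2 / (‖x - p τ‖ ^ 2 + ε ^ 2) ^ 2) ∂paramMeasure N

variable {p σ}

/-- The real inner product of the plane, as a bilinear map. -/
def dotCLM : ℂ →L[ℝ] ℂ →L[ℝ] ℝ :=
  Complex.reCLM.smulRight Complex.reCLM + Complex.imCLM.smulRight Complex.imCLM

@[simp] lemma dotCLM_apply (w v : ℂ) : dotCLM w v = w.re * v.re + w.im * v.im := by
  simp [dotCLM]

lemma dotCLM_self (w : ℂ) : dotCLM w w = ‖w‖ ^ 2 := by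
  rw [dotCLM_apply, ← Complex.normSq_eq_norm_sq, Complex.normSq_apply]

lemma hasFDerivAt_norm_sub_sq (q x : ℂ) :
    HasFDerivAt (fun x => ‖x - q‖ ^ 2) ((2 : ℝ) • dotCLM (x - q)) x := by
  have := ((hasFDerivAt_id x).sub_const q).norm_sq
  refine this.congr_fderiv ?_
  ext v
  simp [Complex.inner]
  ring

lemma hasFDerivAt_pot (hp : Continuous p) (hσ : Continuous σ) {ε : ℝ} {U : Set ℂ} (hU : IsOpen U)
    (hne : ∀ x ∈ U, ∀ τ ∈ paramSet N, ‖x - p τ‖ ^ 2 + ε ^ 2 ≠ 0) {x : ℂ} (hx : x ∈ U) :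
    HasFDerivAt (pot p σ ε) (dotCLM (potGrad p σ ε x)) x := by
  have hA : ContinuousOn (fun q : ℂ × (Fin N × ℝ) => ‖q.1 - p q.2‖ ^ 2 + ε ^ 2) (U ×ˢ paramSet N) := by
    fun_prop
  have hA0 : ∀ q ∈ U ×ˢ paramSet N, ‖q.1 - p q.2‖ ^ 2 + ε ^ 2 ≠ 0 :=
    fun q hq => hne q.1 hq.1 q.2 hq.2
  have hG : ContinuousOn (Function.uncurry fun (x : ℂ) (τ : Fin N × ℝ) =>
      (σ τ * (‖x - p τ‖ ^ 2 + ε ^ 2)⁻¹) • (x - p τ)) (U ×ˢ paramSet N) :=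
    ContinuousOn.smul (ContinuousOn.mul (by fun_prop) (hA.inv₀ hA0)) (by fun_prop)
  have hF : ContinuousOn (Function.uncurry fun (x : ℂ) (τ : Fin N × ℝ) =>
      σ τ * (1 / 2 * Real.log (‖x - p τ‖ ^ 2 + ε ^ 2))) (U ×ˢ paramSet N) :=
    ContinuousOn.mul (by fun_prop) (ContinuousOn.mul (by fun_prop) (hA.log hA0))
  have key := hasFDerivAt_setIntegral_of_continuousOn (𝕜 := ℝ) (m := paramMeasure N)
    (isCompact_paramSet N) hU hF
    (F' := fun x τ => dotCLM ((σ τ * (‖x - p τ‖ ^ 2 + ε ^ 2)⁻¹) • (x - p τ)))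
    (dotCLM.continuous.comp_continuousOn hG) (by
      intro y hy τ hτ
      have h1 := (((hasFDerivAt_norm_sub_sq (p τ) y).add_const (ε ^ 2)).log (hne y hy τ hτ))
      refine ((h1.const_mul (1 / 2)).const_mul (σ τ)).congr_fderiv ?_
      rw [map_smul, smul_smul, smul_smul, smul_smul]
      congr 1; ring) hx
  refine key.congr_fderiv ?_
  rw [potGrad]
  exact ContinuousLinearMap.integral_comp_comm dotCLM
    ((hG.slice_right hx).integrableOn_compact (isCompact_paramSet N))

/-- Derivative of the kernel `w ↦ w / (‖w‖² + ε²)`. -/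
def dker (ε : ℝ) (w : ℂ) : ℂ →L[ℝ] ℂ :=
  (‖w‖ ^ 2 + ε ^ 2)⁻¹ • ContinuousLinearMap.id ℝ ℂ
    - (2 * ((‖w‖ ^ 2 + ε ^ 2)⁻¹) ^ 2) • (dotCLM w).smulRight w

lemma norm_sq_add_sq_pos {ε : ℝ} (hε : ε ≠ 0) (w : ℂ) : 0 < ‖w‖ ^ 2 + ε ^ 2 := by positivity

lemma continuous_dker {ε : ℝ} (hε : ε ≠ 0) : Continuous (dker ε) := by
  have h : Continuous fun w : ℂ => (‖w‖ ^ 2 + ε ^ 2)⁻¹ :=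
    Continuous.inv₀ (by fun_prop) fun w => (norm_sq_add_sq_pos hε w).ne'
  have h2 : Continuous fun w : ℂ => (dotCLM w).smulRight w :=
    ((ContinuousLinearMap.smulRightL ℝ ℂ ℂ).continuous.comp dotCLM.continuous).clm_apply
      continuous_id
  unfold dker
  fun_prop

lemma dker_apply (ε : ℝ) (w v : ℂ) : dker ε w v = (‖w‖ ^ 2 + ε ^ 2)⁻¹ • v
    - (2 * ((‖w‖ ^ 2 + ε ^ 2)⁻¹) ^ 2 * dotCLM w v) • w := by
  simp [dker, mul_smul, -dotCLM_apply]

lemma dker_div {ε : ℝ} (hε : ε ≠ 0) (w : ℂ) : (dker ε w 1).re + (dker ε w Complex.I).im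
    = 2 * ε ^ 2 / (‖w‖ ^ 2 + ε ^ 2) ^ 2 := by
  have h0 := (norm_sq_add_sq_pos hε w).ne'
  have h1 : w.re ^ 2 + w.im ^ 2 = ‖w‖ ^ 2 := by
    rw [← Complex.normSq_eq_norm_sq, Complex.normSq_apply]; ring
  have e1 : dotCLM w 1 = w.re := by simp
  have e2 : dotCLM w Complex.I = w.im := by simp
  simp only [dker_apply, e1, e2, Complex.sub_re, Complex.sub_im, Complex.smul_re, Complex.smul_im,
    Complex.one_re, Complex.I_im, smul_eq_mul]
  field_simp
  linear_combination (-2) * h1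

lemma hasFDerivAt_potGrad (hp : Continuous p) (hσ : Continuous σ) {ε : ℝ} (hε : ε ≠ 0) (x : ℂ) :
    HasFDerivAt (potGrad p σ ε) (∫ τ in paramSet N, σ τ • dker ε (x - p τ) ∂paramMeasure N) x := by
  have hd := continuous_dker hε
  have h : Continuous fun w : ℂ => (‖w‖ ^ 2 + ε ^ 2)⁻¹ :=
    Continuous.inv₀ (by fun_prop) fun w => (norm_sq_add_sq_pos hε w).ne'
  refine hasFDerivAt_setIntegral_of_continuousOn (𝕜 := ℝ) (m := paramMeasure N)
    (isCompact_paramSet N) isOpen_univ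
    (F := fun x τ => (σ τ * (‖x - p τ‖ ^ 2 + ε ^ 2)⁻¹) • (x - p τ))
    (F' := fun x τ => σ τ • dker ε (x - p τ)) ?_ ?_ ?_ (Set.mem_univ x)
  · apply Continuous.continuousOn
    have : Continuous fun q : ℂ × (Fin N × ℝ) => (‖q.1 - p q.2‖ ^ 2 + ε ^ 2)⁻¹ :=
      h.comp (g := fun w : ℂ => (‖w‖ ^ 2 + ε ^ 2)⁻¹) 
        (f := fun q : ℂ × (Fin N × ℝ) => q.1 - p q.2) (by fun_prop)
    unfold Function.uncurry; fun_prop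
  · apply Continuous.continuousOn
    unfold Function.uncurry; fun_prop
  · intro y _ τ _
    have h0 := (norm_sq_add_sq_pos hε (y - p τ)).ne'
    have h1 : HasFDerivAt (fun y => (‖y - p τ‖ ^ 2 + ε ^ 2)⁻¹) _ y :=
      (hasDerivAt_inv h0).comp_hasFDerivAt y
        ((hasFDerivAt_norm_sub_sq (p τ) y).add_const (ε ^ 2))
    have h2 := (h1.const_mul (σ τ)).smul ((hasFDerivAt_id y).sub_const (p τ))
    refine h2.congr_fderiv (ContinuousLinearMap.ext fun v => ?_)
    simp [dker_apply]
    ring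

lemma integrableOn_dker (hp : Continuous p) (hσ : Continuous σ) {ε : ℝ} (hε : ε ≠ 0) (x : ℂ) :
    IntegrableOn (fun τ => σ τ • dker ε (x - p τ)) (paramSet N) (paramMeasure N) := by
  have hd := continuous_dker hε
  exact (by fun_prop : Continuous fun τ => σ τ • dker ε (x - p τ)).continuousOn.integrableOn_compact
    (isCompact_paramSet N)

lemma contDiff_potGrad (hp : Continuous p) (hσ : Continuous σ) {ε : ℝ} (hε : ε ≠ 0) :
    ContDiff ℝ 1 (potGrad p σ ε) := by
  have hd := continuous_dker hε
  rw [contDiff_one_iff_hasFDerivAt]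
  refine ⟨_, ?_, fun x => hasFDerivAt_potGrad hp hσ hε x⟩
  rw [continuous_iff_continuousAt]
  intro x
  refine continuousAt_setIntegral_of_continuousOn (m := paramMeasure N) (isCompact_paramSet N)
    isOpen_univ (F := fun x τ => σ τ • dker ε (x - p τ)) ?_ (Set.mem_univ x)
  apply Continuous.continuousOn
  unfold Function.uncurry; fun_prop

lemma div_potGrad (hp : Continuous p) (hσ : Continuous σ) {ε : ℝ} (hε : ε ≠ 0) (x : ℂ) :
    (fderiv ℝ (potGrad p σ ε) x 1).re + (fderiv ℝ (potGrad p σ ε) x Complex.I).im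
      = potLap p σ ε x := by
  have hi := integrableOn_dker hp hσ hε x
  rw [(hasFDerivAt_potGrad hp hσ hε x).fderiv, ContinuousLinearMap.integral_apply hi,
    ContinuousLinearMap.integral_apply hi, ← Complex.reCLM_apply, ← Complex.imCLM_apply,
    ← Complex.reCLM.integral_comp_comm (hi.apply_continuousLinearMap _),
    ← Complex.imCLM.integral_comp_comm (hi.apply_continuousLinearMap _),
    ← integral_add, potLap]
  · congr 1; ext τ
    simp only [Complex.reCLM_apply, Complex.imCLM_apply, _root_.smul_apply,
      Complex.smul_re, Complex.smul_im, smul_eq_mul, ← mul_add, dker_div hε]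
  · exact Complex.reCLM.integrable_comp (hi.apply_continuousLinearMap _)
  · exact Complex.imCLM.integrable_comp (hi.apply_continuousLinearMap _)

end Potential

lemma log_sub_log_le {A B : ℝ} (hB : 0 < B) (hAB : B ≤ A) :
    Real.log A - Real.log B ≤ 2 * (√(A - B) * B ^ (-(1 / 2) : ℝ)) := by
  have hA : 0 < A := hB.trans_le hAB
  have h1 : Real.log A - Real.log B = 2 * Real.log √(A / B) := by
    rw [Real.log_sqrt (by positivity), Real.log_div hA.ne' hB.ne']; ring
  have h2 : Real.log √(A / B) ≤ √(A / B) - 1 :=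
    Real.log_le_sub_one_of_pos (Real.sqrt_pos.2 (by positivity))
  have h3 : √(A / B) ≤ 1 + √((A - B) / B) := by
    rw [Real.sqrt_le_left (by positivity)]
    have h4 : 0 ≤ (A - B) / B := div_nonneg (by linarith) hB.le
    have h5 : A / B = 1 + (A - B) / B := by field_simp; ring
    have := Real.sq_sqrt h4
    have := Real.sqrt_nonneg ((A - B) / B)
    nlinarith
  have h6 : √((A - B) / B) = √(A - B) * B ^ (-(1 / 2) : ℝ) := by
    rw [Real.sqrt_div' _ hB.le, Real.rpow_neg hB.le, ← Real.sqrt_eq_rpow, div_eq_mul_inv]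
  rw [← h6, h1]; linarith

lemma abs_log_sub_log_le {A B : ℝ} (hA : 0 < A) (hB : 0 < B) :
    |Real.log A - Real.log B| ≤ 2 * √|A - B| * (A ^ (-(1 / 2) : ℝ) + B ^ (-(1 / 2) : ℝ)) := by
  have hA' : 0 ≤ A ^ (-(1 / 2) : ℝ) := by positivity
  have hB' : 0 ≤ B ^ (-(1 / 2) : ℝ) := by positivity
  rcases le_total B A with h | h
  · have := log_sub_log_le hB h
    rw [abs_of_nonneg (by linarith [Real.log_le_log hB h]), abs_of_nonneg (sub_nonneg.2 h)]
    nlinarith [mul_nonneg (Real.sqrt_nonneg (A - B)) hA']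
  · have := log_sub_log_le hA h
    rw [abs_of_nonpos (by linarith [Real.log_le_log hA h]), abs_of_nonpos (sub_nonpos.2 h), neg_sub,
      neg_sub]
    nlinarith [mul_nonneg (Real.sqrt_nonneg (B - A)) hB']

lemma abs_half_log_sub_le {q : ℂ} {x y : ℂ} (hx : x ≠ q) (hy : y ≠ q) (ε δ : ℝ) :
    |1 / 2 * Real.log (‖x - q‖ ^ 2 + ε ^ 2) - 1 / 2 * Real.log (‖y - q‖ ^ 2 + δ ^ 2)|
      ≤ 2 * √(‖x - y‖ + |ε| + |δ|) *
        (‖x - q‖ ^ (-(1 / 2) : ℝ) + ‖y - q‖ ^ (-(1 / 2) : ℝ)) := by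
  have ha : 0 < ‖x - q‖ := norm_pos_iff.2 (sub_ne_zero.2 hx)
  have hb : 0 < ‖y - q‖ := norm_pos_iff.2 (sub_ne_zero.2 hy)
  have key : ∀ a e : ℝ, 0 < a → a ≤ √(a ^ 2 + e ^ 2) ∧ √(a ^ 2 + e ^ 2) ≤ a + |e| ∧
      1 / 2 * Real.log (a ^ 2 + e ^ 2) = Real.log √(a ^ 2 + e ^ 2) := by
    intro a e h
    refine ⟨Real.le_sqrt_of_sq_le (by nlinarith [sq_nonneg e]), ?_, ?_⟩
    · rw [Real.sqrt_le_left (by positivity), ← sq_abs e]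
      nlinarith [abs_nonneg e]
    · rw [Real.log_sqrt (by positivity)]; ring
  obtain ⟨a1, a2, a3⟩ := key _ ε ha
  obtain ⟨b1, b2, b3⟩ := key _ δ hb
  rw [a3, b3]
  refine (abs_log_sub_log_le (ha.trans_le a1) (hb.trans_le b1)).trans ?_
  have h1 : |‖x - q‖ - ‖y - q‖| ≤ ‖x - y‖ := by
    have := abs_norm_sub_norm_le (x - q) (y - q)
    rwa [sub_sub_sub_cancel_right] at this
  have h2 := abs_le.1 h1
  have h3 := abs_nonneg ε
  have h4 := abs_nonneg δ
  gcongr 2 * √?_ * (?_ + ?_)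
  · rw [abs_le]; constructor <;> linarith
  · exact Real.rpow_le_rpow_of_nonpos ha a1 (by norm_num)
  · exact Real.rpow_le_rpow_of_nonpos hb b1 (by norm_num)

/-- The mild-singularity condition on a charge carrier which makes its potentials continuous. -/
structure IsMild {N : ℕ} (p : Fin N × ℝ → ℂ) : Prop where
  continuous : Continuous p
  ae_ne : ∀ x, ∀ᵐ τ ∂(paramMeasure N).restrict (paramSet N), x ≠ p τ
  exists_integral_le : ∃ C, ∀ x,
    IntegrableOn (fun τ => ‖x - p τ‖ ^ (-(1 / 2) : ℝ)) (paramSet N) (paramMeasure N) ∧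
    ∫ τ in paramSet N, ‖x - p τ‖ ^ (-(1 / 2) : ℝ) ∂paramMeasure N ≤ C

namespace IsMild
variable {N : ℕ} {p : Fin N × ℝ → ℂ} {σ : Fin N × ℝ → ℝ}

lemma exists_bound (hσ : Continuous σ) : ∃ M, 0 ≤ M ∧ ∀ τ ∈ paramSet N, |σ τ| ≤ M := by
  obtain ⟨M, hM⟩ := (isCompact_paramSet N).exists_bound_of_continuousOn hσ.continuousOn
  exact ⟨max M 0, le_max_right _ _, fun τ hτ => (hM τ hτ).trans (le_max_left _ _)⟩

lemma integrableOn_pot_of_ne_zero (hp : IsMild p) (hσ : Continuous σ) {ε : ℝ} (hε : ε ≠ 0) (x : ℂ) :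
    IntegrableOn (fun τ => σ τ * (1 / 2 * Real.log (‖x - p τ‖ ^ 2 + ε ^ 2)))
      (paramSet N) (paramMeasure N) := by
  have hc := hp.continuous
  have : Continuous fun τ => Real.log (‖x - p τ‖ ^ 2 + ε ^ 2) :=
    Continuous.log (by fun_prop) fun τ => (norm_sq_add_sq_pos hε _).ne'
  exact (by fun_prop : Continuous _).continuousOn.integrableOn_compact (isCompact_paramSet N)

lemma ae_abs_sub_le (hp : IsMild p) {M : ℝ} (hM : ∀ τ ∈ paramSet N, |σ τ| ≤ M) (x y : ℂ) (ε δ : ℝ) :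
    ∀ᵐ τ ∂(paramMeasure N).restrict (paramSet N),
      ‖σ τ * (1 / 2 * Real.log (‖x - p τ‖ ^ 2 + ε ^ 2))
        - σ τ * (1 / 2 * Real.log (‖y - p τ‖ ^ 2 + δ ^ 2))‖ ≤
      M * (2 * √(‖x - y‖ + |ε| + |δ|)) *
        (‖x - p τ‖ ^ (-(1 / 2) : ℝ) + ‖y - p τ‖ ^ (-(1 / 2) : ℝ)) := by
  filter_upwards [hp.ae_ne x, hp.ae_ne y,
    ae_restrict_mem (isCompact_paramSet N).measurableSet] with τ hx hy hτ
  rw [← mul_sub, Real.norm_eq_abs, abs_mul, mul_assoc M]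
  exact mul_le_mul (hM τ hτ) (abs_half_log_sub_le hx hy ε δ) (abs_nonneg _)
    ((abs_nonneg _).trans (hM τ hτ))

lemma integrableOn_pot (hp : IsMild p) (hσ : Continuous σ) (ε : ℝ) (x : ℂ) :
    IntegrableOn (fun τ => σ τ * (1 / 2 * Real.log (‖x - p τ‖ ^ 2 + ε ^ 2)))
      (paramSet N) (paramMeasure N) := by
  have hc := hp.continuous
  obtain ⟨M, -, hM⟩ := exists_bound (N := N) hσ
  obtain ⟨C, hC⟩ := hp.exists_integral_le
  have h1 := hp.integrableOn_pot_of_ne_zero hσ one_ne_zero x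
  have h2 : IntegrableOn (fun τ => σ τ * (1 / 2 * Real.log (‖x - p τ‖ ^ 2 + ε ^ 2))
      - σ τ * (1 / 2 * Real.log (‖x - p τ‖ ^ 2 + 1 ^ 2))) (paramSet N) (paramMeasure N) := by
    refine Integrable.mono' (((hC x).1.add (hC x).1).const_mul _) ?_ (hp.ae_abs_sub_le hM x x ε 1)
    have := hc.measurable; have := hσ.measurable
    apply Measurable.aestronglyMeasurable
    fun_prop
  refine (h2.add h1).congr (Eventually.of_forall fun τ => ?_)
  simp

lemma exists_abs_pot_sub_le (hp : IsMild p) (hσ : Continuous σ) : ∃ C, 0 ≤ C ∧ ∀ ε x y,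
    |pot p σ ε x - pot p σ 0 y| ≤ C * √(‖x - y‖ + |ε|) := by
  obtain ⟨M, hM0, hM⟩ := exists_bound (N := N) hσ
  obtain ⟨C, hC⟩ := hp.exists_integral_le
  have hC0 : 0 ≤ C := (integral_nonneg fun τ => by positivity).trans (hC 0).2
  refine ⟨M * 2 * (C + C), by positivity, fun ε x y => ?_⟩
  rw [pot, pot, ← integral_sub (hp.integrableOn_pot hσ ε x) (hp.integrableOn_pot hσ 0 y)]
  refine (norm_integral_le_of_norm_le (((hC x).1.add (hC y).1).const_mul _)
    (hp.ae_abs_sub_le hM x y ε 0)).trans ?_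
  rw [integral_const_mul]
  simp only [Pi.add_apply]
  rw [integral_add (hC x).1 (hC y).1]
  simp only [abs_zero, add_zero]
  have := add_le_add (hC x).2 (hC y).2
  calc _ ≤ M * (2 * √(‖x - y‖ + |ε|)) * (C + C) := by gcongr
    _ = _ := by ring

lemma tendsto_pot (hp : IsMild p) (hσ : Continuous σ) (y : ℂ) :
    Tendsto (fun q : ℝ × ℂ => pot p σ q.1 q.2) (𝓝 0 ×ˢ 𝓝 y) (𝓝 (pot p σ 0 y)) := by
  obtain ⟨C, -, hC⟩ := hp.exists_abs_pot_sub_le hσ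
  rw [tendsto_iff_norm_sub_tendsto_zero]
  refine squeeze_zero (fun _ => norm_nonneg _) (fun q => hC q.1 q.2 y) ?_
  have h : Tendsto (fun q : ℝ × ℂ => ‖q.2 - y‖ + |q.1|) (𝓝 0 ×ˢ 𝓝 y) (𝓝 (‖y - y‖ + |0|)) :=
    ((tendsto_snd.sub_const y).norm).add tendsto_fst.abs
  have h2 := (h.sqrt).const_mul C
  rwa [sub_self, norm_zero, abs_zero, add_zero, Real.sqrt_zero, mul_zero] at h2

lemma continuous_pot_zero (hp : IsMild p) (hσ : Continuous σ) : Continuous (pot p σ 0) := by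
  rw [continuous_iff_continuousAt]
  intro y
  have h : Tendsto (fun x : ℂ => ((0:ℝ), x)) (𝓝 y) (𝓝 0 ×ˢ 𝓝 y) :=
    tendsto_const_nhds.prodMk tendsto_id
  have h2 := (hp.tendsto_pot hσ y).comp h
  rwa [Function.comp_def] at h2

end IsMild

section Params
variable {N : ℕ}

lemma continuous_uncurry_fin {X : Type*} [TopologicalSpace X] {g : Fin N → ℝ → X}
    (hg : ∀ j, Continuous (g j)) : Continuous fun τ : Fin N × ℝ => g τ.1 τ.2 :=
  continuous_prod_of_discrete_left.2 hg

lemma restrict_paramSet (N : ℕ) : (paramMeasure N).restrict (paramSet N)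
    = Measure.count.prod (volume.restrict (Set.Icc 0 (2 * π))) := by
  rw [paramMeasure, paramSet, ← Measure.prod_restrict, Measure.restrict_univ]

lemma ae_paramSet {P : Fin N × ℝ → Prop} (hP : MeasurableSet {τ | P τ})
    (h : ∀ j, ∀ᵐ t ∂volume.restrict (Set.Icc 0 (2 * π)), P (j, t)) :
    ∀ᵐ τ ∂(paramMeasure N).restrict (paramSet N), P τ := by
  rw [restrict_paramSet, Measure.ae_prod_iff_ae_ae hP]
  exact Eventually.of_forall h

lemma integral_paramSet {E : Type*} [NormedAddCommGroup E] [NormedSpace ℝ E]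
    [CompleteSpace E] {f : Fin N × ℝ → E} (hf : IntegrableOn f (paramSet N) (paramMeasure N)) :
    ∫ τ in paramSet N, f τ ∂paramMeasure N = ∑ j, ∫ t in (0:ℝ)..(2 * π), f (j, t) := by
  rw [IntegrableOn, restrict_paramSet] at hf
  rw [restrict_paramSet, integral_prod _ hf, integral_count]
  refine Finset.sum_congr rfl fun j _ => ?_
  rw [intervalIntegral.integral_of_le (by positivity), integral_Icc_eq_integral_Ioc]

lemma integrableOn_paramSet {E : Type*} [NormedAddCommGroup E] {f : Fin N × ℝ → E}
    (hm : AEStronglyMeasurable f ((paramMeasure N).restrict (paramSet N)))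
    (hf : ∀ j, IntervalIntegrable (fun t => f (j, t)) volume 0 (2 * π)) :
    IntegrableOn f (paramSet N) (paramMeasure N) := by
  rw [IntegrableOn]
  rw [restrict_paramSet] at hm ⊢
  rw [integrable_prod_iff hm]
  refine ⟨Eventually.of_forall fun j => ?_, Integrable.of_finite⟩
  have := (intervalIntegrable_iff_integrableOn_Icc_of_le (by positivity)).1 (hf j)
  exact this

lemma IsJordanParam.countable_fiber {g : ℝ → ℂ} (h : IsJordanParam g) (x : ℂ) :
    {t | x = g t}.Countable := by
  by_cases hx : ∃ s, g s = x
  · obtain ⟨s, rfl⟩ := hx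
    refine (Set.countable_range fun k : ℤ => s + k * (2 * π)).mono fun t ht => ?_
    obtain ⟨k, hk⟩ := h.eq_of_apply_eq (Eq.symm ht : g t = g s)
    exact ⟨k, hk.symm⟩
  · convert Set.countable_empty
    ext t
    simp only [Set.mem_ofPred_eq, Set.mem_empty_iff_false, iff_false]
    exact fun h => hx ⟨t, h.symm⟩

lemma IsJordanParam.isMild {g : Fin N → ℝ → ℂ} (h : ∀ j, IsJordanParam (g j)) :
    IsMild fun τ : Fin N × ℝ => g τ.1 τ.2 := by
  have hc := continuous_uncurry_fin fun j => (h j).continuous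
  refine ⟨hc, fun x => ?_, ?_⟩
  · refine ae_paramSet (isClosed_eq continuous_const hc).measurableSet.compl fun j => ?_
    exact ae_restrict_of_ae (((h j).countable_fiber x).ae_notMem _)
  · choose C hC using fun j => (h j).exists_integral_rpow_le
    refine ⟨∑ j, C j, fun x => ?_⟩
    have hi : IntegrableOn (fun τ : Fin N × ℝ => ‖x - g τ.1 τ.2‖ ^ (-(1 / 2) : ℝ))
        (paramSet N) (paramMeasure N) := by
      refine integrableOn_paramSet ?_ fun j => (hC j x).1
      have := hc.measurable
      apply Measurable.aestronglyMeasurable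
      fun_prop
    refine ⟨hi, ?_⟩
    rw [integral_paramSet hi]
    exact Finset.sum_le_sum fun j _ => (hC j x).2

end Params

/-- Profile of the Laplacian of the regularized logarithmic kernel. -/
def bump (z : ℂ) : ℝ := 2 / (1 + ‖z‖ ^ 2) ^ 2

lemma bump_nonneg (z : ℂ) : 0 ≤ bump z := by unfold bump; positivity

lemma continuous_bump : Continuous bump :=
  continuous_const.div (by fun_prop) fun z => by positivity

lemma integral_bump : Integrable bump ∧ ∫ z, bump z = 2 * π := by
  have hd : ∀ x ∈ Set.Ici (0:ℝ), HasDerivAt (fun x : ℝ => -(1 + x ^ 2)⁻¹)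
      (2 * x / (1 + x ^ 2) ^ 2) x := by
    intro x _
    have h := (((hasDerivAt_pow 2 x).const_add 1).inv (by positivity)).neg
    refine h.congr_deriv ?_
    simp; ring
  have hl : Tendsto (fun x : ℝ => -(1 + x ^ 2)⁻¹) atTop (𝓝 (-0)) :=
    (tendsto_inv_atTop_zero.comp
      (tendsto_atTop_add_const_left _ _ (tendsto_pow_atTop two_ne_zero))).neg
  have hp : ∀ x ∈ Set.Ioi (0:ℝ), 0 ≤ 2 * x / (1 + x ^ 2) ^ 2 := fun x hx => by
    have : 0 < x := hx
    positivity
  have hi := integrableOn_Ioi_deriv_of_nonneg' hd hp hl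
  have hv := integral_Ioi_of_hasDerivAt_of_nonneg' hd hp hl
  have e : ∀ x : ℝ, x ^ (Module.finrank ℝ ℂ - 1) • (2 / (1 + x ^ 2) ^ 2)
      = 2 * x / (1 + x ^ 2) ^ 2 := fun x => by
    rw [Complex.finrank_real_complex, smul_eq_mul]; ring
  constructor
  · refine (integrable_fun_norm_addHaar volume (E := ℂ) (f := fun x => 2 / (1 + x ^ 2) ^ 2)).2 ?_
    simpa only [e] using hi
  · have := integral_fun_norm_addHaar (volume : Measure ℂ) fun x : ℝ => 2 / (1 + x ^ 2) ^ 2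
    simp only [e, hv] at this
    simp only [bump, this]
    simp [Measure.real, Complex.volume_ball]

lemma integral_bump_halfPlane (ℓ : ℂ →L[ℝ] ℝ) (hℓ : ℓ ≠ 0) :
    ∫ z in {z | 0 < ℓ z}, bump z = π := by
  have hm : MeasurableSet {z | 0 < ℓ z} := measurableSet_lt measurable_const ℓ.measurable
  have hm' : MeasurableSet {z | ℓ z < 0} := measurableSet_lt ℓ.measurable measurable_const
  have hn : volume {z | ℓ z = 0} = 0 := by
    have := Measure.addHaar_submodule (volume : Measure ℂ) (LinearMap.ker (ℓ : ℂ →ₗ[ℝ] ℝ)) (by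
      rw [Ne, LinearMap.ker_eq_top]
      exact fun h => hℓ (ContinuousLinearMap.coe_injective h))
    exact this
  have h1 : ∫ z in {z | ℓ z < 0}, bump z = ∫ z in {z | 0 < ℓ z}, bump z := by
    rw [← integral_indicator hm, ← integral_indicator hm', ← integral_neg_eq_self]
    congr 1; ext z
    simp [Set.indicator, bump]
  have h2 : ∫ z in {z | 0 < ℓ z} ∪ {z | ℓ z < 0}, bump z = ∫ z, bump z := by
    rw [← setIntegral_univ (μ := volume) (f := bump)]
    refine setIntegral_congr_set ?_
    rw [ae_eq_univ]
    convert hn using 2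
    ext z
    simp only [Set.mem_compl_iff, Set.mem_union, Set.mem_ofPred_eq]
    constructor
    · intro h; push Not at h; linarith [h.1, h.2]
    · intro h; simp [h]
  rw [setIntegral_union _ hm' integral_bump.1.integrableOn integral_bump.1.integrableOn, h1,
    integral_bump.2] at h2
  · linarith
  · exact Set.disjoint_left.2 fun z (hz : 0 < ℓ z) (hz' : ℓ z < 0) => by linarith

lemma setIntegral_bump_scale {D : Set ℂ} (hD : MeasurableSet D) {ε : ℝ} (hε : 0 < ε) (p : ℂ)
    (f : ℂ → ℝ) : ∫ x in D, 2 * ε ^ 2 / (‖x - p‖ ^ 2 + ε ^ 2) ^ 2 * f x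
      = ∫ z, bump z * D.indicator f (p + ε * z) := by
  rw [← integral_indicator hD, ← integral_add_left_eq_self _ p]
  have := Measure.integral_comp_smul (volume : Measure ℂ) (fun x => D.indicator
    (fun x => 2 * ε ^ 2 / (‖x - p‖ ^ 2 + ε ^ 2) ^ 2 * f x) (p + x)) ε
  rw [Complex.finrank_real_complex, abs_of_pos (by positivity), smul_eq_mul, eq_inv_mul_iff_mul_eq₀
    (by positivity)] at this
  rw [← this, ← integral_const_mul]
  congr 1; ext z
  simp only [Complex.real_smul]
  by_cases h : p + ε * z ∈ D
  · rw [Set.indicator_of_mem h, Set.indicator_of_mem h]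
    simp only [bump, add_sub_cancel_left, norm_mul, Complex.norm_real, norm_of_nonneg hε.le]
    field_simp
    ring
  · simp [h]

lemma abs_setIntegral_bump_le {D : Set ℂ} (hD : MeasurableSet D) {ε : ℝ} (hε : 0 < ε) (p : ℂ)
    {f : ℂ → ℝ} {H : ℝ} (hH : 0 ≤ H) (hf : ∀ x ∈ D, |f x| ≤ H) :
    |∫ x in D, 2 * ε ^ 2 / (‖x - p‖ ^ 2 + ε ^ 2) ^ 2 * f x| ≤ 2 * π * H := by
  rw [setIntegral_bump_scale hD hε, ← integral_bump.2, ← integral_mul_const]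
  rw [← Real.norm_eq_abs]
  refine norm_integral_le_of_norm_le (integral_bump.1.mul_const H) (ae_of_all _ fun z => ?_)
  rw [norm_mul, norm_of_nonneg (bump_nonneg z)]
  refine mul_le_mul_of_nonneg_left ?_ (bump_nonneg z)
  by_cases h : p + ε * z ∈ D
  · rw [Set.indicator_of_mem h]; exact hf _ h
  · simpa [h] using hH

lemma tendsto_setIntegral_bump {D : Set ℂ} (hD : MeasurableSet D) (p : ℂ) {f : ℝ → ℂ → ℝ}
    (hfc : ∀ ε, 0 < ε → Continuous (f ε)) {H : ℝ} (hH : 0 ≤ H)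
    (hf : ∀ ε ∈ Set.Ioc (0:ℝ) 1, ∀ x ∈ D, |f ε x| ≤ H) {F : ℂ → ℝ}
    (hlim : ∀ᵐ z, Tendsto (fun ε : ℝ => D.indicator (f ε) (p + ε * z)) (𝓝[>] 0) (𝓝 (F z))) :
    Tendsto (fun ε => ∫ x in D, 2 * ε ^ 2 / (‖x - p‖ ^ 2 + ε ^ 2) ^ 2 * f ε x) (𝓝[>] 0)
      (𝓝 (∫ z, bump z * F z)) := by
  have hev : ∀ᶠ ε : ℝ in 𝓝[>] 0, ε ∈ Set.Ioc (0:ℝ) 1 := Ioc_mem_nhdsGT one_pos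
  have h : Tendsto (fun ε : ℝ => ∫ z, bump z * D.indicator (f ε) (p + ε * z)) (𝓝[>] 0)
      (𝓝 (∫ z, bump z * F z)) := by
    refine tendsto_integral_filter_of_dominated_convergence (fun z => bump z * H) ?_ ?_
      (integral_bump.1.mul_const H) ?_
    · filter_upwards [hev] with ε hε
      have h1 : Measurable (D.indicator (f ε)) := (hfc ε hε.1).measurable.indicator hD
      exact (continuous_bump.measurable.mul (h1.comp (by fun_prop))).aestronglyMeasurable
    · filter_upwards [hev] with ε hε
      refine ae_of_all _ fun z => ?_
      rw [norm_mul, norm_of_nonneg (bump_nonneg z)]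
      refine mul_le_mul_of_nonneg_left ?_ (bump_nonneg z)
      by_cases h : p + ε * z ∈ D
      · rw [Set.indicator_of_mem h]; exact hf _ hε _ h
      · simpa [h] using hH
    · filter_upwards [hlim] with z hz
      exact hz.const_mul _
  refine h.congr' ?_
  filter_upwards [hev] with ε hε
  exact (setIntegral_bump_scale hD hε.1 p (f ε)).symm

lemma tendsto_add_real_mul (p z : ℂ) : Tendsto (fun ε : ℝ => p + ε * z) (𝓝[>] 0) (𝓝 p) := by
  have : Tendsto (fun ε : ℝ => p + ε * z) (𝓝 0) (𝓝 (p + ((0:ℝ):ℂ) * z)) :=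
    Continuous.tendsto (by fun_prop) 0
  simp only [Complex.ofReal_zero, zero_mul, add_zero] at this
  exact this.mono_left nhdsWithin_le_nhds

lemma tendsto_setIntegral_bump_of_notMem_closure {D : Set ℂ} (hD : MeasurableSet D) {p : ℂ}
    (hp : p ∉ closure D) {f : ℝ → ℂ → ℝ}
    (hfc : ∀ ε, 0 < ε → Continuous (f ε)) {H : ℝ} (hH : 0 ≤ H)
    (hf : ∀ ε ∈ Set.Ioc (0:ℝ) 1, ∀ x ∈ D, |f ε x| ≤ H) :
    Tendsto (fun ε => ∫ x in D, 2 * ε ^ 2 / (‖x - p‖ ^ 2 + ε ^ 2) ^ 2 * f ε x) (𝓝[>] 0)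
      (𝓝 0) := by
  have := tendsto_setIntegral_bump hD p hfc hH hf (F := 0) (ae_of_all _ fun z => by
    refine tendsto_const_nhds.congr' ?_
    filter_upwards [(tendsto_add_real_mul p z).eventually
      (isClosed_closure.isOpen_compl.mem_nhds hp)] with ε hε
    exact (Set.indicator_of_notMem (fun h => hε (subset_closure h)) _).symm)
  simpa using this

lemma eventually_mem_side {g : ℝ → ℂ} {r : ℝ} {s : ℝ} {z : ℂ} (hw : deriv g s ≠ 0)
    (h : 0 < r * (z / deriv g s).im) : ∀ᶠ ε : ℝ in 𝓝[>] 0, g s + ε * z ∈ side g r := by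
  have hpos : ∀ᶠ ε : ℝ in 𝓝[>] 0, 0 < ε := self_mem_nhdsWithin
  have ht : Tendsto (fun ε : ℝ => ε * ‖z / deriv g s‖ ^ 2) (𝓝[>] 0) (𝓝 (0 * ‖z / deriv g s‖ ^ 2)) :=
    (tendsto_id.mono_left nhdsWithin_le_nhds).mul_const _
  rw [zero_mul] at ht
  filter_upwards [hpos, ht.eventually (gt_mem_nhds (by linarith :
    0 < 2 * (r * (z / deriv g s).im)))] with ε hε hlt
  refine ⟨s, ε * (z / deriv g s), ?_, ?_⟩
  · rw [mem_ball_mul_I_iff, norm_mul, Complex.norm_real, norm_of_nonneg hε.le,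
      Complex.im_ofReal_mul]
    nlinarith
  · field_simp

lemma IsJordanDomain.tendsto_setIntegral_bump {g : ℝ → ℂ} {D : Set ℂ} (h : IsJordanDomain g D)
    (s : ℝ) {f : ℝ → ℂ → ℝ} (hfc : ∀ ε, 0 < ε → Continuous (f ε)) {H : ℝ} (hH : 0 ≤ H)
    (hf : ∀ ε ∈ Set.Ioc (0:ℝ) 1, ∀ x ∈ D, |f ε x| ≤ H) {c : ℝ}
    (hlim : Tendsto (fun q : ℝ × ℂ => f q.1 q.2) (𝓝 0 ×ˢ 𝓝 (g s)) (𝓝 c)) :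
    Tendsto (fun ε => ∫ x in D, 2 * ε ^ 2 / (‖x - g s‖ ^ 2 + ε ^ 2) ^ 2 * f ε x) (𝓝[>] 0)
      (𝓝 (π * c)) := by
  obtain ⟨r, hr, hs1, hs2, -⟩ := h.exists_side_subset h.isOpen h.isBounded h.frontier_eq
  have hw := h.regular s
  let ℓ : ℂ →L[ℝ] ℝ := r • (Complex.imCLM.comp
    ((ContinuousLinearMap.mul ℝ ℂ).flip (deriv g s)⁻¹))
  have hl : ∀ z, ℓ z = r * (z / deriv g s).im := fun z => by
    simp [ℓ, div_eq_mul_inv, -Complex.inv_re, -Complex.inv_im]; ring_nf; simp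
  have hl0 : ℓ ≠ 0 := fun h0 => hr (by
    have := hl (Complex.I * deriv g s)
    rw [h0, mul_div_cancel_right₀ _ hw] at this
    simpa using this.symm)
  have hm : MeasurableSet {z | 0 < ℓ z} := measurableSet_lt measurable_const ℓ.measurable
  have hn : volume {z | ℓ z = 0} = 0 :=
    Measure.addHaar_submodule (volume : Measure ℂ) (LinearMap.ker (ℓ : ℂ →ₗ[ℝ] ℝ)) (by
      rw [Ne, LinearMap.ker_eq_top]
      exact fun h => hl0 (ContinuousLinearMap.coe_injective h))
  have key := _root_.tendsto_setIntegral_bump h.isOpen.measurableSet (g s) hfc hH hf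
    (F := {z | 0 < ℓ z}.indicator fun _ => c) (by
      have : ∀ᵐ z, ℓ z ≠ 0 := by rw [ae_iff]; simpa using hn
      filter_upwards [this] with z hz
      rcases lt_or_gt_of_ne hz with hz | hz
      · rw [Set.indicator_of_notMem (by simpa using hz.le)]
        refine tendsto_const_nhds.congr' ?_
        have : 0 < -r * (z / deriv g s).im := by rw [hl] at hz; linarith
        filter_upwards [eventually_mem_side hw this] with ε hε
        exact (Set.indicator_of_notMem (fun h => hs2 hε (subset_closure h)) _).symm
      · rw [Set.indicator_of_mem (by simpa using hz)]
        have h1 : Tendsto (fun ε : ℝ => (ε, g s + ε * z)) (𝓝[>] 0) (𝓝 0 ×ˢ 𝓝 (g s)) :=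
          (tendsto_id.mono_left nhdsWithin_le_nhds).prodMk (tendsto_add_real_mul _ _)
        have h2 := hlim.comp h1
        refine h2.congr' ?_
        filter_upwards [eventually_mem_side hw (hl z ▸ hz)] with ε hε
        exact (Set.indicator_of_mem (hs1 hε) _).symm)
  convert key using 2
  have e : ∀ z, bump z * {z | 0 < ℓ z}.indicator (fun _ => c) z
      = {z | 0 < ℓ z}.indicator (fun z => bump z * c) z := fun z => by
    simp only [Set.indicator]; split_ifs <;> simp
  simp only [e]
  rw [integral_indicator hm, integral_mul_const, integral_bump_halfPlane ℓ hl0]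

/-- Finitely many Jordan domains with pairwise disjoint closures. -/
structure IsJordanFamily {N : ℕ} (g : Fin N → ℝ → ℂ) (D : Fin N → Set ℂ) : Prop where
  domain : ∀ j, IsJordanDomain (g j) (D j)
  disjoint : Pairwise fun i j => Disjoint (closure (D i)) (closure (D j))

lemma continuousOn_potLap_integrand {N : ℕ} {p : Fin N × ℝ → ℂ} {σ : Fin N × ℝ → ℝ}
    (hp : Continuous p) (hσ : Continuous σ) {ε : ℝ} (hε : ε ≠ 0) {f : ℂ → ℝ} (hf : Continuous f) :
    Continuous fun q : ℂ × (Fin N × ℝ) =>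
      σ q.2 * (2 * ε ^ 2 / (‖q.1 - p q.2‖ ^ 2 + ε ^ 2) ^ 2 * f q.1) := by
  have h1 : Continuous fun q : ℂ × (Fin N × ℝ) => 2 * ε ^ 2 / (‖q.1 - p q.2‖ ^ 2 + ε ^ 2) ^ 2 :=
    continuous_const.div (by fun_prop) fun q => by positivity
  fun_prop

lemma integral_potLap_mul {N : ℕ} {p : Fin N × ℝ → ℂ} {σ : Fin N × ℝ → ℝ}
    (hp : Continuous p) (hσ : Continuous σ) {ε : ℝ} (hε : ε ≠ 0) {f : ℂ → ℝ} (hf : Continuous f)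
    {D : Set ℂ} (hb : Bornology.IsBounded D) :
    (Integrable (fun τ => σ τ * ∫ x in D, 2 * ε ^ 2 / (‖x - p τ‖ ^ 2 + ε ^ 2) ^ 2 * f x)
      ((paramMeasure N).restrict (paramSet N))) ∧
    ∫ x in D, potLap p σ ε x * f x = ∫ τ in paramSet N,
      σ τ * (∫ x in D, 2 * ε ^ 2 / (‖x - p τ‖ ^ 2 + ε ^ 2) ^ 2 * f x) ∂paramMeasure N := by
  have hi : Integrable (Function.uncurry fun (x : ℂ) (τ : Fin N × ℝ) =>
      σ τ * (2 * ε ^ 2 / (‖x - p τ‖ ^ 2 + ε ^ 2) ^ 2 * f x))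
      ((volume.restrict D).prod ((paramMeasure N).restrict (paramSet N))) := by
    rw [Measure.prod_restrict]
    exact ((continuousOn_potLap_integrand hp hσ hε hf).continuousOn.integrableOn_compact
      (hb.isCompact_closure.prod (isCompact_paramSet N))).mono_set
      (Set.prod_mono subset_closure subset_rfl)
  have e := integral_integral_swap hi
  have hr := hi.integral_prod_right
  simp only [integral_const_mul, Function.uncurry_apply_pair] at e hr
  refine ⟨hr, ?_⟩
  rw [← e]
  congr 1; ext x
  rw [potLap, ← integral_mul_const]
  congr 1; ext τ; ring

namespace IsJordanFamily
variable {N : ℕ} {g : Fin N → ℝ → ℂ} {D : Fin N → Set ℂ}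

lemma isMild (h : IsJordanFamily g D) : IsMild fun τ : Fin N × ℝ => g τ.1 τ.2 :=
  IsJordanParam.isMild fun j => (h.domain j).toIsJordanParam

lemma mem_closure (h : IsJordanFamily g D) (j : Fin N) (t : ℝ) : g j t ∈ closure (D j) := by
  rw [(h.domain j).closure_eq]; exact Or.inr ⟨t, rfl⟩

lemma notMem_closure (h : IsJordanFamily g D) {i j : Fin N} (hij : j ≠ i) (t : ℝ) :
    g j t ∉ closure (D i) :=
  Set.disjoint_left.1 (h.disjoint hij) (h.mem_closure j t)

/-- The Laplacian of the regularized potential of a charge on the curves converges, when tested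
over `D i` against functions converging on `range (g i)`, to `π` times the charge: each curve
element sees half of its mass inside. -/
lemma tendsto_integral_potLap_mul (h : IsJordanFamily g D) {σ : Fin N × ℝ → ℝ} (hσ : Continuous σ)
    (i : Fin N) {f : ℝ → ℂ → ℝ} (hfc : ∀ ε, 0 < ε → Continuous (f ε)) {H : ℝ} (hH : 0 ≤ H)
    (hf : ∀ ε ∈ Set.Ioc (0:ℝ) 1, ∀ x ∈ D i, |f ε x| ≤ H) {f₀ : ℂ → ℝ} (hf₀ : Continuous f₀)
    (hlim : ∀ y, Tendsto (fun q : ℝ × ℂ => f q.1 q.2) (𝓝 0 ×ˢ 𝓝 y) (𝓝 (f₀ y))) :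
    Tendsto (fun ε => ∫ x in D i, potLap (fun τ => g τ.1 τ.2) σ ε x * f ε x) (𝓝[>] 0)
      (𝓝 (π * ∫ t in (0:ℝ)..(2 * π), σ (i, t) * f₀ (g i t))) := by
  set p : Fin N × ℝ → ℂ := fun τ => g τ.1 τ.2 with hpdef
  have hp : Continuous p := h.isMild.continuous
  have hD := (h.domain i).isOpen.measurableSet
  obtain ⟨M, hM0, hM⟩ := IsMild.exists_bound (N := N) hσ
  let L : Fin N × ℝ → ℝ := fun τ => if τ.1 = i then σ τ * (π * f₀ (p τ)) else 0
  have hL : Continuous L := continuous_prod_of_discrete_left.2 fun j => by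
    by_cases hj : j = i
    · simp only [L, hj, if_true]; fun_prop
    · simp only [L, hj, if_false]; fun_prop
  have hev : ∀ᶠ ε : ℝ in 𝓝[>] 0, ε ∈ Set.Ioc (0:ℝ) 1 := Ioc_mem_nhdsGT one_pos
  have key : Tendsto (fun ε => ∫ τ in paramSet N,
      σ τ * (∫ x in D i, 2 * ε ^ 2 / (‖x - p τ‖ ^ 2 + ε ^ 2) ^ 2 * f ε x) ∂paramMeasure N) (𝓝[>] 0)
      (𝓝 (∫ τ in paramSet N, L τ ∂paramMeasure N)) := by
    refine tendsto_integral_filter_of_dominated_convergence (fun _ => M * (2 * π * H)) ?_ ?_ ?_ ?_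
    · filter_upwards [hev] with ε hε
      exact (integral_potLap_mul hp hσ hε.1.ne' (hfc ε hε.1)
        (h.domain i).isBounded).1.aestronglyMeasurable
    · filter_upwards [hev] with ε hε
      filter_upwards [ae_restrict_mem (isCompact_paramSet N).measurableSet] with τ hτ
      rw [norm_mul]
      exact mul_le_mul (hM τ hτ) (abs_setIntegral_bump_le hD hε.1 _ hH (hf ε hε)) (norm_nonneg _) hM0
    · exact continuous_const.continuousOn.integrableOn_compact (isCompact_paramSet N)
    · refine ae_of_all _ fun ⟨j, t⟩ => ?_
      by_cases hj : j = i
      · subst hj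
        simp only [L, if_true]
        exact ((h.domain j).tendsto_setIntegral_bump t hfc hH hf (hlim _)).const_mul _
      · simp only [L, hj, if_false]
        have h0 := (tendsto_setIntegral_bump_of_notMem_closure hD (h.notMem_closure hj t) hfc hH
          hf).const_mul (σ (j, t))
        rwa [mul_zero] at h0
  have hLi : ∫ τ in paramSet N, L τ ∂paramMeasure N
      = π * ∫ t in (0:ℝ)..(2 * π), σ (i, t) * f₀ (g i t) := by
    rw [integral_paramSet (hL.continuousOn.integrableOn_compact (isCompact_paramSet N)),
      Finset.sum_eq_single i]
    · rw [← intervalIntegral.integral_const_mul]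
      congr 1; ext t
      simp only [L, p, if_true]; ring
    · intro j _ hj; simp [L, hj]
    · simp
  rw [← hLi]
  refine key.congr' ?_
  filter_upwards [hev] with ε hε
  exact (integral_potLap_mul hp hσ hε.1.ne' (hfc ε hε.1) (h.domain i).isBounded).2.symm

end IsJordanFamily

lemma Metric.exists_pos_le_dist {s t : Set ℂ} (hs : IsCompact s) (ht : IsClosed t)
    (hst : Disjoint s t) : ∃ δ > 0, ∀ x ∈ s, ∀ y ∈ t, δ ≤ ‖x - y‖ := by
  obtain ⟨r, hr, h⟩ := Metric.exists_pos_forall_lt_edist hs ht hst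
  refine ⟨r, by exact_mod_cast hr, fun x hx y hy => ?_⟩
  have := (h x hx y hy).le
  rw [edist_dist, ← ENNReal.ofReal_coe_nnreal,
    ENNReal.ofReal_le_ofReal_iff dist_nonneg, dist_eq_norm] at this
  exact this

/-- The flux through the vector `w` at `x` of the gradient of the regularized potential. -/
def flux {N : ℕ} (p : Fin N × ℝ → ℂ) (σ : Fin N × ℝ → ℝ) (ε : ℝ) (x w : ℂ) : ℝ :=
  ∫ τ in paramSet N, σ τ * ((‖x - p τ‖ ^ 2 + ε ^ 2)⁻¹ * cross (x - p τ) w) ∂paramMeasure N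

/-- `cross` with a fixed second argument. -/
def crossCLM (w : ℂ) : ℂ →L[ℝ] ℝ := w.im • Complex.reCLM - w.re • Complex.imCLM

lemma crossCLM_apply (w v : ℂ) : crossCLM w v = cross v w := by
  simp [crossCLM, cross]; ring

lemma cross_potGrad {N : ℕ} {p : Fin N × ℝ → ℂ} {σ : Fin N × ℝ → ℝ} (hp : Continuous p)
    (hσ : Continuous σ) {ε : ℝ} (hε : ε ≠ 0) (x w : ℂ) :
    cross (potGrad p σ ε x) w = flux p σ ε x w := by
  have h1 : Continuous fun τ => (‖x - p τ‖ ^ 2 + ε ^ 2)⁻¹ :=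
    Continuous.inv₀ (by fun_prop) fun τ => (norm_sq_add_sq_pos hε _).ne'
  have hc : Continuous fun τ => (σ τ * (‖x - p τ‖ ^ 2 + ε ^ 2)⁻¹) • (x - p τ) := by fun_prop
  rw [← crossCLM_apply, potGrad, ← ContinuousLinearMap.integral_comp_comm _
    (hc.continuousOn.integrableOn_compact (isCompact_paramSet N)), flux]
  congr 1; ext τ
  rw [map_smul, crossCLM_apply, smul_eq_mul, mul_assoc]

namespace IsJordanFamily
variable {N : ℕ} {g : Fin N → ℝ → ℂ} {D : Fin N → Set ℂ}

lemma exists_abs_cross_le (h : IsJordanFamily g D) (i : Fin N) : ∃ C, 0 ≤ C ∧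
    ∀ s (τ : Fin N × ℝ), |cross (g i s - g τ.1 τ.2) (deriv (g i) s)| ≤ C * ‖g i s - g τ.1 τ.2‖ ^ 2 := by
  obtain ⟨B, hB0, hB⟩ := (h.domain i).exists_norm_deriv_le
  have key : ∀ j, ∃ C, 0 ≤ C ∧ ∀ s t,
      |cross (g i s - g j t) (deriv (g i) s)| ≤ C * ‖g i s - g j t‖ ^ 2 := by
    intro j
    by_cases hj : j = i
    · subst hj
      obtain ⟨C, hC, h⟩ := (h.domain j).exists_abs_cross_le
      exact ⟨C, hC.le, h⟩
    · obtain ⟨δ, hδ, hd⟩ := Metric.exists_pos_le_dist (h.domain i).isBounded.isCompact_closure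
        isClosed_closure (h.disjoint (Ne.symm hj))
      refine ⟨B / δ, by positivity, fun s t => (abs_cross_le _ _).trans ?_⟩
      have h1 := hd _ (h.mem_closure i s) _ (h.mem_closure j t)
      rw [div_mul_eq_mul_div, le_div_iff₀ hδ]
      calc ‖g i s - g j t‖ * ‖deriv (g i) s‖ * δ
          ≤ ‖g i s - g j t‖ * B * ‖g i s - g j t‖ := by gcongr; exact hB s
        _ = _ := by ring
  choose C hC0 hC using key
  refine ⟨∑ j, C j, Finset.sum_nonneg fun j _ => hC0 j, fun s τ => (hC τ.1 s τ.2).trans ?_⟩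
  gcongr
  exact Finset.single_le_sum (fun j _ => hC0 j) (Finset.mem_univ _)

lemma exists_abs_flux (h : IsJordanFamily g D) {σ : Fin N × ℝ → ℝ} (hσ : Continuous σ)
    (i : Fin N) : ∃ C, 0 ≤ C ∧ ∀ s,
      (∀ ε, |flux (fun τ => g τ.1 τ.2) σ ε (g i s) (deriv (g i) s)| ≤ C) ∧
      IntegrableOn (fun τ => σ τ * ((‖g i s - g τ.1 τ.2‖ ^ 2)⁻¹ *
        cross (g i s - g τ.1 τ.2) (deriv (g i) s))) (paramSet N) (paramMeasure N) ∧
      Tendsto (fun ε => flux (fun τ => g τ.1 τ.2) σ ε (g i s) (deriv (g i) s)) (𝓝[>] 0)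
        (𝓝 (flux (fun τ => g τ.1 τ.2) σ 0 (g i s) (deriv (g i) s))) := by
  obtain ⟨C, hC0, hC⟩ := h.exists_abs_cross_le i
  obtain ⟨M, hM0, hM⟩ := IsMild.exists_bound (N := N) hσ
  have hp := h.isMild.continuous
  have hmeas : ∀ s ε, AEStronglyMeasurable (fun τ : Fin N × ℝ =>
      σ τ * ((‖g i s - g τ.1 τ.2‖ ^ 2 + ε ^ 2)⁻¹ * cross (g i s - g τ.1 τ.2) (deriv (g i) s)))
      ((paramMeasure N).restrict (paramSet N)) := by
    intro s ε
    have h1 : Measurable fun τ : Fin N × ℝ => (‖g i s - g τ.1 τ.2‖ ^ 2 + ε ^ 2)⁻¹ :=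
      Measurable.inv (by fun_prop : Continuous _).measurable
    have h2 : Continuous fun τ : Fin N × ℝ => cross (g i s - g τ.1 τ.2) (deriv (g i) s) := by
      unfold cross; fun_prop
    exact (hσ.measurable.mul (h1.mul h2.measurable)).aestronglyMeasurable
  have hbd : ∀ s ε, ∀ᵐ τ ∂(paramMeasure N).restrict (paramSet N),
      ‖σ τ * ((‖g i s - g τ.1 τ.2‖ ^ 2 + ε ^ 2)⁻¹ * cross (g i s - g τ.1 τ.2) (deriv (g i) s))‖
        ≤ M * C := by
    intro s ε
    filter_upwards [ae_restrict_mem (isCompact_paramSet N).measurableSet] with τ hτ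
    rw [norm_mul, norm_mul, norm_inv]
    refine mul_le_mul (hM τ hτ) ?_ (by positivity) hM0
    have := hC s τ
    rw [norm_of_nonneg (by positivity : (0:ℝ) ≤ ‖g i s - g τ.1 τ.2‖ ^ 2 + ε ^ 2), Real.norm_eq_abs]
    refine inv_mul_le_of_le_mul₀ (by positivity) hC0 (this.trans ?_)
    rw [mul_comm]
    gcongr
    nlinarith [sq_nonneg ε]
  have hci : IntegrableOn (fun _ => M * C) (paramSet N) (paramMeasure N) :=
    continuous_const.continuousOn.integrableOn_compact (isCompact_paramSet N)
  refine ⟨∫ τ in paramSet N, M * C ∂paramMeasure N, integral_nonneg fun _ => mul_nonneg hM0 hC0,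
    fun s => ⟨fun ε => norm_integral_le_of_norm_le hci (hbd s ε), ?_, ?_⟩⟩
  · have h1 := hmeas s 0
    have h2 := hbd s 0
    simp only [zero_pow two_ne_zero, add_zero] at h1 h2
    exact hci.mono' h1 h2
  · refine tendsto_integral_filter_of_dominated_convergence (fun _ => M * C)
      (Eventually.of_forall (hmeas s)) (Eventually.of_forall (hbd s)) hci (ae_of_all _ fun τ => ?_)
    by_cases hx : g i s = g τ.1 τ.2
    · simp [hx, cross]
    · have hn : ‖g i s - g τ.1 τ.2‖ ^ 2 + 0 ^ 2 ≠ 0 := by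
        simpa [sub_eq_zero] using hx
      have h1 : Tendsto (fun ε : ℝ => ‖g i s - g τ.1 τ.2‖ ^ 2 + ε ^ 2) (𝓝 0)
          (𝓝 (‖g i s - g τ.1 τ.2‖ ^ 2 + 0 ^ 2)) := Continuous.tendsto (by fun_prop) 0
      exact (((h1.inv₀ hn).mul_const _).const_mul _).mono_left nhdsWithin_le_nhds

/-- Passing to the limit in the boundary terms of Green's identities. -/
lemma tendsto_integral_mul_flux (h : IsJordanFamily g D) {σ : Fin N × ℝ → ℝ} (hσ : Continuous σ)
    (i : Fin N) {f : ℝ → ℂ → ℝ} (hfc : ∀ ε, 0 < ε → Continuous (f ε)) {H : ℝ} (hH : 0 ≤ H)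
    (hf : ∀ ε ∈ Set.Ioc (0:ℝ) 1, ∀ s, |f ε (g i s)| ≤ H) {f₀ : ℂ → ℝ}
    (hlim : ∀ y, Tendsto (fun q : ℝ × ℂ => f q.1 q.2) (𝓝 0 ×ˢ 𝓝 y) (𝓝 (f₀ y))) :
    Tendsto (fun ε => ∫ s in (0:ℝ)..(2 * π),
        f ε (g i s) * cross (potGrad (fun τ => g τ.1 τ.2) σ ε (g i s)) (deriv (g i) s)) (𝓝[>] 0)
      (𝓝 (∫ s in (0:ℝ)..(2 * π),
        f₀ (g i s) * flux (fun τ => g τ.1 τ.2) σ 0 (g i s) (deriv (g i) s))) := by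
  obtain ⟨C, hC0, hC⟩ := h.exists_abs_flux hσ i
  have hp := h.isMild.continuous
  have hg := (h.domain i).continuous
  have hg' := (h.domain i).continuous_deriv
  have hev : ∀ᶠ ε : ℝ in 𝓝[>] 0, ε ∈ Set.Ioc (0:ℝ) 1 := Ioc_mem_nhdsGT one_pos
  refine intervalIntegral.tendsto_integral_filter_of_dominated_convergence (fun _ => H * C) ?_ ?_
    intervalIntegrable_const ?_
  · filter_upwards [hev] with ε hε
    have h1 := (contDiff_potGrad hp hσ hε.1.ne').continuous
    have h2 := hfc ε hε.1
    refine Continuous.aestronglyMeasurable ?_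
    unfold cross
    fun_prop
  · filter_upwards [hev] with ε hε
    refine ae_of_all _ fun s _ => ?_
    rw [norm_mul, cross_potGrad hp hσ hε.1.ne']
    exact mul_le_mul (hf ε hε s) ((hC s).1 ε) (norm_nonneg _) hH
  · refine ae_of_all _ fun s _ => ?_
    have h1 : Tendsto (fun ε : ℝ => (ε, g i s)) (𝓝[>] 0) (𝓝 0 ×ˢ 𝓝 (g i s)) :=
      (tendsto_id.mono_left nhdsWithin_le_nhds).prodMk tendsto_const_nhds
    refine (((hlim (g i s)).comp h1).mul (hC s).2.2).congr' ?_
    filter_upwards [hev] with ε hε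
    rw [cross_potGrad hp hσ hε.1.ne']; rfl

end IsJordanFamily

section
variable {N : ℕ} {p : Fin N × ℝ → ℂ} {σ : Fin N × ℝ → ℝ}

lemma hasFDerivAt_pot_of_ne_zero (hp : Continuous p) (hσ : Continuous σ) {ε : ℝ} (hε : ε ≠ 0)
    (x : ℂ) : HasFDerivAt (pot p σ ε) (dotCLM (potGrad p σ ε x)) x :=
  hasFDerivAt_pot hp hσ isOpen_univ (fun x _ τ _ => (norm_sq_add_sq_pos hε (x - p τ)).ne')
    (Set.mem_univ x)

lemma contDiff_pot (hp : Continuous p) (hσ : Continuous σ) {ε : ℝ} (hε : ε ≠ 0) :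
    ContDiff ℝ 1 (pot p σ ε) :=
  contDiff_one_iff_hasFDerivAt.2 ⟨_, dotCLM.continuous.comp (contDiff_potGrad hp hσ hε).continuous,
    hasFDerivAt_pot_of_ne_zero hp hσ hε⟩

lemma div_pot_smul_potGrad (hp : Continuous p) (hσ : Continuous σ) {ε : ℝ} (hε : ε ≠ 0) (x : ℂ) :
    (fderiv ℝ (fun x => pot p σ ε x • potGrad p σ ε x) x 1).re
      + (fderiv ℝ (fun x => pot p σ ε x • potGrad p σ ε x) x Complex.I).im
      = ‖potGrad p σ ε x‖ ^ 2 + potLap p σ ε x * pot p σ ε x := by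
  have h1 := hasFDerivAt_pot_of_ne_zero hp hσ hε x
  have h2 : HasFDerivAt (potGrad p σ ε) (fderiv ℝ (potGrad p σ ε) x) x :=
    ((contDiff_potGrad hp hσ hε).differentiable (by norm_num)).differentiableAt.hasFDerivAt
  have h3 := h1.smul h2
  rw [← div_potGrad hp hσ hε, ← dotCLM_self, (show HasFDerivAt
    (fun x => pot p σ ε x • potGrad p σ ε x) _ x from h3).fderiv]
  simp
  ring

end

namespace IsJordanFamily
variable {N : ℕ} {g : Fin N → ℝ → ℂ} {D : Fin N → Set ℂ} {σ : Fin N × ℝ → ℝ}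

lemma integral_charge_eq_zero (h : IsJordanFamily g D) (hσ : Continuous σ) {i : Fin N}
    {c : ℝ} (hc : c = ∫ t in (0:ℝ)..(2 * π), σ (i, t))
    (heq : ∀ s, flux (fun τ => g τ.1 τ.2) σ 0 (g i s) (deriv (g i) s)
      = 2 * π * (1 / 2 * σ (i, s) + c * ‖deriv (g i) s‖)) : c = 0 := by
  have hp := h.isMild.continuous
  have hg' := (h.domain i).continuous_deriv
  have hb : ∀ y : ℂ, Tendsto (fun _ : ℝ × ℂ => (1:ℝ)) (𝓝 0 ×ˢ 𝓝 y) (𝓝 1) :=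
    fun _ => tendsto_const_nhds
  have h1 := h.tendsto_integral_potLap_mul hσ i (f := fun _ _ => 1) (fun _ _ => continuous_const)
    zero_le_one (by simp) (f₀ := fun _ => 1) continuous_const hb
  have h2 := h.tendsto_integral_mul_flux hσ i (f := fun _ _ => 1) (fun _ _ => continuous_const)
    zero_le_one (by simp) (f₀ := fun _ => 1) hb
  have h3 := tendsto_nhds_unique (h1.congr' (by
    filter_upwards [self_mem_nhdsWithin] with ε hε
    have hε' : ε ≠ 0 := (ne_of_gt hε)
    have := (h.domain i).integral_div (contDiff_potGrad hp hσ hε')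
    simp only [div_potGrad hp hσ hε'] at this
    simp only [mul_one, one_mul, this])) h2
  simp only [mul_one, one_mul, heq, ← hc] at h3
  have hn : Continuous fun s => ‖deriv (g i) s‖ := hg'.norm
  have hs : Continuous fun s => σ (i, s) := by fun_prop
  rw [intervalIntegral.integral_const_mul, intervalIntegral.integral_add
    ((hs.const_mul _).intervalIntegrable _ _) ((hn.const_mul _).intervalIntegrable _ _),
    intervalIntegral.integral_const_mul, intervalIntegral.integral_const_mul, ← hc] at h3
  have hL : 0 < ∫ s in (0:ℝ)..(2 * π), ‖deriv (g i) s‖ :=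
    intervalIntegral.intervalIntegral_pos_of_pos (hn.intervalIntegrable _ _)
      (fun s => norm_pos_iff.2 ((h.domain i).regular s)) (by positivity)
  have h4 : 2 * π * (c * ∫ s in (0:ℝ)..(2 * π), ‖deriv (g i) s‖) = 0 := by linarith
  simpa [hL.ne', Real.pi_ne_zero] using h4

lemma tendsto_integral_norm_potGrad_sq (h : IsJordanFamily g D) (hσ : Continuous σ) {i : Fin N}
    (heq : ∀ s, flux (fun τ => g τ.1 τ.2) σ 0 (g i s) (deriv (g i) s) = π * σ (i, s)) :
    Tendsto (fun ε => ∫ x in D i, ‖potGrad (fun τ => g τ.1 τ.2) σ ε x‖ ^ 2) (𝓝[>] 0) (𝓝 0) := by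
  have hp := h.isMild.continuous
  obtain ⟨C, hC0, hC⟩ := h.isMild.exists_abs_pot_sub_le hσ
  have hpc := h.isMild.continuous_pot_zero hσ
  obtain ⟨M, hM⟩ := (h.domain i).isBounded.isCompact_closure.exists_bound_of_continuousOn
    hpc.continuousOn
  have hb : ∀ ε ∈ Set.Ioc (0:ℝ) 1, ∀ x ∈ closure (D i),
      |pot (fun τ => g τ.1 τ.2) σ ε x| ≤ max (M + C) 0 := by
    intro ε hε x hx
    refine le_max_of_le_left ?_
    have h1 := hC ε x x
    rw [sub_self, norm_zero, zero_add, abs_of_pos hε.1] at h1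
    have h2 : C * √ε ≤ C * 1 := by gcongr; exact Real.sqrt_le_one.2 hε.2
    have h3 := hM x hx
    rw [Real.norm_eq_abs] at h3
    have := abs_sub_abs_le_abs_sub (pot (fun τ => g τ.1 τ.2) σ ε x) (pot (fun τ => g τ.1 τ.2) σ 0 x)
    linarith
  have hpε : ∀ ε : ℝ, 0 < ε → Continuous (pot (fun τ => g τ.1 τ.2) σ ε) :=
    fun ε hε => (contDiff_pot hp hσ hε.ne').continuous
  have h1 := h.tendsto_integral_potLap_mul hσ i hpε (le_max_right _ _)
    (fun ε hε x hx => hb ε hε x (subset_closure hx)) hpc (h.isMild.tendsto_pot hσ)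
  have h2 := h.tendsto_integral_mul_flux hσ i hpε (le_max_right _ _)
    (fun ε hε s => hb ε hε _ (h.mem_closure i s)) (h.isMild.tendsto_pot hσ)
  have h3 := h2.sub h1
  have e : (∫ s in (0:ℝ)..(2 * π), pot (fun τ => g τ.1 τ.2) σ 0 (g i s) *
        flux (fun τ => g τ.1 τ.2) σ 0 (g i s) (deriv (g i) s))
      - π * ∫ t in (0:ℝ)..(2 * π), σ (i, t) * pot (fun τ => g τ.1 τ.2) σ 0 (g i t) = 0 := by
    rw [← intervalIntegral.integral_const_mul, sub_eq_zero]
    congr 1; ext s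
    rw [heq]; ring
  rw [e] at h3
  refine h3.congr' ?_
  filter_upwards [self_mem_nhdsWithin] with ε hε
  have hε' : ε ≠ 0 := ne_of_gt hε
  have hG := contDiff_potGrad hp hσ hε'
  have hP := contDiff_pot hp hσ hε'
  have key := (h.domain i).integral_div (V := fun x => pot (fun τ => g τ.1 τ.2) σ ε x •
    potGrad (fun τ => g τ.1 τ.2) σ ε x) (hP.smul hG)
  have hI : ∀ f : ℂ → ℝ, Continuous f → IntegrableOn f (D i) :=
    fun f hf => (hf.continuousOn.integrableOn_compact
      (h.domain i).isBounded.isCompact_closure).mono_set subset_closure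
  have hL : Continuous (potLap (fun τ => g τ.1 τ.2) σ ε) := by
    have hd := hG.continuous_fderiv (by norm_num)
    simp only [← funext (div_potGrad hp hσ hε')]
    fun_prop
  have hGc := hG.continuous
  have hPc := hP.continuous
  simp only [div_pot_smul_potGrad hp hσ hε'] at key
  rw [integral_add (hI _ (by fun_prop)) (hI _ (by fun_prop))] at key
  rw [sub_eq_iff_eq_add, key]
  congr 1; ext s
  simp [cross]; ring

lemma notMem_domain (h : IsJordanFamily g D) (i : Fin N) (τ : Fin N × ℝ) : g τ.1 τ.2 ∉ D i := by
  intro hx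
  by_cases hj : τ.1 = i
  · exact Set.disjoint_left.1 (h.domain i).disjoint_range hx (hj ▸ ⟨τ.2, rfl⟩)
  · exact h.notMem_closure hj τ.2 (subset_closure hx)

lemma potGrad_eq_zero (h : IsJordanFamily g D) (hσ : Continuous σ) {i : Fin N}
    (heq : ∀ s, flux (fun τ => g τ.1 τ.2) σ 0 (g i s) (deriv (g i) s) = π * σ (i, s))
    {x₀ : ℂ} (hx₀ : x₀ ∈ D i) : potGrad (fun τ => g τ.1 τ.2) σ 0 x₀ = 0 := by
  by_contra hne
  have hp := h.isMild.continuous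
  set G := potGrad (fun τ => g τ.1 τ.2) σ with hG
  have hc : ContinuousAt (fun q : ℝ × ℂ => G q.1 q.2) (0, x₀) := by
    refine continuousAt_setIntegral_of_continuousOn (m := paramMeasure N) (isCompact_paramSet N)
      (isOpen_univ.prod (h.domain i).isOpen)
      (F := fun (q : ℝ × ℂ) (τ : Fin N × ℝ) =>
        (σ τ * (‖q.2 - g τ.1 τ.2‖ ^ 2 + q.1 ^ 2)⁻¹) • (q.2 - g τ.1 τ.2)) ?_ ⟨Set.mem_univ _, hx₀⟩
    have h1 : ContinuousOn (fun q : (ℝ × ℂ) × (Fin N × ℝ) =>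
        (‖q.1.2 - g q.2.1 q.2.2‖ ^ 2 + q.1.1 ^ 2)⁻¹) ((Set.univ ×ˢ D i) ×ˢ paramSet N) := by
      have hp' : Continuous fun q : (ℝ × ℂ) × (Fin N × ℝ) => g q.2.1 q.2.2 := hp.comp continuous_snd
      refine ContinuousOn.inv₀ (by fun_prop) ?_
      rintro ⟨⟨e, x⟩, τ⟩ ⟨⟨-, hx⟩, -⟩
      have : x - g τ.1 τ.2 ≠ 0 := fun h0 => h.notMem_domain i τ (sub_eq_zero.1 h0 ▸ hx)
      have := norm_pos_iff.2 this
      simp only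
      positivity
    have hp' : Continuous fun q : (ℝ × ℂ) × (Fin N × ℝ) => g q.2.1 q.2.2 := hp.comp continuous_snd
    exact ContinuousOn.smul (ContinuousOn.mul (by fun_prop) h1) (by fun_prop)
  have hn : 0 < ‖G 0 x₀‖ ^ 2 := by positivity
  have hc2 : ContinuousAt (fun q : ℝ × ℂ => ‖G q.1 q.2‖ ^ 2) (0, x₀) := hc.norm.pow 2
  have hev := hc2.eventually (lt_mem_nhds (half_lt_self hn))
  rw [nhds_prod_eq, Filter.eventually_prod_iff] at hev
  obtain ⟨P, hP, Q, hQ, hPQ⟩ := hev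
  obtain ⟨δ, hδ, hball⟩ := Metric.eventually_nhds_iff_ball.1
    (hQ.and ((h.domain i).isOpen.mem_nhds hx₀))
  set m := ‖G 0 x₀‖ ^ 2 / 2 with hm
  have hvol : 0 < volume.real (Metric.ball x₀ δ) :=
    ENNReal.toReal_pos (Metric.measure_ball_pos volume x₀ hδ).ne' measure_ball_lt_top.ne
  have hlow : ∀ᶠ ε : ℝ in 𝓝[>] 0, m * volume.real (Metric.ball x₀ δ)
      ≤ ∫ x in D i, ‖G ε x‖ ^ 2 := by
    filter_upwards [self_mem_nhdsWithin, hP.filter_mono nhdsWithin_le_nhds] with ε hε hPε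
    have hGc : Continuous (G ε) := (contDiff_potGrad hp hσ (ne_of_gt hε)).continuous
    have hi : IntegrableOn (fun x => ‖G ε x‖ ^ 2) (D i) :=
      ((by fun_prop : Continuous fun x => ‖G ε x‖ ^ 2).continuousOn.integrableOn_compact
        (h.domain i).isBounded.isCompact_closure).mono_set subset_closure
    have hsub : Metric.ball x₀ δ ⊆ D i := fun x hx => (hball x hx).2
    calc m * volume.real (Metric.ball x₀ δ) = ∫ _ in Metric.ball x₀ δ, m := by
          rw [setIntegral_const, smul_eq_mul, mul_comm]
      _ ≤ ∫ x in Metric.ball x₀ δ, ‖G ε x‖ ^ 2 :=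
          setIntegral_mono_on (integrableOn_const measure_ball_lt_top.ne)
            (hi.mono_set hsub) measurableSet_ball fun x hx => (hPQ hPε (hball x hx).1).le
      _ ≤ _ := setIntegral_mono_set hi (ae_of_all _ fun x => by positivity) hsub.eventuallyLE
  have := ge_of_tendsto (h.tendsto_integral_norm_potGrad_sq hσ heq) hlow
  have : 0 < m * volume.real (Metric.ball x₀ δ) := by positivity
  linarith

lemma exists_pot_eq (h : IsJordanFamily g D) (hσ : Continuous σ) {i : Fin N}
    (heq : ∀ s, flux (fun τ => g τ.1 τ.2) σ 0 (g i s) (deriv (g i) s) = π * σ (i, s)) :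
    ∃ v, ∀ t, pot (fun τ => g τ.1 τ.2) σ 0 (g i t) = v := by
  have hp := h.isMild.continuous
  have hpc := h.isMild.continuous_pot_zero hσ
  have hloc : ∀ x ∉ (D i)ᶜ, ∀ᶠ y in 𝓝 x, pot (fun τ => g τ.1 τ.2) σ 0 y
      = pot (fun τ => g τ.1 τ.2) σ 0 x := by
    intro x hx
    obtain ⟨δ, hδ, hball⟩ := Metric.isOpen_iff.1 (h.domain i).isOpen x (not_not.1 hx)
    have hd : ∀ y ∈ Metric.ball x δ,
        HasFDerivAt (pot (fun τ => g τ.1 τ.2) σ 0) (0 : ℂ →L[ℝ] ℝ) y := by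
      intro y hy
      have := hasFDerivAt_pot hp hσ (h.domain i).isOpen (ε := 0) (fun z hz τ _ => by
        have : z - g τ.1 τ.2 ≠ 0 := fun h0 => h.notMem_domain i τ (sub_eq_zero.1 h0 ▸ hz)
        have := norm_pos_iff.2 this
        positivity) (hball hy)
      rwa [h.potGrad_eq_zero hσ heq (hball hy), map_zero] at this
    filter_upwards [Metric.ball_mem_nhds x hδ] with y hy
    exact (convex_ball x δ).is_const_of_fderivWithin_eq_zero (𝕜 := ℝ)
      (fun z hz => (hd z hz).differentiableAt.differentiableWithinAt)
      (fun z hz => by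
        rw [fderivWithin_of_isOpen Metric.isOpen_ball hz, (hd z hz).fderiv])
      hy (Metric.mem_ball_self hδ)
  obtain ⟨r, hr, hs, -, -⟩ := (h.domain i).exists_side_subset (h.domain i).isOpen
    (h.domain i).isBounded (h.domain i).frontier_eq
  obtain ⟨a, ha⟩ := (side_nonempty (g := g i) hr)
  have hconst := IsPreconnected.eqOn_of_eventually_eq ((h.domain i).isPreconnected_side r)
    (h.domain i).isOpen.isClosed_compl (Set.disjoint_compl_right_iff_subset.2 hs) hloc ha
  refine ⟨pot (fun τ => g τ.1 τ.2) σ 0 a, fun t => ?_⟩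
  have hcl : closure (side (g i) r) ⊆ {x | pot (fun τ => g τ.1 τ.2) σ 0 x
      = pot (fun τ => g τ.1 τ.2) σ 0 a} :=
    closure_minimal hconst (isClosed_eq hpc continuous_const)
  refine hcl (mem_closure_of_tendsto (tendsto_add_real_mul (g i t)
    ((r : ℂ) * Complex.I * deriv (g i) t)) (eventually_mem_side ((h.domain i).regular t) ?_))
  rw [mul_div_cancel_right₀ _ ((h.domain i).regular t)]
  simp
  positivity

end IsJordanFamily

/-- The double parameter space. -/
abbrev Param2 (N : ℕ) : Type := (Fin N × ℝ) × (Fin N × ℝ)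

/-- The product measure on the double parameter space. -/
abbrev paramMeasure2 (N : ℕ) : Measure (Param2 N) := (paramMeasure N).prod (paramMeasure N)

/-- The product of the parameter sets. -/
abbrev paramSet2 (N : ℕ) : Set (Param2 N) := paramSet N ×ˢ paramSet N

lemma isCompact_paramSet2 (N : ℕ) : IsCompact (paramSet2 N) :=
  (isCompact_paramSet N).prod (isCompact_paramSet N)

lemma integrable_and_integral_swap {N : ℕ} {Z : Type*} [TopologicalSpace Z] [MeasurableSpace Z]
    [OpensMeasurableSpace Z] [SecondCountableTopology Z] {ν : Measure Z} [SFinite ν]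
    {w κ : Param2 N → ℝ} (hw : Continuous w) (hκ : ContinuousOn κ (paramSet2 N))
    {k : Param2 N → Z → ℝ} (hk : Continuous (Function.uncurry k)) (hk0 : ∀ τ z, 0 ≤ k τ z)
    (hi : ∀ τ ∈ paramSet2 N, Integrable (k τ) ν) (hκk : ∀ τ ∈ paramSet2 N, ∫ z, k τ z ∂ν = κ τ) :
    Integrable (fun z => ∫ τ in paramSet2 N, w τ * k τ z ∂paramMeasure2 N) ν ∧
      ∫ z, (∫ τ in paramSet2 N, w τ * k τ z ∂paramMeasure2 N) ∂ν
        = ∫ τ in paramSet2 N, w τ * κ τ ∂paramMeasure2 N := by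
  have hms := (isCompact_paramSet2 N).measurableSet
  have hcont : Continuous (Function.uncurry fun (τ : Param2 N) (z : Z) => w τ * k τ z) :=
    (hw.comp continuous_fst).mul hk
  have hI : Integrable (Function.uncurry fun (τ : Param2 N) (z : Z) => w τ * k τ z)
      (((paramMeasure2 N).restrict (paramSet2 N)).prod ν) := by
    rw [integrable_prod_iff hcont.aestronglyMeasurable]
    constructor
    · filter_upwards [ae_restrict_mem hms] with τ hτ
      exact (hi τ hτ).const_mul (w τ)
    · have h1 : IntegrableOn (fun τ => |w τ| * κ τ) (paramSet2 N) (paramMeasure2 N) :=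
        (hw.abs.continuousOn.mul hκ).integrableOn_compact (isCompact_paramSet2 N)
      refine h1.congr ?_
      filter_upwards [ae_restrict_mem hms] with τ hτ
      simp only [Function.uncurry_apply_pair, norm_mul, Real.norm_eq_abs, abs_of_nonneg (hk0 _ _)]
      rw [integral_const_mul, hκk τ hτ]
  refine ⟨hI.integral_prod_right, ?_⟩
  rw [← integral_integral_swap hI]
  refine setIntegral_congr_fun hms fun τ hτ => ?_
  simp only [integral_const_mul, hκk τ hτ]

section
variable {N : ℕ} {p : Fin N × ℝ → ℂ} {σ : Fin N × ℝ → ℝ}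

/-- Gaussian average of the charge. -/
def gaussPot (p : Fin N × ℝ → ℂ) (σ : Fin N × ℝ → ℝ) (s : ℝ) (z : ℂ) : ℝ :=
  ∫ τ in paramSet N, σ τ * Real.exp (-(2 * s) * ‖z - p τ‖ ^ 2) ∂paramMeasure N

/-- Gaussian energy of the charge. -/
def gaussEnergy (p : Fin N × ℝ → ℂ) (σ : Fin N × ℝ → ℝ) (s : ℝ) : ℝ :=
  ∫ τ in paramSet2 N, σ τ.1 * σ τ.2 * Real.exp (-s * ‖p τ.1 - p τ.2‖ ^ 2) ∂paramMeasure2 N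

lemma continuous_gaussPot (hp : Continuous p) (hσ : Continuous σ) (s : ℝ) :
    Continuous (gaussPot p σ s) := by
  rw [continuous_iff_continuousAt]
  intro x
  refine continuousAt_setIntegral_of_continuousOn (m := paramMeasure N) (isCompact_paramSet N)
    isOpen_univ (F := fun z τ => σ τ * Real.exp (-(2 * s) * ‖z - p τ‖ ^ 2)) ?_ (Set.mem_univ x)
  apply Continuous.continuousOn
  unfold Function.uncurry; fun_prop

lemma continuous_gaussEnergy (hp : Continuous p) (hσ : Continuous σ) :
    Continuous (gaussEnergy p σ) := by
  rw [continuous_iff_continuousAt]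
  intro x
  refine continuousAt_setIntegral_of_continuousOn (m := paramMeasure2 N) (isCompact_paramSet2 N)
    isOpen_univ (F := fun s τ => σ τ.1 * σ τ.2 * Real.exp (-s * ‖p τ.1 - p τ.2‖ ^ 2)) ?_
    (Set.mem_univ x)
  apply Continuous.continuousOn
  unfold Function.uncurry; fun_prop

lemma integral_gaussian_mul_gaussian {s : ℝ} (hs : 0 < s) (a b : ℂ) :
    Integrable (fun z => Real.exp (-(2 * s) * ‖z - a‖ ^ 2) * Real.exp (-(2 * s) * ‖z - b‖ ^ 2)) ∧
    ∫ z, Real.exp (-(2 * s) * ‖z - a‖ ^ 2) * Real.exp (-(2 * s) * ‖z - b‖ ^ 2)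
      = Real.exp (-s * ‖a - b‖ ^ 2) * (π / (4 * s)) := by
  have e : ∀ z : ℂ, Real.exp (-(2 * s) * ‖z - a‖ ^ 2) * Real.exp (-(2 * s) * ‖z - b‖ ^ 2)
      = Real.exp (-s * ‖a - b‖ ^ 2) * Real.exp (-(4 * s) * ‖z - (a + b) / 2‖ ^ 2) := by
    intro z
    rw [← Real.exp_add, ← Real.exp_add]
    congr 1
    simp only [← Complex.normSq_eq_norm_sq, Complex.normSq_apply, Complex.sub_re, Complex.sub_im,
      Complex.add_re, Complex.add_im, Complex.div_ofNat_re, Complex.div_ofNat_im]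
    ring
  have h1 : ∫ z : ℂ, Real.exp (-(4 * s) * ‖z - (a + b) / 2‖ ^ 2) = π / (4 * s) := by
    rw [integral_sub_right_eq_self (fun z : ℂ => Real.exp (-(4 * s) * ‖z‖ ^ 2)),
      GaussianFourier.integral_rexp_neg_mul_sq_norm (by positivity)]
    simp
  have h2 : Integrable fun z : ℂ => Real.exp (-(4 * s) * ‖z - (a + b) / 2‖ ^ 2) := by
    by_contra hn
    rw [integral_undef hn] at h1
    have : 0 < π / (4 * s) := by positivity
    linarith
  simp only [e]
  exact ⟨h2.const_mul _, by rw [integral_const_mul, h1]⟩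

lemma gaussEnergy_eq (hp : Continuous p) (hσ : Continuous σ) {s : ℝ} (hs : 0 < s) :
    Integrable (fun z => gaussPot p σ s z ^ 2) ∧
      ∫ z, gaussPot p σ s z ^ 2 = gaussEnergy p σ s * (π / (4 * s)) := by
  have key := integrable_and_integral_swap (N := N) (ν := (volume : Measure ℂ))
    (w := fun τ => σ τ.1 * σ τ.2)
    (κ := fun τ => Real.exp (-s * ‖p τ.1 - p τ.2‖ ^ 2) * (π / (4 * s)))
    (k := fun τ z => Real.exp (-(2 * s) * ‖z - p τ.1‖ ^ 2) * Real.exp (-(2 * s) * ‖z - p τ.2‖ ^ 2))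
    (by fun_prop) (by fun_prop) (by unfold Function.uncurry; fun_prop) (fun τ z => by positivity)
    (fun τ _ => (integral_gaussian_mul_gaussian hs _ _).1)
    (fun τ _ => (integral_gaussian_mul_gaussian hs _ _).2)
  have e : ∀ z, ∫ τ in paramSet2 N, σ τ.1 * σ τ.2 * (Real.exp (-(2 * s) * ‖z - p τ.1‖ ^ 2) *
      Real.exp (-(2 * s) * ‖z - p τ.2‖ ^ 2)) ∂paramMeasure2 N = gaussPot p σ s z ^ 2 := by
    intro z
    rw [sq, gaussPot, ← setIntegral_prod_mul]
    congr 1; ext τ; ring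
  simp only [e] at key
  refine ⟨key.1, key.2.trans ?_⟩
  rw [gaussEnergy, ← integral_mul_const]
  congr 1; ext τ; ring

lemma gaussEnergy_nonneg (hp : Continuous p) (hσ : Continuous σ) {s : ℝ} (hs : 0 < s) :
    0 ≤ gaussEnergy p σ s := by
  have h : 0 ≤ ∫ z, gaussPot p σ s z ^ 2 := integral_nonneg fun z => sq_nonneg _
  rw [(gaussEnergy_eq hp hσ hs).2] at h
  exact nonneg_of_mul_nonneg_left h (by positivity)

lemma gaussPot_eq_zero (hp : Continuous p) (hσ : Continuous σ) {s : ℝ} (hs : 0 < s)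
    (h : gaussEnergy p σ s = 0) (z : ℂ) : gaussPot p σ s z = 0 := by
  obtain ⟨h1, h2⟩ := gaussEnergy_eq hp hσ hs
  rw [h, zero_mul, integral_eq_zero_iff_of_nonneg (fun z => sq_nonneg _) h1] at h2
  have h3 := (Continuous.ae_eq_iff_eq (f := fun z => gaussPot p σ s z ^ 2) (g := fun _ => 0)
    volume ((continuous_gaussPot hp hσ s).pow 2) continuous_const).1 h2
  exact pow_eq_zero_iff two_ne_zero |>.1 (congrFun h3 z)

lemma integral_exp_neg_mul_add {r a : ℝ} (hr : 0 ≤ r) (ha : 0 < a) :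
    IntegrableOn (fun s => Real.exp (-s * (r + a))) (Set.Ioi 0) ∧
      ∫ s in Set.Ioi (0:ℝ), Real.exp (-s * (r + a)) = (r + a)⁻¹ := by
  have hlt : -(r + a) < 0 := by linarith
  have e : ∀ s, -s * (r + a) = -(r + a) * s := fun s => by ring
  simp only [e]
  refine ⟨integrableOn_exp_mul_Ioi hlt 0, ?_⟩
  rw [integral_exp_mul_Ioi hlt 0]
  rw [mul_zero, Real.exp_zero, neg_div_neg_eq, one_div]

lemma integral_exp_mul_gaussEnergy (hp : Continuous p) (hσ : Continuous σ) {a : ℝ} (ha : 0 < a) :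
    IntegrableOn (fun s => Real.exp (-s * a) * gaussEnergy p σ s) (Set.Ioi 0) ∧
    ∫ s in Set.Ioi (0:ℝ), Real.exp (-s * a) * gaussEnergy p σ s
      = ∫ τ in paramSet2 N, σ τ.1 * σ τ.2 * (‖p τ.1 - p τ.2‖ ^ 2 + a)⁻¹ ∂paramMeasure2 N := by
  have key := integrable_and_integral_swap (N := N) (ν := (volume : Measure ℝ).restrict (Set.Ioi 0))
    (w := fun τ => σ τ.1 * σ τ.2)
    (κ := fun τ => (‖p τ.1 - p τ.2‖ ^ 2 + a)⁻¹)
    (k := fun τ s => Real.exp (-s * (‖p τ.1 - p τ.2‖ ^ 2 + a)))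
    (by fun_prop) (Continuous.continuousOn
      (Continuous.inv₀ (by fun_prop) fun τ => by positivity))
    (by unfold Function.uncurry; fun_prop) (fun τ z => by positivity)
    (fun τ _ => (integral_exp_neg_mul_add (by positivity) ha).1)
    (fun τ _ => (integral_exp_neg_mul_add (by positivity) ha).2)
  have e : ∀ s, ∫ τ in paramSet2 N, σ τ.1 * σ τ.2 * Real.exp (-s * (‖p τ.1 - p τ.2‖ ^ 2 + a))
      ∂paramMeasure2 N = Real.exp (-s * a) * gaussEnergy p σ s := by
    intro s
    rw [gaussEnergy, ← integral_const_mul]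
    congr 1; ext τ
    rw [mul_add, Real.exp_add]; ring
  simp only [e] at key
  exact key

lemma integral_charge_inv_nonneg (hp : Continuous p) (hσ : Continuous σ) {a : ℝ} (ha : 0 < a) :
    0 ≤ ∫ τ in paramSet2 N, σ τ.1 * σ τ.2 * (‖p τ.1 - p τ.2‖ ^ 2 + a)⁻¹ ∂paramMeasure2 N := by
  rw [← (integral_exp_mul_gaussEnergy hp hσ ha).2]
  exact setIntegral_nonneg measurableSet_Ioi fun s hs =>
    mul_nonneg (Real.exp_nonneg _) (gaussEnergy_nonneg hp hσ hs)

lemma gaussEnergy_eq_zero (hp : Continuous p) (hσ : Continuous σ) {a : ℝ} (ha : 0 < a)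
    (h : ∫ τ in paramSet2 N, σ τ.1 * σ τ.2 * (‖p τ.1 - p τ.2‖ ^ 2 + a)⁻¹ ∂paramMeasure2 N = 0)
    {s : ℝ} (hs : 0 < s) : gaussEnergy p σ s = 0 := by
  obtain ⟨h1, h2⟩ := integral_exp_mul_gaussEnergy hp hσ ha
  have hc := continuous_gaussEnergy hp hσ
  rw [h, setIntegral_eq_zero_iff_of_nonneg_ae _ h1] at h2
  · have := Measure.eqOn_open_of_ae_eq h2 isOpen_Ioi
      (by fun_prop : Continuous fun s => Real.exp (-s * a) * gaussEnergy p σ s).continuousOn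
      continuousOn_const hs
    simpa using this
  · filter_upwards [ae_restrict_mem measurableSet_Ioi] with s hs
    exact mul_nonneg (Real.exp_nonneg _) (gaussEnergy_nonneg hp hσ hs)

end

section
variable {N : ℕ} {p : Fin N × ℝ → ℂ} {σ : Fin N × ℝ → ℝ}

/-- Logarithmic energy of the charge `σ`, regularized at scale `√a`. -/
def logEnergy (p : Fin N × ℝ → ℂ) (σ : Fin N × ℝ → ℝ) (a : ℝ) : ℝ :=
  ∫ τ in paramSet2 N, σ τ.1 * σ τ.2 * Real.log (‖p τ.1 - p τ.2‖ ^ 2 + a) ∂paramMeasure2 N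

lemma hasDerivAt_logEnergy (hp : Continuous p) (hσ : Continuous σ) {a : ℝ} (ha : 0 < a) :
    HasDerivAt (logEnergy p σ)
      (∫ τ in paramSet2 N, σ τ.1 * σ τ.2 * (‖p τ.1 - p τ.2‖ ^ 2 + a)⁻¹ ∂paramMeasure2 N) a := by
  have hpos : ∀ q ∈ (Set.Ioi (0:ℝ)) ×ˢ paramSet2 N,
      ‖p q.2.1 - p q.2.2‖ ^ 2 + q.1 ≠ 0 := fun q hq => by
    have : 0 < q.1 := hq.1
    positivity
  have hw : ContinuousOn (fun q : ℝ × Param2 N => σ q.2.1 * σ q.2.2)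
      (Set.Ioi (0:ℝ) ×ˢ paramSet2 N) := by fun_prop
  have hr : ContinuousOn (fun q : ℝ × Param2 N => ‖p q.2.1 - p q.2.2‖ ^ 2 + q.1)
      (Set.Ioi (0:ℝ) ×ˢ paramSet2 N) := by fun_prop
  have h := hasFDerivAt_setIntegral_of_continuousOn (𝕜 := ℝ) (m := paramMeasure2 N)
    (isCompact_paramSet2 N) (isOpen_Ioi (a := (0:ℝ)))
    (F := fun a τ => σ τ.1 * σ τ.2 * Real.log (‖p τ.1 - p τ.2‖ ^ 2 + a))
    (F' := fun a τ => (σ τ.1 * σ τ.2 * (‖p τ.1 - p τ.2‖ ^ 2 + a)⁻¹) • (1 : ℝ →L[ℝ] ℝ))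
    ?_ ?_ ?_ (x₀ := a) ha
  · rw [integral_smul_const] at h
    have h2 := h.hasDerivAt
    simp only [_root_.smul_apply, one_apply_eq_self, smul_eq_mul,
      mul_one] at h2
    exact h2
  · exact hw.mul (hr.log hpos)
  · exact (hw.mul (hr.inv₀ hpos)).smul continuousOn_const
  · intro x hx τ hτ
    have hx0 := hpos (x, τ) ⟨hx, hτ⟩
    have h1 : HasDerivAt (fun x => σ τ.1 * σ τ.2 * Real.log (‖p τ.1 - p τ.2‖ ^ 2 + x))
        (σ τ.1 * σ τ.2 * (‖p τ.1 - p τ.2‖ ^ 2 + x)⁻¹) x := by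
      have := (((hasDerivAt_id x).const_add (‖p τ.1 - p τ.2‖ ^ 2)).log hx0).const_mul
        (σ τ.1 * σ τ.2)
      simpa using this
    refine h1.hasFDerivAt.congr_fderiv ?_
    ext; simp

lemma integrableOn_logEnergy (hp : Continuous p) (hσ : Continuous σ) {a : ℝ} (ha : 0 < a) :
    IntegrableOn (fun τ : Param2 N => σ τ.1 * σ τ.2 * Real.log (‖p τ.1 - p τ.2‖ ^ 2 + a))
      (paramSet2 N) (paramMeasure2 N) := by
  have : Continuous fun τ : Param2 N => Real.log (‖p τ.1 - p τ.2‖ ^ 2 + a) :=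
    Continuous.log (by fun_prop) fun τ => by positivity
  exact (by fun_prop : Continuous _).continuousOn.integrableOn_compact (isCompact_paramSet2 N)

lemma tendsto_logEnergy_atTop (hp : Continuous p) (hσ : Continuous σ)
    (h0 : ∫ τ in paramSet N, σ τ ∂paramMeasure N = 0) :
    Tendsto (logEnergy p σ) atTop (𝓝 0) := by
  have hw : IntegrableOn (fun τ : Param2 N => σ τ.1 * σ τ.2) (paramSet2 N) (paramMeasure2 N) :=
    (by fun_prop : Continuous _).continuousOn.integrableOn_compact (isCompact_paramSet2 N)
  have hd : IntegrableOn (fun τ : Param2 N => |σ τ.1 * σ τ.2| * ‖p τ.1 - p τ.2‖ ^ 2)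
      (paramSet2 N) (paramMeasure2 N) :=
    (by fun_prop : Continuous _).continuousOn.integrableOn_compact (isCompact_paramSet2 N)
  have hw0 : ∫ τ in paramSet2 N, σ τ.1 * σ τ.2 ∂paramMeasure2 N = 0 := by
    rw [setIntegral_prod_mul, h0, zero_mul]
  set C := ∫ τ in paramSet2 N, |σ τ.1 * σ τ.2| * ‖p τ.1 - p τ.2‖ ^ 2 ∂paramMeasure2 N
  refine squeeze_zero_norm' (a := fun a : ℝ => C * a⁻¹) ?_ ?_
  · filter_upwards [eventually_gt_atTop 0] with a ha
    have e : logEnergy p σ a = ∫ τ in paramSet2 N, (σ τ.1 * σ τ.2 *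
        Real.log (‖p τ.1 - p τ.2‖ ^ 2 + a) - σ τ.1 * σ τ.2 * Real.log a) ∂paramMeasure2 N := by
      rw [integral_sub (integrableOn_logEnergy hp hσ ha) (hw.mul_const _), integral_mul_const,
        hw0, zero_mul, sub_zero]
      rfl
    rw [e, ← integral_mul_const]
    refine norm_integral_le_of_norm_le (hd.mul_const _) (Eventually.of_forall fun τ => ?_)
    rw [← mul_sub, norm_mul, Real.norm_eq_abs, Real.norm_eq_abs, mul_assoc]
    refine mul_le_mul_of_nonneg_left ?_ (abs_nonneg _)
    set d := ‖p τ.1 - p τ.2‖ ^ 2 with hd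
    have hd0 : 0 ≤ d := by positivity
    rw [← Real.log_div (by positivity) ha.ne', abs_of_nonneg (Real.log_nonneg (by
      rw [le_div_iff₀ ha]; linarith))]
    refine (Real.log_le_sub_one_of_pos (by positivity)).trans (le_of_eq ?_)
    field_simp; ring
  · simpa using tendsto_inv_atTop_zero.const_mul C

lemma logEnergy_sq (hp : Continuous p) (hσ : Continuous σ) {ε : ℝ} (hε : ε ≠ 0) :
    logEnergy p σ (ε ^ 2) = 2 * ∫ τ in paramSet N, σ τ * pot p σ ε (p τ) ∂paramMeasure N := by
  rw [logEnergy, setIntegral_prod _ (integrableOn_logEnergy hp hσ (by positivity)),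
    ← integral_const_mul]
  congr 1; ext τ
  rw [pot, ← mul_assoc, ← integral_const_mul]
  congr 1; ext τ'
  ring

lemma tendsto_logEnergy_sq (hp : IsMild p) (hσ : Continuous σ) :
    Tendsto (fun ε => logEnergy p σ (ε ^ 2)) (𝓝[>] 0)
      (𝓝 (2 * ∫ τ in paramSet N, σ τ * pot p σ 0 (p τ) ∂paramMeasure N)) := by
  have hc := hp.continuous
  obtain ⟨C, hC0, hC⟩ := hp.exists_abs_pot_sub_le hσ
  have hcε : ∀ ε, ε ≠ 0 → Continuous (pot p σ ε) := fun ε hε => (contDiff_pot hc hσ hε).continuous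
  have h0 := hp.continuous_pot_zero hσ
  have hi : ∀ f : ℂ → ℝ, Continuous f →
      IntegrableOn (fun τ => σ τ * f (p τ)) (paramSet N) (paramMeasure N) := fun f hf =>
    (by fun_prop : Continuous _).continuousOn.integrableOn_compact (isCompact_paramSet N)
  have hia : IntegrableOn (fun τ => |σ τ|) (paramSet N) (paramMeasure N) :=
    hσ.abs.continuousOn.integrableOn_compact (isCompact_paramSet N)
  rw [tendsto_iff_norm_sub_tendsto_zero]
  refine squeeze_zero' (g := fun ε =>
    2 * ((∫ τ in paramSet N, |σ τ| ∂paramMeasure N) * (C * √|ε|))) ?_ ?_ ?_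
  · exact Eventually.of_forall fun _ => norm_nonneg _
  · filter_upwards [self_mem_nhdsWithin] with ε hε
    have hε0 : ε ≠ 0 := ne_of_gt hε
    rw [logEnergy_sq hc hσ hε0, ← mul_sub, ← integral_sub (hi _ (hcε ε hε0)) (hi _ h0), norm_mul,
      Real.norm_ofNat, ← integral_mul_const]
    refine mul_le_mul_of_nonneg_left (norm_integral_le_of_norm_le (hia.mul_const _)
      (Eventually.of_forall fun τ => ?_)) zero_le_two
    rw [← mul_sub, norm_mul, Real.norm_eq_abs, Real.norm_eq_abs]
    refine mul_le_mul_of_nonneg_left ?_ (abs_nonneg _)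
    simpa using hC ε (p τ) (p τ)
  · have : Continuous fun ε : ℝ =>
        2 * ((∫ τ in paramSet N, |σ τ| ∂paramMeasure N) * (C * √|ε|)) := by fun_prop
    have := this.tendsto 0
    simp only [abs_zero, Real.sqrt_zero, mul_zero] at this
    exact this.mono_left nhdsWithin_le_nhds

lemma gaussPot_eq_zero_of_energy (hp : IsMild p) (hσ : Continuous σ)
    (h0 : ∫ τ in paramSet N, σ τ ∂paramMeasure N = 0)
    (h1 : ∫ τ in paramSet N, σ τ * pot p σ 0 (p τ) ∂paramMeasure N = 0) {s : ℝ} (hs : 0 < s)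
    (z : ℂ) : gaussPot p σ s z = 0 := by
  have hc := hp.continuous
  have hmono : MonotoneOn (logEnergy p σ) (Set.Ioi 0) := by
    refine monotoneOn_of_deriv_nonneg (convex_Ioi 0)
      (fun a ha => (hasDerivAt_logEnergy hc hσ ha).continuousAt.continuousWithinAt) ?_ ?_
    · rw [interior_Ioi]
      exact fun a ha => (hasDerivAt_logEnergy hc hσ ha).differentiableAt.differentiableWithinAt
    · rw [interior_Ioi]
      intro a ha
      rw [(hasDerivAt_logEnergy hc hσ ha).deriv]
      exact integral_charge_inv_nonneg hc hσ ha
  have hzero : ∀ a, 0 < a → logEnergy p σ a = 0 := by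
    intro a ha
    apply le_antisymm
    · refine ge_of_tendsto (tendsto_logEnergy_atTop hc hσ h0) ?_
      filter_upwards [eventually_ge_atTop a] with b hb
      exact hmono ha (ha.trans_le hb) hb
    · have h2 := tendsto_logEnergy_sq hp hσ
      rw [h1, mul_zero] at h2
      refine le_of_tendsto h2 ?_
      filter_upwards [Ioc_mem_nhdsGT (Real.sqrt_pos.2 ha)] with ε hε
      refine hmono (pow_pos hε.1 2 : (0:ℝ) < ε ^ 2) ha ?_
      calc ε ^ 2 ≤ (√a) ^ 2 := by have := hε.1; gcongr; exact hε.2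
        _ = a := Real.sq_sqrt ha.le
  have hd : HasDerivAt (logEnergy p σ) 0 1 := by
    refine (hasDerivAt_const (1:ℝ) (0:ℝ)).congr_of_eventuallyEq ?_
    filter_upwards [Ioi_mem_nhds (zero_lt_one' ℝ)] with a ha
    exact hzero a ha
  exact gaussPot_eq_zero hc hσ hs (gaussEnergy_eq_zero hc hσ one_pos
    ((hasDerivAt_logEnergy hc hσ one_pos).unique hd) hs) z

instance : (Measure.count : Measure (Fin N)).IsOpenPosMeasure :=
  ⟨fun _ _ hne => Measure.count_ne_zero hne⟩

/-- A charge on a curve whose Gaussian averages at a simple point all vanish is zero there. -/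
lemma eq_zero_of_gaussPot_eq_zero (hp : Continuous p) (hσ : Continuous σ) {τ₀ : Fin N × ℝ}
    (hτ₀ : τ₀.2 ∈ Set.Ioo 0 (2 * π)) (hinj : ∀ τ ∈ paramSet N, τ ≠ τ₀ → p τ ≠ p τ₀)
    (h : ∀ s, 0 < s → gaussPot p σ s (p τ₀) = 0) : σ τ₀ = 0 := by
  have hmem : τ₀ ∈ paramSet N := ⟨Set.mem_univ _, hτ₀.1.le, hτ₀.2.le⟩
  have hopen : IsOpen ((Set.univ : Set (Fin N)) ×ˢ Set.Ioo 0 (2 * π)) := isOpen_univ.prod isOpen_Ioo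
  have key := tendsto_setIntegral_pow_smul_of_unique_maximum_of_isCompact_of_measure_nhdsWithin_pos
    (μ := paramMeasure N) (s := paramSet N) (isCompact_paramSet N) (x₀ := τ₀)
    (c := fun τ => Real.exp (-2 * ‖p τ₀ - p τ‖ ^ 2)) (g := σ) ?_ ?_ ?_ ?_ ?_ hmem
    (hσ.continuousOn.integrableOn_compact (isCompact_paramSet N)) hσ.continuousWithinAt
  · refine tendsto_nhds_unique key (tendsto_const_nhds.congr' ?_)
    filter_upwards [eventually_gt_atTop 0] with n hn
    have h2 := h n (by exact_mod_cast hn)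
    rw [gaussPot] at h2
    have e : ∫ τ in paramSet N, Real.exp (-2 * ‖p τ₀ - p τ‖ ^ 2) ^ n • σ τ ∂paramMeasure N = 0 := by
      rw [← h2]
      congr 1; ext τ
      rw [← Real.exp_nat_mul, smul_eq_mul, mul_comm]
      congr 2; ring
    rw [e, smul_zero]
  · intro u hu hx
    have hu' := hu.inter hopen
    refine lt_of_lt_of_le (hu'.measure_pos (paramMeasure N) ⟨τ₀, hx, Set.mem_univ _, hτ₀⟩)
      (measure_mono fun τ hτ => ⟨hτ.1, Set.mem_univ _, hτ.2.2.1.le, hτ.2.2.2.le⟩)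
  · exact (by fun_prop : Continuous _).continuousOn
  · intro τ hτ hne
    refine Real.exp_lt_exp.2 ?_
    have := sub_ne_zero.2 (hinj τ hτ hne).symm
    have : 0 < ‖p τ₀ - p τ‖ := norm_pos_iff.2 this
    simp only [sub_self, norm_zero]
    nlinarith [sq_nonneg ‖p τ₀ - p τ‖, pow_pos this 2]
  · intro τ _; positivity
  · positivity
end

namespace IsJordanFamily
variable {N : ℕ} {g : Fin N → ℝ → ℂ} {D : Fin N → Set ℂ} {σ : Fin N × ℝ → ℝ}

lemma apply_ne_apply (h : IsJordanFamily g D) {τ τ₀ : Fin N × ℝ} (hτ₀ : τ₀.2 ∈ Set.Ioo 0 (2 * π))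
    (hτ : τ ∈ paramSet N) (hne : τ ≠ τ₀) : g τ.1 τ.2 ≠ g τ₀.1 τ₀.2 := by
  obtain ⟨i, t⟩ := τ
  obtain ⟨j, s⟩ := τ₀
  intro he
  simp only at he hτ₀
  obtain ⟨-, ht⟩ := hτ
  simp only at ht
  rcases eq_or_ne i j with rfl | hij
  · obtain ⟨k, hk⟩ := (h.domain i).eq_of_apply_eq he
    have hp : (0:ℝ) < 2 * π := by positivity
    have h1 : (k:ℝ) < 1 := by
      by_contra! hc
      nlinarith [ht.2, hτ₀.1]
    have h2 : (-1:ℝ) < k := by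
      by_contra! hc
      nlinarith [ht.1, hτ₀.2]
    have h3 : k = 0 := by
      have h1' : k < 1 := by exact_mod_cast h1
      have h2' : -1 < k := by exact_mod_cast h2
      omega
    rw [h3, Int.cast_zero, zero_mul, add_zero] at hk
    exact hne (by rw [hk])
  · exact h.notMem_closure hij t (he ▸ h.mem_closure j s)

/-- The operator `½I + K + L` is injective on charges carried by Jordan curves. -/
theorem charge_eq_zero (h : IsJordanFamily g D) (hσ : Continuous σ)
    (hper : ∀ j, Function.Periodic (fun t => σ (j, t)) (2 * π))
    (heq : ∀ i s, flux (fun τ => g τ.1 τ.2) σ 0 (g i s) (deriv (g i) s)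
      = 2 * π * (1 / 2 * σ (i, s) + (∫ t in (0:ℝ)..(2 * π), σ (i, t)) * ‖deriv (g i) s‖))
    (i : Fin N) (s : ℝ) : σ (i, s) = 0 := by
  have hp := h.isMild
  have hc : ∀ i, ∫ t in (0:ℝ)..(2 * π), σ (i, t) = 0 := fun i =>
    h.integral_charge_eq_zero hσ rfl (heq i)
  choose v hv using fun i => h.exists_pot_eq hσ (i := i) fun s => by
    rw [heq, hc]; ring
  have hi : IntegrableOn σ (paramSet N) (paramMeasure N) :=
    hσ.continuousOn.integrableOn_compact (isCompact_paramSet N)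
  have hpot := hp.continuous_pot_zero hσ
  have hgc := hp.continuous
  have hi' : IntegrableOn (fun τ => σ τ * pot (fun τ => g τ.1 τ.2) σ 0 (g τ.1 τ.2))
      (paramSet N) (paramMeasure N) :=
    (hσ.mul (hpot.comp hgc)).continuousOn.integrableOn_compact (isCompact_paramSet N)
  have h0 : ∫ τ in paramSet N, σ τ ∂paramMeasure N = 0 := by
    rw [integral_paramSet hi]
    exact Finset.sum_eq_zero fun j _ => hc j
  have h1 : ∫ τ in paramSet N, σ τ * pot (fun τ => g τ.1 τ.2) σ 0 (g τ.1 τ.2) ∂paramMeasure N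
      = 0 := by
    rw [integral_paramSet hi']
    refine Finset.sum_eq_zero fun j _ => ?_
    simp only [hv]
    rw [intervalIntegral.integral_mul_const, hc, zero_mul]
  have hz : Set.EqOn (fun t => σ (i, t)) (fun _ => 0) (Set.Ioo 0 (2 * π)) := fun t ht =>
    eq_zero_of_gaussPot_eq_zero (p := fun τ => g τ.1 τ.2) hgc hσ (τ₀ := (i, t)) ht
      (fun τ hτ hne => h.apply_ne_apply (τ₀ := (i, t)) ht hτ hne)
      fun s hs => gaussPot_eq_zero_of_energy hp hσ h0 h1 hs _
  have hz' := hz.closure (by fun_prop) continuous_const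
  rw [closure_Ioo (by positivity)] at hz'
  obtain ⟨y, hy, hsy⟩ := (hper i).exists_mem_Ico₀ (by positivity) s
  exact hsy.trans (hz' ⟨hy.1, hy.2.le⟩)

end IsJordanFamily

/-- The standard isometry between the Euclidean plane and `ℂ`. -/
def planeIso : E2 ≃ₗᵢ[ℝ] ℂ := Complex.orthonormalBasisOneI.repr.symm

lemma planeIso_apply (x : E2) : planeIso x = ⟨x 0, x 1⟩ := by
  rw [planeIso, Complex.orthonormalBasisOneI_repr_symm_apply]
  apply Complex.ext <;> simp

lemma cross_planeIso (x y : E2) : cross (planeIso x) (planeIso y) = x 0 * y 1 - x 1 * y 0 := by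
  simp [cross, planeIso_apply]

lemma deriv_planeIso_comp {c : ℝ → E2} (hc : ContDiff ℝ 2 c) (t : ℝ) :
    deriv (fun t => planeIso (c t)) t = planeIso (deriv c t) :=
  (planeIso.toContinuousLinearEquiv.toContinuousLinearMap.hasFDerivAt.comp_hasDerivAt t
    (hc.differentiable (by norm_num) t).hasDerivAt).deriv

/-- The operator `½I + K + L` is injective: if `(½I + K + L)μ = 0` (with `L` the
block diagonal operator `L i μ i (x) = ∫_{Γ i} μ i ds`), then `μ = 0`. -/
theorem half_plus_K_plus_L_injective
    (N : ℕ) (D : Fin N → Set E2)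
    (hopen : ∀ j, IsOpen (D j)) (hbdd : ∀ j, Bornology.IsBounded (D j))
    (hdisj : Pairwise fun i j => Disjoint (closure (D i)) (closure (D j)))
    (γ : Fin N → ℝ → E2)
    (hγ : ∀ j, ContDiff ℝ 2 (γ j))
    (hper : ∀ j t, γ j (t + 2*π) = γ j t)
    (hreg : ∀ j t, deriv (γ j) t ≠ 0)
    (hinj : ∀ j, Set.InjOn (γ j) (Set.Ico 0 (2*π)))
    (hfront : ∀ j, frontier (D j) = Set.range (γ j))
    (horient : ∀ j, (1/2) * ∫ t in (0:ℝ)..(2*π),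
        (γ j t 0 * deriv (γ j) t 1 - γ j t 1 * deriv (γ j) t 0) = (volume (D j)).toReal)
    (μ : Fin N → ℝ → ℝ)
    (hμc : ∀ j, Continuous (μ j))
    (hμper : ∀ j t, μ j (t + 2*π) = μ j t)
    (heq : ∀ i s, (1/2) * μ i s
        + (∑ j, ∫ t in (0:ℝ)..(2*π), Kker γ i j s t * μ j t)
        + (∫ t in (0:ℝ)..(2*π), μ i t * ‖deriv (γ i) t‖) = 0) :
    ∀ i s, μ i s = 0 := by
  set g : Fin N → ℝ → ℂ := fun j t => planeIso (γ j t) with hg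
  have hd : ∀ j t, deriv (g j) t = planeIso (deriv (γ j) t) := fun j t =>
    deriv_planeIso_comp (hγ j) t
  have hdc : ∀ j, Continuous (deriv (γ j)) := fun j => (hγ j).continuous_deriv (by norm_num)
  have hfam : IsJordanFamily g fun j => planeIso '' D j := by
    refine ⟨fun j => ?_, fun i j hij => ?_⟩
    · refine {
        contDiff := planeIso.contDiff.comp (hγ j)
        periodic := fun t => ?_
        regular := ?_
        injOn := ?_
        isOpen := ?_
        isBounded := ?_
        frontier_eq := ?_
        orient := ?_ }
      · simp only [hg, hper]
      · intro t
        rw [hd]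
        exact (map_ne_zero_iff planeIso planeIso.injective).2 (hreg j t)
      · exact planeIso.injective.comp_injOn (hinj j)
      · exact planeIso.toHomeomorph.isOpen_image.2 (hopen j)
      · exact planeIso.lipschitz.isBounded_image (hbdd j)
      · rw [← planeIso.coe_toHomeomorph, ← planeIso.toHomeomorph.image_frontier, hfront,
          ← Set.range_comp]
        rfl
      · simp only [hd]
        simp only [hg, cross_planeIso]
        rw [horient, ← planeIso.coe_toMeasurableEquiv, planeIso.toMeasurableEquiv.image_eq_preimage_symm]
        congr 1
        exact (planeIso.symm.measurePreserving.measure_preimage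
          (hopen j).measurableSet.nullMeasurableSet).symm
    · have := (Set.disjoint_image_iff planeIso.injective).2 (hdisj hij)
      rwa [← planeIso.coe_toHomeomorph, planeIso.toHomeomorph.image_closure,
        planeIso.toHomeomorph.image_closure] at this
  set σ : Fin N × ℝ → ℝ := fun τ => μ τ.1 τ.2 * ‖deriv (γ τ.1) τ.2‖ with hσdef
  have hσ : Continuous σ := continuous_uncurry_fin (g := fun j t => μ j t * ‖deriv (γ j) t‖)
    fun j => (hμc j).mul (hdc j).norm
  have hdper : ∀ j t, deriv (γ j) (t + 2 * π) = deriv (γ j) t := fun j t => by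
    rw [← deriv_comp_add_const]
    congr 1
    exact funext (hper j)
  have hmain := hfam.charge_eq_zero hσ (fun j t => by simp only [hσdef, hμper, hdper]) ?_
  · intro i s
    have := hmain i s
    exact (mul_eq_zero.1 this).resolve_right (norm_ne_zero_iff.2 (hreg i s))
  · intro i s
    have hn : ‖deriv (γ i) s‖ ≠ 0 := norm_ne_zero_iff.2 (hreg i s)
    obtain ⟨C, -, hC⟩ := hfam.exists_abs_flux hσ i
    have hflux : flux (fun τ => g τ.1 τ.2) σ 0 (g i s) (deriv (g i) s)
        = -(2 * π) * ‖deriv (γ i) s‖ * ∑ j, ∫ t in (0:ℝ)..(2*π), Kker γ i j s t * μ j t := by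
      have e : flux (fun τ => g τ.1 τ.2) σ 0 (g i s) (deriv (g i) s) = _ :=
        (by simp only [flux, zero_pow two_ne_zero, add_zero] :
          _ = ∫ τ in paramSet N, σ τ * ((‖g i s - g τ.1 τ.2‖ ^ 2)⁻¹ *
            cross (g i s - g τ.1 τ.2) (deriv (g i) s)) ∂paramMeasure N).trans
          (integral_paramSet (hC s).2.1)
      rw [e, Finset.mul_sum]
      refine Finset.sum_congr rfl fun j _ => ?_
      rw [← intervalIntegral.integral_const_mul]
      congr 1; ext t
      simp only [hd]
      simp only [hg, hσdef, ← map_sub, cross_planeIso, planeIso.norm_map, Kker]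
      have hpi := Real.pi_ne_zero
      rcases eq_or_ne (‖γ i s - γ j t‖) 0 with h0 | h0
      · simp [h0]
      · field_simp
    have h2 := heq i s
    have e2 : ∑ j, ∫ t in (0:ℝ)..(2*π), Kker γ i j s t * μ j t
        = -((1/2) * μ i s) - ∫ t in (0:ℝ)..(2*π), μ i t * ‖deriv (γ i) t‖ := by linarith
    rw [hflux, e2, hd, planeIso.norm_map]
    simp only [hσdef]
    ring
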